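/- Let A ≥ p be a real number. Let (a_i)_{i≥0} be a sequence with a_0 ∈ S_p and a_i ∈ S'_p for all i ≥ 1 which is quasi-periodic with data (n_i), (λ_i), (k_i), is not ultimately periodic, satisfies |a_i|_p ≤ A for every i, and for which the sequence (k_i)_{i≥0} is bounded. If limsup_{i→∞} λ_i/n_i > 4·log A/log p − 1, then the value α of the infinite Ruban continued fraction [a_0, a_1, a_2, …] is either algebraic of degree exactly 2 over ℚ or transcendental over ℚ. -/

import Mathlib

open Filter Polynomial

/-- `S_p`: rationals `b` with `b·p^k ∈ ℤ` for some `k ≥ 0` and `0 ≤ b < p`. -/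
def Sp (p : ℕ) : Set ℚ :=
  {b : ℚ | (∃ k : ℕ, ∃ z : ℤ, (z : ℚ) = b * (p : ℚ) ^ k) ∧ 0 ≤ b ∧ b < (p : ℚ)}

/-- `S'_p`: elements of `S_p` with `|b|_p ≥ p`. -/
def Sp' (p : ℕ) : Set ℚ :=
  {b : ℚ | b ∈ Sp p ∧ (p : ℚ) ≤ padicNorm p b}

/-- Denominators of the convergents, with shifted index: `rubanQ a 0 = q_{-1} = 0`,
`rubanQ a 1 = q_0 = 1`, and `rubanQ a (n+1) = q_n = a_n q_{n-1} + q_{n-2}`. -/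
def rubanQ (a : ℕ → ℚ) : ℕ → ℚ
  | 0 => 0
  | 1 => 1
  | n + 2 => a (n + 1) * rubanQ a (n + 1) + rubanQ a n

/-- Numerators of the convergents, with shifted index: `rubanR a 0 = r_{-1} = 1`,
`rubanR a 1 = r_0 = a_0`, and `rubanR a (n+1) = r_n = a_n r_{n-1} + r_{n-2}`. -/
def rubanR (a : ℕ → ℚ) : ℕ → ℚ
  | 0 => 1
  | 1 => a 0
  | n + 2 => a (n + 1) * rubanR a (n + 1) + rubanR a n

/-- `α` is the value of the infinite Ruban continued fraction `[a_0, a_1, …]`, i.e. the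
limit in `ℚ_p` of the convergents `r_n / q_n`. -/
def IsRubanValue (p : ℕ) [Fact p.Prime] (a : ℕ → ℚ) (α : ℚ_[p]) : Prop :=
  Filter.Tendsto (fun n : ℕ => ((rubanR a (n + 1) / rubanQ a (n + 1) : ℚ) : ℚ_[p]))
    Filter.atTop (nhds α)

/-- A sequence is ultimately periodic if `a_{n+l} = a_n` for all `n ≥ k`,
for some `k ≥ 0`, `l ≥ 1`. -/
def UltimatelyPeriodic (a : ℕ → ℚ) : Prop :=
  ∃ k l : ℕ, 1 ≤ l ∧ ∀ n, k ≤ n → a (n + l) = a n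

namespace Roth

section Shift

variable {σ R S T : Type*} [CommRing R] [CommRing S] [CommRing T]

/-- The Taylor shift `P(X + a)`. -/
noncomputable def shift [Algebra R S] (a : σ → S) : MvPolynomial σ R →ₐ[R] MvPolynomial σ S :=
  MvPolynomial.aeval fun i => MvPolynomial.X i + MvPolynomial.C (a i)

lemma coeff_prod_aeval_X [Fintype σ] (f : σ → S[X]) (J : σ →₀ ℕ) :
    MvPolynomial.coeff J (∏ i, Polynomial.aeval (MvPolynomial.X i : MvPolynomial σ S) (f i)) =
      ∏ i, (f i).coeff (J i) := by
  classical
  set N := (Finset.univ.sup fun i => (f i).natDegree) + (Finset.univ.sup fun i => J i) + 1 with hN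
  have hf : ∀ i, Polynomial.aeval (MvPolynomial.X i : MvPolynomial σ S) (f i) =
      ∑ k ∈ Finset.range N, MvPolynomial.monomial (Finsupp.single i k) ((f i).coeff k) := by
    intro i
    rw [Polynomial.aeval_eq_sum_range' (n := N)]
    · refine Finset.sum_congr rfl fun k _ => ?_
      rw [MvPolynomial.X_pow_eq_monomial, MvPolynomial.smul_monomial, smul_eq_mul, mul_one]
    · have : (f i).natDegree ≤ Finset.univ.sup fun i => (f i).natDegree :=
        Finset.le_sup (f := fun i => (f i).natDegree) (Finset.mem_univ i)
      omega
  have hJ : ∀ i, J i < N := by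
    intro i
    have : J i ≤ Finset.univ.sup fun i => J i :=
      Finset.le_sup (f := fun i => J i) (Finset.mem_univ i)
    omega
  simp_rw [hf]
  rw [Finset.prod_univ_sum, MvPolynomial.coeff_sum, Finset.sum_eq_single (fun i => J i)]
  · rw [← MvPolynomial.monomial_sum_prod, MvPolynomial.coeff_monomial, if_pos]
    ext i
    simp
  · intro x _ hx
    rw [← MvPolynomial.monomial_sum_prod, MvPolynomial.coeff_monomial, if_neg]
    rintro rfl
    apply hx
    ext i
    simp [Finsupp.single_apply]
  · intro h
    exact absurd (Fintype.mem_piFinset.2 fun i => Finset.mem_range.2 (hJ i)) h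


lemma map_shift [Algebra R S] [Algebra R T] (g : S →ₐ[R] T) (a : σ → S)
    (P : MvPolynomial σ R) :
    MvPolynomial.map (g : S →+* T) (shift a P) = shift (fun i => g (a i)) P := by
  induction P using MvPolynomial.induction_on with
  | C r => simp [shift]
  | add P Q hP hQ => simp only [map_add, hP, hQ]
  | mul_X P i hP => simp only [map_mul, hP]; simp [shift]

lemma aeval_sub_shift [Algebra R S] (a b : σ → S) (P : MvPolynomial σ R) :
    MvPolynomial.aeval (fun i => b i - a i) (shift a P) = MvPolynomial.aeval b P := by
  induction P using MvPolynomial.induction_on with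
  | C r => simp [shift]
  | add P Q hP hQ => simp only [map_add, hP, hQ]
  | mul_X P i hP => simp only [map_mul, hP]; simp [shift]

lemma shift_injective [Algebra R S] (h : Function.Injective (algebraMap R S)) (a : σ → S) :
    Function.Injective (shift a : MvPolynomial σ R →ₐ[R] MvPolynomial σ S) := by
  intro P Q hPQ
  have key : ∀ P : MvPolynomial σ R,
      MvPolynomial.aeval (fun i => MvPolynomial.X i - MvPolynomial.C (a i) : σ → MvPolynomial σ S)
        (shift a P) = MvPolynomial.map (algebraMap R S) P := by
    intro P
    induction P using MvPolynomial.induction_on with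
    | C r => simp [shift, MvPolynomial.algebraMap_eq]
    | add P Q hP hQ => simp only [map_add, hP, hQ]
    | mul_X P i hP => simp only [map_mul, hP]; simp [shift, MvPolynomial.algebraMap_eq]
  apply MvPolynomial.map_injective _ h
  rw [← key, ← key, hPQ]

/-- Divided partial derivatives: `hasse J P` is the coefficient of `Z ^ J` in `P(X + Z)`. -/
noncomputable def hasse (J : σ →₀ ℕ) : MvPolynomial σ R →ₗ[R] MvPolynomial σ R where
  toFun P := MvPolynomial.coeff J (shift (MvPolynomial.X : σ → MvPolynomial σ R) P)
  map_add' P Q := by simp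
  map_smul' c P := by rw [map_smul, MvPolynomial.coeff_smul, RingHom.id_apply]

lemma aeval_hasse [Algebra R S] (a : σ → S) (J : σ →₀ ℕ) (P : MvPolynomial σ R) :
    MvPolynomial.aeval a (hasse J P) = MvPolynomial.coeff J (shift a P) := by
  have := map_shift (MvPolynomial.aeval a : MvPolynomial σ R →ₐ[R] S)
    (MvPolynomial.X : σ → MvPolynomial σ R) P
  simp only [MvPolynomial.aeval_X] at this
  rw [← this, MvPolynomial.coeff_map]
  rfl

variable [Fintype σ]

lemma coeff_shift_monomial [Algebra R S] (a : σ → S) (I J : σ →₀ ℕ) (c : R) :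
    MvPolynomial.coeff J (shift a (MvPolynomial.monomial I c)) =
      algebraMap R S c * ∏ i, (((I i).choose (J i) : ℕ) : S) * a i ^ (I i - J i) := by
  have h : shift a (MvPolynomial.monomial I c) = MvPolynomial.C (algebraMap R S c) *
      ∏ i, Polynomial.aeval (MvPolynomial.X i : MvPolynomial σ S)
        ((Polynomial.X + Polynomial.C (a i)) ^ I i) := by
    rw [shift, MvPolynomial.aeval_monomial, Finsupp.prod_fintype _ _ (by simp)]
    simp [MvPolynomial.algebraMap_eq]
  rw [h, MvPolynomial.coeff_C_mul, coeff_prod_aeval_X]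
  congr 1
  refine Finset.prod_congr rfl fun i _ => ?_
  rw [Polynomial.coeff_X_add_C_pow, mul_comm]

lemma hasse_monomial (I J : σ →₀ ℕ) (c : R) :
    hasse J (MvPolynomial.monomial I c) =
      MvPolynomial.monomial (I - J) (c * ∏ i, (((I i).choose (J i) : ℕ) : R)) := by
  change MvPolynomial.coeff J (shift _ _) = _
  rw [coeff_shift_monomial, MvPolynomial.monomial_eq, Finsupp.prod_fintype _ _ (by simp),
    Finset.prod_mul_distrib]
  simp [MvPolynomial.algebraMap_eq, mul_assoc]

lemma map_hasse [Algebra R S] (J : σ →₀ ℕ) (P : MvPolynomial σ R) :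
    MvPolynomial.map (algebraMap R S) (hasse J P) =
      hasse J (MvPolynomial.map (algebraMap R S) P) := by
  induction P using MvPolynomial.induction_on' with
  | monomial I c => simp [hasse_monomial]
  | add P Q hP hQ => simp only [map_add, hP, hQ]

lemma coeff_shift_hasse [Algebra R S] (a : σ → S) (J K : σ →₀ ℕ) (P : MvPolynomial σ R) :
    MvPolynomial.coeff K (shift a (hasse J P)) =
      (∏ i, (((K i + J i).choose (J i) : ℕ) : S)) * MvPolynomial.coeff (K + J) (shift a P) := by
  induction P using MvPolynomial.induction_on' with
  | monomial I c =>
    rw [hasse_monomial, coeff_shift_monomial, coeff_shift_monomial, map_mul, map_prod]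
    refine (mul_assoc _ _ _).trans (Eq.trans ?_ (mul_left_comm _ _ _))
    congr 1
    rw [← Finset.prod_mul_distrib, ← Finset.prod_mul_distrib]
    refine Finset.prod_congr rfl fun i _ => ?_
    simp only [map_natCast, Finsupp.coe_tsub, Pi.sub_apply, Finsupp.coe_add, Pi.add_apply]
    rw [show I i - J i - K i = I i - (K i + J i) by omega, ← mul_assoc, ← mul_assoc]
    congr 1
    norm_cast
    rw [mul_comm ((K i + J i).choose (J i)), Nat.choose_mul (Nat.le_add_left _ _),
      Nat.add_sub_cancel]
  | add P Q hP hQ => simp only [map_add, MvPolynomial.coeff_add, hP, hQ, mul_add]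

end Shift

section LengthNorm

variable {σ : Type*}

/-- The length (sum of absolute values of coefficients) of an integer polynomial. -/
noncomputable def length (P : MvPolynomial σ ℤ) : ℝ :=
  ∑ I ∈ P.support, |((MvPolynomial.coeff I P : ℤ) : ℝ)|

lemma length_eq_sum {P : MvPolynomial σ ℤ} {s : Finset (σ →₀ ℕ)} (h : P.support ⊆ s) :
    length P = ∑ I ∈ s, |((MvPolynomial.coeff I P : ℤ) : ℝ)| := by
  refine Finset.sum_subset h fun I _ hI => ?_
  simp [MvPolynomial.notMem_support_iff.1 hI]

lemma length_nonneg (P : MvPolynomial σ ℤ) : 0 ≤ length P :=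
  Finset.sum_nonneg fun _ _ => abs_nonneg _

lemma one_le_length {P : MvPolynomial σ ℤ} (h : P ≠ 0) : 1 ≤ length P := by
  obtain ⟨I, hI⟩ := MvPolynomial.ne_zero_iff.1 h
  calc (1 : ℝ) ≤ |((MvPolynomial.coeff I P : ℤ) : ℝ)| := by exact_mod_cast Int.one_le_abs hI
    _ ≤ length P := Finset.single_le_sum (f := fun I => |((MvPolynomial.coeff I P : ℤ) : ℝ)|)
        (fun _ _ => abs_nonneg _) (MvPolynomial.mem_support_iff.2 hI)

@[simp] lemma length_zero : length (0 : MvPolynomial σ ℤ) = 0 := by simp [length]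

lemma length_add_le (P Q : MvPolynomial σ ℤ) : length (P + Q) ≤ length P + length Q := by
  classical
  rw [length_eq_sum (MvPolynomial.support_add (p := P) (q := Q)),
    length_eq_sum (P := P) (Finset.subset_union_left (s₂ := Q.support)),
    length_eq_sum (P := Q) (Finset.subset_union_right (s₁ := P.support)),
    ← Finset.sum_add_distrib]
  refine Finset.sum_le_sum fun I _ => ?_
  rw [MvPolynomial.coeff_add]
  push_cast
  exact abs_add_le _ _

lemma length_sum_le {ι : Type*} (s : Finset ι) (f : ι → MvPolynomial σ ℤ) :
    length (∑ i ∈ s, f i) ≤ ∑ i ∈ s, length (f i) := by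
  classical
  induction s using Finset.induction_on with
  | empty => simp
  | insert a s ha ih =>
    rw [Finset.sum_insert ha, Finset.sum_insert ha]
    exact (length_add_le _ _).trans (by gcongr)

lemma length_monomial (I : σ →₀ ℕ) (c : ℤ) :
    length (MvPolynomial.monomial I c) = |(c : ℝ)| := by
  classical
  rw [length_eq_sum MvPolynomial.support_monomial_subset]
  simp

lemma length_neg (P : MvPolynomial σ ℤ) : length (-P) = length P := by
  simp [length]

lemma length_monomial_mul_le (I : σ →₀ ℕ) (c : ℤ) (Q : MvPolynomial σ ℤ) :
    length (MvPolynomial.monomial I c * Q) ≤ |(c : ℝ)| * length Q := by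
  conv_lhs => rw [Q.as_sum, Finset.mul_sum]
  refine (length_sum_le _ _).trans ?_
  rw [length, Finset.mul_sum]
  refine Finset.sum_le_sum fun K _ => ?_
  rw [MvPolynomial.monomial_mul, length_monomial]
  push_cast
  rw [abs_mul]

lemma length_mul_le (P Q : MvPolynomial σ ℤ) : length (P * Q) ≤ length P * length Q := by
  conv_lhs => rw [P.as_sum, Finset.sum_mul]
  refine (length_sum_le _ _).trans ?_
  rw [length, Finset.sum_mul]
  exact Finset.sum_le_sum fun K _ => length_monomial_mul_le _ _ _

lemma length_prod_le {ι : Type*} (s : Finset ι) (f : ι → MvPolynomial σ ℤ) :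
    length (∏ i ∈ s, f i) ≤ ∏ i ∈ s, length (f i) := by
  classical
  induction s using Finset.induction_on with
  | empty =>
    have := length_monomial (σ := σ) 0 1
    simp only [MvPolynomial.monomial_zero', map_one] at this
    simp [this]
  | insert a s ha ih =>
    rw [Finset.prod_insert ha, Finset.prod_insert ha]
    exact (length_mul_le _ _).trans (mul_le_mul_of_nonneg_left ih (length_nonneg _))

lemma length_det_le {k : ℕ} (M : Matrix (Fin k) (Fin k) (MvPolynomial σ ℤ)) {B : ℝ}
    (hM : ∀ i j, length (M i j) ≤ B) : length M.det ≤ k.factorial * B ^ k := by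
  rw [Matrix.det_apply]
  refine (length_sum_le _ _).trans ?_
  have : ∀ τ ∈ (Finset.univ : Finset (Equiv.Perm (Fin k))),
      length (Equiv.Perm.sign τ • ∏ i, M (τ i) i) ≤ B ^ k := by
    intro τ _
    have h1 : length (∏ i, M (τ i) i) ≤ B ^ k := by
      refine (length_prod_le _ _).trans ?_
      refine (Finset.prod_le_prod (fun _ _ => length_nonneg _) fun i _ => hM (τ i) i).trans ?_
      simp
    rcases Int.units_eq_one_or (Equiv.Perm.sign τ) with h | h
    · rwa [h, one_smul]
    · rwa [h, Units.neg_smul, one_smul, length_neg]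
  refine (Finset.sum_le_sum this).trans ?_
  simp [Fintype.card_perm]

lemma hasse_eq_sum [Fintype σ] {R : Type*} [CommRing R] (J : σ →₀ ℕ) (P : MvPolynomial σ R) :
    hasse J P = ∑ I ∈ P.support, MvPolynomial.monomial (I - J)
      (MvPolynomial.coeff I P * ∏ i, (((I i).choose (J i) : ℕ) : R)) := by
  conv_lhs => rw [P.as_sum, map_sum]
  exact Finset.sum_congr rfl fun I _ => hasse_monomial _ _ _

lemma length_hasse_le [Fintype σ] {P : MvPolynomial σ ℤ} {d : σ → ℕ}
    (hd : ∀ i, P.degreeOf i ≤ d i) (J : σ →₀ ℕ) :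
    length (hasse J P) ≤ 2 ^ (∑ i, d i) * length P := by
  rw [hasse_eq_sum]
  refine (length_sum_le _ _).trans ?_
  rw [length, Finset.mul_sum]
  refine Finset.sum_le_sum fun I hI => ?_
  rw [length_monomial, mul_comm (2 ^ _ : ℝ)]
  push_cast
  rw [abs_mul]
  refine mul_le_mul_of_nonneg_left ?_ (abs_nonneg _)
  rw [abs_of_nonneg (by positivity), ← Finset.prod_pow_eq_pow_sum]
  refine Finset.prod_le_prod (fun _ _ => by positivity) fun i _ => ?_
  calc ((((I i).choose (J i) : ℕ)) : ℝ) ≤ ((2 ^ I i : ℕ) : ℝ) := by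
        exact_mod_cast Nat.choose_le_two_pow _ _
    _ ≤ 2 ^ d i := by
        push_cast
        exact pow_le_pow_right₀ (by norm_num)
          ((MvPolynomial.degreeOf_le_iff.1 (hd i) I hI))

lemma degreeOf_hasse_le [Fintype σ] {R : Type*} [CommRing R] (J : σ →₀ ℕ)
    (P : MvPolynomial σ R) (i : σ) : (hasse J P).degreeOf i ≤ P.degreeOf i := by
  rw [hasse_eq_sum, MvPolynomial.degreeOf_le_iff]
  intro K hK
  classical
  obtain ⟨I, hI, hKI⟩ := Finset.mem_biUnion.1 (MvPolynomial.support_sum hK)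
  have := Finset.mem_singleton.1 (MvPolynomial.support_monomial_subset hKI)
  rw [this]
  exact (by simp : (I - J) i ≤ I i).trans (MvPolynomial.degreeOf_le_iff.1 le_rfl I hI)

lemma degreeOf_det_le {R : Type*} [CommRing R] {k : ℕ}
    (M : Matrix (Fin k) (Fin k) (MvPolynomial σ R)) (s : σ) {d : ℕ}
    (hM : ∀ i j, (M i j).degreeOf s ≤ d) : M.det.degreeOf s ≤ k * d := by
  rw [Matrix.det_apply]
  refine (MvPolynomial.degreeOf_sum_le _ _ _).trans (Finset.sup_le fun τ _ => ?_)
  have h1 : (∏ i, M (τ i) i).degreeOf s ≤ k * d := by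
    refine (MvPolynomial.degreeOf_prod_le _ _ _).trans ?_
    refine (Finset.sum_le_sum fun i _ => hM (τ i) i).trans ?_
    simp
  rcases Int.units_eq_one_or (Equiv.Perm.sign τ) with h | h
  · rwa [h, one_smul]
  · rwa [h, Units.neg_smul, one_smul, MvPolynomial.degreeOf, MvPolynomial.degrees_neg]

end LengthNorm

section Wronskian

variable {F : Type*} [Field F] [CharZero F]

lemma eq_C_mul_of_derivative_mul_eq {g h : F[X]} (hh : h ≠ 0)
    (hgh : derivative g * h = g * derivative h) : ∃ c : F, g = C c * h := by
  obtain ⟨x, hx⟩ : ∃ x, h.eval x ≠ 0 := by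
    by_contra! hc
    exact hh (Polynomial.funext fun x => by simpa using hc x)
  refine ⟨g.eval x / h.eval x, ?_⟩
  set u := g - C (g.eval x / h.eval x) * h with hu
  suffices u = 0 from sub_eq_zero.1 this
  by_contra hu0
  have hroot : u.IsRoot x := by
    simp [hu, div_mul_cancel₀ _ hx]
  have hrel : derivative u * h = u * derivative h := by
    simp only [hu, derivative_sub, derivative_C_mul, sub_mul, hgh]
    ring
  have hmh : h.rootMultiplicity x = 0 := rootMultiplicity_eq_zero hx
  have hpos := (rootMultiplicity_pos hu0).2 hroot
  have hd := derivative_rootMultiplicity_of_root hroot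
  have hdu : derivative u ≠ 0 := by
    intro h0
    have := derivative_eq_zero.1 h0
    rw [eq_C_of_natDegree_eq_zero this] at hroot hu0
    simp at hroot
    rw [hroot] at hu0
    simp at hu0
  have h1 : (derivative u * h).rootMultiplicity x = u.rootMultiplicity x - 1 := by
    rw [rootMultiplicity_mul (mul_ne_zero hdu hh), hd, hmh, add_zero]
  have h2 : u.rootMultiplicity x ≤ (u * derivative h).rootMultiplicity x := by
    rw [rootMultiplicity_mul (hrel ▸ mul_ne_zero hdu hh)]
    exact Nat.le_add_right _ _
  rw [← hrel, h1] at h2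
  omega

/-- Linearly independent polynomials in characteristic zero have nonzero Wronskian. -/
lemma wronskian_det_ne_zero {k : ℕ} (f : Fin k → F[X]) (hf : LinearIndependent F f) :
    (Matrix.of fun i j : Fin k => derivative^[i] (f j)).det ≠ 0 := by
  induction k with
  | zero => simp
  | succ k ih =>
    intro hdet
    obtain ⟨g, hg0, hg⟩ := Matrix.exists_mulVec_eq_zero_iff.2 hdet
    have hrow : ∀ i : ℕ, i < k + 1 → ∑ j, derivative^[i] (f j) * g j = 0 := fun i hi => by
      simpa [Matrix.mulVec, dotProduct] using congrFun hg ⟨i, hi⟩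
    have hih := ih (fun j => f j.castSucc) (hf.comp _ (Fin.castSucc_injective k))
    have hker : ∀ h : Fin (k + 1) → F[X], h (Fin.last k) = 0 →
        (∀ i : ℕ, i < k → ∑ j, derivative^[i] (f j) * h j = 0) → h = 0 := by
      intro h hl hs
      have h0 : (fun j : Fin k => h j.castSucc) = 0 := by
        by_contra hne
        refine hih (Matrix.exists_mulVec_eq_zero_iff.1 ⟨_, hne, ?_⟩)
        ext1 i
        have := hs i i.2
        rw [Fin.sum_univ_castSucc, hl, mul_zero, add_zero] at this
        simpa [Matrix.mulVec, dotProduct] using this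
      ext1 j
      refine Fin.lastCases hl (fun j => congrFun h0 j) j
    have hlast : g (Fin.last k) ≠ 0 := fun h => hg0 (hker g h fun i hi => hrow i (by omega))
    have hrow' : ∀ i : ℕ, i < k → ∑ j, derivative^[i] (f j) * derivative (g j) = 0 := by
      intro i hi
      have h1 := congrArg derivative (hrow i (by omega))
      simp only [derivative_sum, derivative_mul, derivative_zero, Finset.sum_add_distrib,
        ← Function.iterate_succ_apply' derivative] at h1
      rwa [hrow (i + 1) (by omega), zero_add] at h1
    have hprop : ∀ j, derivative (g j) * g (Fin.last k) = g j * derivative (g (Fin.last k)) := by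
      have := hker (fun j => derivative (g j) * g (Fin.last k) - g j * derivative (g (Fin.last k)))
        (by ring) (fun i hi => by
          have h1 := congrArg (· * g (Fin.last k)) (hrow' i hi)
          have h2 := congrArg (· * derivative (g (Fin.last k))) (hrow i (by omega))
          simp only [Finset.sum_mul, zero_mul] at h1 h2
          calc _ = ∑ j, (derivative^[i] (f j) * derivative (g j) * g (Fin.last k) -
                derivative^[i] (f j) * g j * derivative (g (Fin.last k))) :=
                Finset.sum_congr rfl fun j _ => by ring
            _ = 0 := by rw [Finset.sum_sub_distrib, h1, h2, sub_zero])
      exact fun j => sub_eq_zero.1 (congrFun this j)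
    choose c hc using fun j => eq_C_mul_of_derivative_mul_eq hlast (hprop j)
    have hsum : ∑ j, c j • f j = 0 := by
      have h0 := hrow 0 (by omega)
      simp only [Function.iterate_zero, id] at h0
      have : (∑ j, c j • f j) * g (Fin.last k) = 0 := by
        rw [← h0, Finset.sum_mul]
        refine Finset.sum_congr rfl fun j _ => ?_
        conv_rhs => rw [hc j]
        rw [smul_eq_C_mul]
        ring
      exact (mul_eq_zero.1 this).resolve_right hlast
    have hcl := Fintype.linearIndependent_iff.1 hf c hsum (Fin.last k)
    have := hc (Fin.last k)
    rw [hcl] at this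
    simp at this
    exact hlast this

end Wronskian

section GeneralizedWronskian

lemma det_eq_zero_of_mem_span {R : Type*} [CommRing R] {k : ℕ} (S : Fin k → Set (Fin k → R))
    (hS : ∀ w : Matrix (Fin k) (Fin k) R, (∀ i, w i ∈ S i) → w.det = 0)
    (v : Matrix (Fin k) (Fin k) R) (hv : ∀ i, v i ∈ Submodule.span R (S i)) : v.det = 0 := by
  classical
  have key : ∀ t : Finset (Fin k), ∀ v : Matrix (Fin k) (Fin k) R,
      (∀ i ∈ t, v i ∈ Submodule.span R (S i)) → (∀ i ∉ t, v i ∈ S i) → v.det = 0 := by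
    intro t
    induction t using Finset.induction_on with
    | empty => exact fun v _ h => hS v fun i => h i (Finset.notMem_empty i)
    | insert a t ha ih =>
      intro v hv hv'
      have hgen : ∀ x ∈ Submodule.span R (S a), (v.updateRow a x).det = 0 := by
        intro x hx
        induction hx using Submodule.span_induction with
        | mem x hx =>
          refine ih _ (fun i hi => ?_) (fun i hi => ?_)
          · rw [Matrix.updateRow_ne (fun h : i = a => ha (h ▸ hi))]
            exact hv i (Finset.mem_insert_of_mem hi)
          · by_cases h : i = a
            · subst h
              rwa [Matrix.updateRow_self]
            · rw [Matrix.updateRow_ne h]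
              exact hv' i (by simp [h, hi])
        | zero => exact Matrix.det_eq_zero_of_row_eq_zero a (by simp)
        | add x y _ _ hx hy => rw [Matrix.det_updateRow_add, hx, hy, add_zero]
        | smul c x _ hx => rw [Matrix.det_updateRow_smul, hx, mul_zero]
      have := hgen (v a) (hv a (Finset.mem_insert_self a t))
      rwa [Matrix.updateRow_eq_self] at this
  exact key Finset.univ v (fun i _ => hv i) fun i hi => absurd (Finset.mem_univ i) hi

lemma hasse_hasse {σ R : Type*} [Fintype σ] [CommRing R] (J K : σ →₀ ℕ)
    (P : MvPolynomial σ R) :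
    hasse K (hasse J P) = (∏ i, (((K i + J i).choose (J i) : ℕ) : R)) • hasse (K + J) P := by
  have : hasse K (hasse J P) = MvPolynomial.coeff K (shift MvPolynomial.X (hasse J P)) := rfl
  rw [this, coeff_shift_hasse, MvPolynomial.smul_eq_C_mul, map_prod]
  simp only [map_natCast]
  rfl

lemma hasse_zero {σ R : Type*} [Fintype σ] [CommRing R] (P : MvPolynomial σ R) :
    hasse 0 P = P := by
  induction P using MvPolynomial.induction_on' with
  | monomial I c => simp [hasse_monomial]
  | add P Q hP hQ => rw [map_add, hP, hQ]

lemma pderiv_eq_hasse {σ R : Type*} [Fintype σ] [DecidableEq σ] [CommRing R] (i : σ)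
    (P : MvPolynomial σ R) : MvPolynomial.pderiv i P = hasse (Finsupp.single i 1) P := by
  induction P using MvPolynomial.induction_on' with
  | monomial I c =>
    rw [hasse_monomial, MvPolynomial.pderiv_monomial, Finset.prod_eq_single i]
    · simp
    · intro j _ hj
      simp [hj.symm]
    · simp
  | add P Q hP hQ => rw [map_add, map_add, hP, hQ]

variable {F : Type*} [Field F]

/-- Substitution of powers of a single variable for the variables. -/
noncomputable def kronecker {m : ℕ} (l : Fin m → ℕ) : MvPolynomial (Fin m) F →ₐ[F] F[X] :=
  MvPolynomial.aeval fun i => X ^ l i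

lemma kronecker_monomial {m : ℕ} (l : Fin m → ℕ) (I : Fin m →₀ ℕ) (c : F) :
    kronecker l (MvPolynomial.monomial I c) = Polynomial.monomial (∑ i, I i * l i) c := by
  rw [kronecker, MvPolynomial.aeval_monomial, Finsupp.prod_fintype _ _ (by simp),
    ← C_mul_X_pow_eq_monomial, ← Finset.prod_pow_eq_pow_sum]
  simp only [← pow_mul, mul_comm (l _)]
  rfl

lemma derivative_kronecker {m : ℕ} (l : Fin m → ℕ) (P : MvPolynomial (Fin m) F) :
    derivative (kronecker l P) =
      ∑ i, derivative (X ^ l i : F[X]) * kronecker l (hasse (Finsupp.single i 1) P) := by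
  classical
  simp only [← pderiv_eq_hasse]
  induction P using MvPolynomial.induction_on with
  | C c => simp [kronecker]
  | add P Q hP hQ =>
    simp only [map_add, hP, hQ, mul_add, Finset.sum_add_distrib]
  | mul_X P j hP =>
    have h1 : ∀ i, kronecker l (MvPolynomial.pderiv i (P * MvPolynomial.X j)) =
        kronecker l (MvPolynomial.pderiv i P) * X ^ l j +
          (if i = j then kronecker l P else 0) := by
      intro i
      rw [MvPolynomial.pderiv_mul, map_add, map_mul, map_mul, MvPolynomial.pderiv_X]
      have hX : kronecker l (MvPolynomial.X j : MvPolynomial (Fin m) F) = X ^ l j := by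
        simp [kronecker]
      rw [hX]
      split_ifs with h
      · subst h
        simp
      · rw [Pi.single_eq_of_ne (Ne.symm h), map_zero, mul_zero]
    have h2 : kronecker l (P * MvPolynomial.X j) = kronecker l P * X ^ l j := by
      simp [kronecker]
    simp only [h1, mul_add, Finset.sum_add_distrib, mul_ite, mul_zero, Finset.sum_ite_eq',
      Finset.mem_univ, if_true]
    rw [h2, derivative_mul, hP, Finset.sum_mul]
    simp only [mul_assoc]
    rw [mul_comm (derivative (X ^ l j))]

lemma iterate_derivative_kronecker_mem_span {m k : ℕ} (l : Fin m → ℕ)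
    (f : Fin k → MvPolynomial (Fin m) F) (s : ℕ) :
    (fun j => derivative^[s] (kronecker l (f j))) ∈ Submodule.span F[X]
      {v : Fin k → F[X] | ∃ J : Fin m →₀ ℕ, J.degree ≤ s ∧
        v = fun j => kronecker l (hasse J (f j))} := by
  induction s with
  | zero => exact Submodule.subset_span ⟨0, by simp, by simp [hasse_zero]⟩
  | succ s ih =>
    have key : ∀ v ∈ Submodule.span F[X] {v : Fin k → F[X] | ∃ J : Fin m →₀ ℕ, J.degree ≤ s ∧
        v = fun j => kronecker l (hasse J (f j))}, (fun j => derivative (v j)) ∈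
        Submodule.span F[X] {v : Fin k → F[X] | ∃ J : Fin m →₀ ℕ, J.degree ≤ s + 1 ∧
        v = fun j => kronecker l (hasse J (f j))} := by
      intro v hv
      induction hv using Submodule.span_induction with
      | mem v hv =>
        obtain ⟨J, hJ, rfl⟩ := hv
        have : (fun j => derivative (kronecker l (hasse J (f j)))) =
            ∑ i, (derivative (X ^ l i : F[X]) * C (∏ a, (((Finsupp.single i 1 a + J a).choose (J a)
              : ℕ) : F))) • fun j => kronecker l (hasse (Finsupp.single i 1 + J) (f j)) := by
          ext1 j
          rw [derivative_kronecker, Finset.sum_apply]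
          refine Finset.sum_congr rfl fun i _ => ?_
          rw [hasse_hasse, map_smul, Pi.smul_apply, smul_eq_mul, smul_eq_C_mul, mul_assoc]
        rw [this]
        refine Submodule.sum_mem _ fun i _ => Submodule.smul_mem _ _
          (Submodule.subset_span ⟨_, ?_, rfl⟩)
        rw [map_add, Finsupp.degree_single]
        omega
      | zero =>
        simp only [Pi.zero_apply, derivative_zero]
        exact Submodule.zero_mem _
      | add v w _ _ hv hw =>
        simp only [Pi.add_apply, derivative_add]
        exact Submodule.add_mem _ hv hw
      | smul c v hv' hv =>
        simp only [Pi.smul_apply, smul_eq_mul, derivative_mul]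
        refine Submodule.add_mem _ (Submodule.smul_mem _ (derivative c) ?_)
          (Submodule.smul_mem _ c hv)
        refine Submodule.span_mono ?_ hv'
        rintro _ ⟨J, hJ, rfl⟩
        exact ⟨J, hJ.trans (Nat.le_succ s), rfl⟩
    simp only [Function.iterate_succ_apply']
    exact key _ ih

lemma sum_mul_pow_injOn {m : ℕ} (N : ℕ) {I J : Fin m → ℕ} (hI : ∀ i, I i < N)
    (hJ : ∀ i, J i < N) (h : ∑ i, I i * N ^ (i : ℕ) = ∑ i, J i * N ^ (i : ℕ)) : I = J := by
  have := (finFunctionFinEquiv (m := N) (n := m)).injective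
  have h2 := this (a₁ := fun i => ⟨I i, hI i⟩) (a₂ := fun i => ⟨J i, hJ i⟩) (Fin.ext (by
    rw [finFunctionFinEquiv_apply, finFunctionFinEquiv_apply]
    exact h))
  ext1 i
  exact congrArg Fin.val (congrFun h2 i)

lemma coeff_kronecker {m : ℕ} (N : ℕ) {P : MvPolynomial (Fin m) F}
    (hP : ∀ I ∈ P.support, ∀ i, I i < N) {J : Fin m →₀ ℕ} (hJ : ∀ i, J i < N) :
    (kronecker (fun i => N ^ (i : ℕ)) P).coeff (∑ i, J i * N ^ (i : ℕ)) =
      MvPolynomial.coeff J P := by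
  classical
  conv_lhs => rw [P.as_sum, map_sum, finsetSum_coeff]
  simp only [kronecker_monomial, coeff_monomial]
  by_cases hJP : J ∈ P.support
  · rw [Finset.sum_eq_single J]
    · simp
    · intro I hI hIJ
      rw [if_neg]
      exact fun h => hIJ (DFunLike.coe_injective (sum_mul_pow_injOn N (hP I hI) hJ h))
    · exact fun h => absurd hJP h
  · rw [MvPolynomial.notMem_support_iff.1 hJP]
    refine Finset.sum_eq_zero fun I hI => ?_
    rw [if_neg]
    intro h
    exact hJP (DFunLike.coe_injective (sum_mul_pow_injOn N (hP I hI) hJ h) ▸ hI)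

/-- Linearly independent polynomials in several variables in characteristic zero have a nonzero
generalized Wronskian. -/
lemma exists_generalized_wronskian_ne_zero [CharZero F] {m k : ℕ}
    (f : Fin k → MvPolynomial (Fin m) F) (hf : LinearIndependent F f) :
    ∃ J : Fin k → Fin m →₀ ℕ, (∀ i, (J i).degree ≤ i) ∧
      (Matrix.of fun i j => hasse (J i) (f j)).det ≠ 0 := by
  classical
  set N := (Finset.univ.sup fun j => (f j).totalDegree) + 1 with hN
  have hsupp : ∀ P ∈ Submodule.span F (Set.range f), ∀ I ∈ P.support, ∀ i, I i < N := by
    intro P hP I hI i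
    have : P.totalDegree ≤ Finset.univ.sup fun j => (f j).totalDegree := by
      clear hI
      induction hP using Submodule.span_induction with
      | mem P hP =>
        obtain ⟨j, rfl⟩ := hP
        exact Finset.le_sup (f := fun j => (f j).totalDegree) (Finset.mem_univ j)
      | zero => simp
      | add P Q _ _ hP hQ => exact (MvPolynomial.totalDegree_add _ _).trans (max_le hP hQ)
      | smul c P _ hP => exact (MvPolynomial.totalDegree_smul_le _ _).trans hP
    have h2 := MvPolynomial.le_totalDegree hI
    have h3 : I i ≤ I.sum fun _ e => e := by
      rw [Finsupp.sum_fintype _ _ (by simp)]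
      exact Finset.single_le_sum (f := fun i => I i) (by simp) (Finset.mem_univ i)
    omega
  have hind : LinearIndependent F fun j => kronecker (fun i : Fin m => N ^ (i : ℕ)) (f j) := by
    rw [Fintype.linearIndependent_iff]
    intro g hg
    refine Fintype.linearIndependent_iff.1 hf g ?_
    have hmem : ∑ j, g j • f j ∈ Submodule.span F (Set.range f) :=
      Submodule.sum_mem _ fun j _ => Submodule.smul_mem _ _ (Submodule.subset_span ⟨j, rfl⟩)
    simp only [← map_smul, ← map_sum] at hg
    ext J
    by_cases hJ : J ∈ (∑ j, g j • f j).support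
    · rw [← coeff_kronecker N (hsupp _ hmem) (hsupp _ hmem J hJ), hg]
      simp
    · rw [MvPolynomial.notMem_support_iff.1 hJ]
      simp
  by_contra! hcon
  refine wronskian_det_ne_zero _ hind (det_eq_zero_of_mem_span _ ?_ _ fun i =>
    iterate_derivative_kronecker_mem_span _ f i)
  intro w hw
  choose J hJ hwJ using hw
  have hmap : w = (kronecker (fun i : Fin m => N ^ (i : ℕ))).mapMatrix
      (Matrix.of fun i j => hasse (J i) (f j)) := by
    ext1 i j
    rw [hwJ i]
    rfl
  rw [hmap, ← AlgHom.map_det, hcon J hJ, map_zero]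

end GeneralizedWronskian

section Splitting

variable {R : Type*} [CommRing R] {m : ℕ}

lemma coeff_cons_aeval_mul_rename (u : R[X]) (v : MvPolynomial (Fin m) R) (t : ℕ)
    (J : Fin m →₀ ℕ) :
    MvPolynomial.coeff (J.cons t) (Polynomial.aeval (MvPolynomial.X 0) u *
      MvPolynomial.rename Fin.succ v) = u.coeff t * MvPolynomial.coeff J v := by
  have h1 : MvPolynomial.finSuccEquiv R m (Polynomial.aeval (MvPolynomial.X 0) u) =
      u.map MvPolynomial.C := by
    induction u using Polynomial.induction_on' with
    | add p q hp hq => simp only [map_add, Polynomial.map_add, hp, hq]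
    | monomial n a =>
      rw [Polynomial.aeval_monomial, map_mul, map_pow, MvPolynomial.finSuccEquiv_X_zero,
        Polynomial.map_monomial, ← C_mul_X_pow_eq_monomial, AlgEquiv.commutes]
      rfl
  have h2 : MvPolynomial.finSuccEquiv R m (MvPolynomial.rename Fin.succ v) = C v := by
    induction v using MvPolynomial.induction_on with
    | C a =>
      rw [MvPolynomial.rename_C]
      exact (MvPolynomial.finSuccEquiv R m).commutes a
    | add p q hp hq => simp only [map_add, hp, hq]
    | mul_X p i hp =>
      rw [map_mul, map_mul, hp, MvPolynomial.rename_X, MvPolynomial.finSuccEquiv_X_succ, C_mul]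
  rw [← MvPolynomial.finSuccEquiv_coeff_coeff, map_mul, h1, h2, coeff_mul_C, coeff_map,
    MvPolynomial.coeff_C_mul]

lemma hasse_cons_aeval_mul_rename (u : R[X]) (v : MvPolynomial (Fin m) R) (t : ℕ)
    (J : Fin m →₀ ℕ) :
    hasse (J.cons t) (Polynomial.aeval (MvPolynomial.X 0) u * MvPolynomial.rename Fin.succ v) =
      Polynomial.aeval (MvPolynomial.X 0) (hasseDeriv t u) *
        MvPolynomial.rename Fin.succ (hasse J v) := by
  induction u using Polynomial.induction_on' with
  | add p q hp hq => simp only [map_add, add_mul, hp, hq]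
  | monomial n a =>
    induction v using MvPolynomial.induction_on' with
    | add p q hp hq => simp only [map_add, mul_add, hp, hq]
    | monomial I c =>
      have key : ∀ n a I c, Polynomial.aeval (MvPolynomial.X 0 : MvPolynomial (Fin (m+1)) R)
          (Polynomial.monomial n a) * MvPolynomial.rename Fin.succ (MvPolynomial.monomial I c) =
          MvPolynomial.monomial (I.cons n) (a * c) := by
        intro n a I c
        ext K
        have hK : I.cons n = K ↔ n = K 0 ∧ I = K.tail := by
          constructor
          · rintro rfl
            simp
          · rintro ⟨rfl, rfl⟩
            exact Finsupp.cons_tail K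
        conv_lhs => rw [← Finsupp.cons_tail K]
        rw [coeff_cons_aeval_mul_rename, Polynomial.coeff_monomial,
          MvPolynomial.coeff_monomial, MvPolynomial.coeff_monomial]
        simp only [hK]
        by_cases h : n = K 0 <;> by_cases h' : I = K.tail <;> simp [h, h']
      rw [key, hasse_monomial, hasseDeriv_monomial, hasse_monomial, key]
      have hsub : I.cons n - J.cons t = (I - J).cons (n - t) := by
        ext i
        refine Fin.cases ?_ (fun i => ?_) i <;> simp
      rw [hsub, Fin.prod_univ_succ]
      simp only [Finsupp.cons_zero, Finsupp.cons_succ]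
      congr 1
      ring

lemma shift_aeval_mul_rename {S : Type*} [CommRing S] [Algebra R S] (ξ : Fin (m + 1) → S)
    (u : R[X]) (v : MvPolynomial (Fin m) R) :
    shift ξ (Polynomial.aeval (MvPolynomial.X 0) u * MvPolynomial.rename Fin.succ v) =
      Polynomial.aeval (MvPolynomial.X 0) (taylor (ξ 0) (u.map (algebraMap R S))) *
        MvPolynomial.rename Fin.succ (shift (fun i => ξ i.succ) v) := by
  rw [map_mul]
  congr 1
  · induction u using Polynomial.induction_on' with
    | add p q hp hq => simp only [map_add, Polynomial.map_add, hp, hq]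
    | monomial n a =>
      rw [Polynomial.map_monomial, taylor_monomial]
      simp [shift, Polynomial.aeval_monomial, MvPolynomial.algebraMap_eq]
  · induction v using MvPolynomial.induction_on with
    | C a => simp [shift, MvPolynomial.algebraMap_eq]
    | add p q hp hq => simp only [map_add, hp, hq]
    | mul_X p i hp => rw [map_mul, map_mul, map_mul, map_mul, hp]; simp [shift]

/-- A nonzero polynomial over a field is a sum of products of polynomials in the first variable
and in the others, with linearly independent factors on both sides. -/
lemma exists_eq_sum_aeval_mul_rename {F : Type*} [Field F] {P : MvPolynomial (Fin (m + 1)) F}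
    (hP : P ≠ 0) {d : ℕ} (hd : P.degreeOf 0 ≤ d) :
    ∃ k, 1 ≤ k ∧ k ≤ d + 1 ∧ ∃ (ψ : Fin k → F[X]) (φ : Fin k → MvPolynomial (Fin m) F),
      LinearIndependent F ψ ∧ LinearIndependent F φ ∧
      P = ∑ j, Polynomial.aeval (MvPolynomial.X 0) (ψ j) * MvPolynomial.rename Fin.succ (φ j) := by
  set s : Fin (d + 1) → MvPolynomial (Fin m) F :=
    fun l => (MvPolynomial.finSuccEquiv F m P).coeff l with hs
  have hcoeff : ∀ (l : Fin (d + 1)) J, MvPolynomial.coeff J (s l) = MvPolynomial.coeff (J.cons l) P :=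
    fun l J => MvPolynomial.finSuccEquiv_coeff_coeff J P l
  set S := Submodule.span F (Set.range s) with hS
  have hfin : Module.Finite F S := Module.Finite.span_of_finite F (Set.finite_range s)
  let φ := Module.finBasis F S
  have hmem : ∀ l, s l ∈ S := fun l => Submodule.subset_span ⟨l, rfl⟩
  let c : Fin (d + 1) → Fin (Module.finrank F S) → F := fun l j => φ.repr ⟨s l, hmem l⟩ j
  let ψ : Fin (Module.finrank F S) → F[X] := fun j =>
    ∑ l : Fin (d + 1), Polynomial.monomial (l : ℕ) (c l j)
  have hψ : ∀ j (l : Fin (d + 1)), (ψ j).coeff l = c l j := by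
    intro j l
    rw [finsetSum_coeff, Finset.sum_eq_single l]
    · simp
    · intro b _ hb
      rw [Polynomial.coeff_monomial, if_neg]
      exact fun h => hb (Fin.ext h)
    · simp
  have hψ' : ∀ j (l : ℕ), d < l → (ψ j).coeff l = 0 := by
    intro j l hl
    rw [finsetSum_coeff]
    refine Finset.sum_eq_zero fun b _ => ?_
    rw [Polynomial.coeff_monomial, if_neg]
    have := b.2
    omega
  refine ⟨Module.finrank F S, ?_, ?_, ψ, fun j => (φ j : MvPolynomial (Fin m) F), ?_, ?_, ?_⟩
  · by_contra! h0
    have hbot : S = ⊥ := Submodule.finrank_eq_zero.1 (by omega)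
    refine hP (MvPolynomial.ext _ _ fun I => ?_)
    by_cases hI : I 0 ≤ d
    · have h1 : s ⟨I 0, by omega⟩ = 0 := by
        have := hmem ⟨I 0, by omega⟩
        rwa [hbot, Submodule.mem_bot] at this
      have h2 := hcoeff ⟨I 0, by omega⟩ I.tail
      rw [h1] at h2
      rw [← Finsupp.cons_tail I, ← h2]
      simp
    · rw [MvPolynomial.coeff_zero, ← MvPolynomial.notMem_support_iff]
      exact fun h => hI (MvPolynomial.degreeOf_le_iff.1 hd I h)
  · exact (finrank_range_le_card s).trans (by simp)
  · rw [Fintype.linearIndependent_iff]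
    intro g hg
    have h0 : φ.constr F g = 0 := by
      refine LinearMap.ext_on_range (v := fun l => (⟨s l, hmem l⟩ : S)) ?_ fun l => ?_
      · have := Submodule.span_span_coe_preimage (R := F) (s := Set.range s)
        convert this using 2
        ext x
        simp only [Set.mem_range, Set.mem_preimage]
        exact exists_congr fun l => Subtype.ext_iff
      · rw [Module.Basis.constr_apply_fintype, LinearMap.zero_apply]
        have := congrArg (fun q => q.coeff l) hg
        simp only [finsetSum_coeff, coeff_smul, hψ, smul_eq_mul, coeff_zero] at this
        rw [← this]
        exact Finset.sum_congr rfl fun j _ => by rw [mul_comm]; rfl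
    intro j
    have := LinearMap.congr_fun h0 (φ j)
    rwa [Module.Basis.constr_basis] at this
  · exact φ.linearIndependent.map' S.subtype S.ker_subtype
  · ext I
    rw [← Finsupp.cons_tail I, MvPolynomial.coeff_sum]
    simp only [coeff_cons_aeval_mul_rename]
    by_cases hI : I 0 ≤ d
    · have h1 := hcoeff ⟨I 0, by omega⟩ I.tail
      simp only at h1
      rw [← h1]
      have h2 := congrArg (fun x : S => (x : MvPolynomial (Fin m) F))
        (φ.sum_repr ⟨s ⟨I 0, by omega⟩, hmem _⟩)
      simp only [Submodule.coe_sum, Submodule.coe_smul] at h2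
      rw [← h2, MvPolynomial.coeff_sum]
      refine Finset.sum_congr rfl fun j _ => ?_
      rw [MvPolynomial.coeff_smul, smul_eq_mul]
      exact congrArg (· * _) (hψ j ⟨I 0, by omega⟩).symm
    · rw [Finset.sum_eq_zero fun j _ => by rw [hψ' j _ (by omega), zero_mul],
        ← MvPolynomial.notMem_support_iff]
      intro h
      have := MvPolynomial.degreeOf_le_iff.1 hd _ h
      rw [Finsupp.cons_zero] at this
      exact hI this

end Splitting

section WronskianSplitting

/-- The sum of the absolute values of the coefficients. -/
noncomputable def plength (V : ℤ[X]) : ℝ :=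
  ∑ i ∈ V.support, |(V.coeff i : ℝ)|

variable {m : ℕ}

lemma exists_int_splitting {W : MvPolynomial (Fin (m + 1)) ℤ} {v : ℚ[X]}
    {u : MvPolynomial (Fin m) ℚ} (hv : v ≠ 0) (hu : u ≠ 0)
    (hW : MvPolynomial.map (algebraMap ℤ ℚ) W =
      Polynomial.aeval (MvPolynomial.X 0) v * MvPolynomial.rename Fin.succ u) :
    ∃ (V : ℤ[X]) (U : MvPolynomial (Fin m) ℤ) (c : ℤ), V ≠ 0 ∧ U ≠ 0 ∧ c ≠ 0 ∧
      MvPolynomial.C c * W =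
        Polynomial.aeval (MvPolynomial.X 0) V * MvPolynomial.rename Fin.succ U ∧
      plength V ≤ length W ∧ length U ≤ length W ∧
      ∀ i, U.degreeOf i ≤ W.degreeOf (Fin.succ i) := by
  classical
  have hcoeff : ∀ t J, ((MvPolynomial.coeff (J.cons t) W : ℤ) : ℚ) =
      v.coeff t * MvPolynomial.coeff J u := by
    intro t J
    rw [← coeff_cons_aeval_mul_rename, ← hW, MvPolynomial.coeff_map]
    rfl
  obtain ⟨b, hb⟩ : ∃ b, v.coeff b ≠ 0 := by
    by_contra! h
    exact hv (Polynomial.ext h)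
  obtain ⟨K, hK⟩ := MvPolynomial.ne_zero_iff.1 hu
  set U := (MvPolynomial.finSuccEquiv ℤ m W).coeff b with hU
  have hUc : ∀ J, MvPolynomial.coeff J U = MvPolynomial.coeff (J.cons b) W :=
    fun J => MvPolynomial.finSuccEquiv_coeff_coeff J W b
  set V : ℤ[X] := ∑ t ∈ Finset.range (W.degreeOf 0 + 1),
    Polynomial.monomial t (MvPolynomial.coeff (K.cons t) W) with hV
  have hVc : ∀ t, V.coeff t = MvPolynomial.coeff (K.cons t) W := by
    intro t
    simp only [hV, finsetSum_coeff, Polynomial.coeff_monomial, Finset.sum_ite_eq', Finset.mem_range]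
    split_ifs with h
    · rfl
    · rw [eq_comm, ← MvPolynomial.notMem_support_iff]
      intro hm
      have := MvPolynomial.degreeOf_le_iff.1 (le_refl (W.degreeOf 0)) _ hm
      rw [Finsupp.cons_zero] at this
      omega
  have hc : MvPolynomial.coeff (K.cons b) W ≠ 0 := by
    have := hcoeff b K
    intro h
    rw [h] at this
    exact mul_ne_zero hb hK (by simpa using this.symm)
  refine ⟨V, U, MvPolynomial.coeff (K.cons b) W, ?_, ?_, hc, ?_, ?_, ?_, fun i => ?_⟩
  · intro h
    rw [← hVc, h] at hc
    simp at hc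
  · intro h
    rw [← hUc, h] at hc
    simp at hc
  · ext I
    rw [← Finsupp.cons_tail I, coeff_cons_aeval_mul_rename, MvPolynomial.coeff_C_mul, hVc, hUc]
    have : ∀ x y : ℤ, (x : ℚ) = y → x = y := fun x y h => by exact_mod_cast h
    apply this
    push_cast
    rw [hcoeff, hcoeff, hcoeff, hcoeff]
    ring
  · rw [plength]
    have hinj : Set.InjOn (fun t => K.cons t) (V.support : Set ℕ) := fun s _ t _ h =>
      (Finsupp.cons_injective2 h).1
    simp only [hVc]
    rw [← Finset.sum_image (f := fun I => |((MvPolynomial.coeff I W : ℤ) : ℝ)|) hinj]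
    refine Finset.sum_le_sum_of_subset_of_nonneg ?_ fun _ _ _ => abs_nonneg _
    intro I hI
    obtain ⟨t, ht, rfl⟩ := Finset.mem_image.1 hI
    rw [MvPolynomial.mem_support_iff, ← hVc]
    exact Polynomial.mem_support_iff.1 ht
  · rw [length]
    have hinj : Set.InjOn (fun I => Finsupp.cons b I) (U.support : Set (Fin m →₀ ℕ)) :=
      fun s _ t _ h => (Finsupp.cons_injective2 h).2
    simp only [hUc]
    rw [← Finset.sum_image (f := fun I => |((MvPolynomial.coeff I W : ℤ) : ℝ)|) hinj]
    refine Finset.sum_le_sum_of_subset_of_nonneg ?_ fun _ _ _ => abs_nonneg _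
    intro I hI
    obtain ⟨J, hJ, rfl⟩ := Finset.mem_image.1 hI
    rw [MvPolynomial.mem_support_iff, ← hUc]
    exact MvPolynomial.mem_support_iff.1 hJ
  · exact MvPolynomial.degreeOf_coeff_finSuccEquiv W i b

lemma hasse_wronskian_det_ne_zero {F : Type*} [Field F] [CharZero F] {k : ℕ} (f : Fin k → F[X])
    (hf : LinearIndependent F f) :
    (Matrix.of fun i j : Fin k => hasseDeriv (i : ℕ) (f j)).det ≠ 0 := by
  have h := wronskian_det_ne_zero f hf
  have h2 : (Matrix.of fun i j : Fin k => derivative^[i] (f j)) =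
      Matrix.of fun i j : Fin k => (fun i : Fin k => (((i : ℕ).factorial : ℕ) : F[X])) i *
        (Matrix.of fun i j : Fin k => hasseDeriv (i : ℕ) (f j)) i j := by
    ext1 i j
    have := congrFun (Polynomial.factorial_smul_hasseDeriv (R := F) (i : ℕ)) (f j)
    simp only [Matrix.of_apply, ← this]
    exact nsmul_eq_mul _ _
  rw [h2, Matrix.det_mul_column] at h
  exact right_ne_zero_of_mul h

lemma exists_wronskian_splitting {P : MvPolynomial (Fin (m + 1)) ℤ} (hP : P ≠ 0) {d : ℕ}
    (hd : P.degreeOf 0 ≤ d) :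
    ∃ k, 1 ≤ k ∧ k ≤ d + 1 ∧ ∃ J : Fin k → Fin m →₀ ℕ, (∀ i, (J i).degree ≤ i) ∧
      ∃ (V : ℤ[X]) (U : MvPolynomial (Fin m) ℤ) (c : ℤ) (W : MvPolynomial (Fin (m + 1)) ℤ),
        W = (Matrix.of fun l i : Fin k => hasse ((J i).cons l) P).det ∧
        V ≠ 0 ∧ U ≠ 0 ∧ c ≠ 0 ∧ MvPolynomial.C c * W =
          Polynomial.aeval (MvPolynomial.X 0) V * MvPolynomial.rename Fin.succ U ∧
        plength V ≤ length W ∧ length U ≤ length W ∧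
        ∀ i, U.degreeOf i ≤ W.degreeOf (Fin.succ i) := by
  set Q := MvPolynomial.map (algebraMap ℤ ℚ) P with hQ
  have hQ0 : Q ≠ 0 := by
    intro h
    exact hP (MvPolynomial.map_injective _ (algebraMap ℤ ℚ).injective_int (by rw [← hQ, h, map_zero]))
  have hQd : Q.degreeOf 0 ≤ d := MvPolynomial.degreeOf_le_iff.2 fun I hI =>
    MvPolynomial.degreeOf_le_iff.1 hd I (MvPolynomial.support_map_subset _ _ hI)
  obtain ⟨k, hk1, hk2, ψ, φ, hψ, hφ, hsum⟩ := exists_eq_sum_aeval_mul_rename hQ0 hQd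
  obtain ⟨J, hJ, hdet⟩ := exists_generalized_wronskian_ne_zero φ hφ
  refine ⟨k, hk1, hk2, J, hJ, ?_⟩
  set W := (Matrix.of fun l i : Fin k => hasse ((J i).cons l) P).det with hW
  have hmap : MvPolynomial.map (algebraMap ℤ ℚ) W =
      Polynomial.aeval (MvPolynomial.X 0)
        (Matrix.of fun i j : Fin k => hasseDeriv (i : ℕ) (ψ j)).det *
      MvPolynomial.rename Fin.succ (Matrix.of fun i j => hasse (J i) (φ j)).det := by
    have h1 : (MvPolynomial.map (algebraMap ℤ ℚ)).mapMatrix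
        (Matrix.of fun l i : Fin k => hasse ((J i).cons l) P) =
        (Polynomial.aeval (MvPolynomial.X 0 : MvPolynomial (Fin (m + 1)) ℚ)).mapMatrix
          (Matrix.of fun i j : Fin k => hasseDeriv (i : ℕ) (ψ j)) *
        ((MvPolynomial.rename Fin.succ).mapMatrix
          (Matrix.of fun i j => hasse (J i) (φ j))).transpose := by
      ext1 l i
      simp only [RingHom.mapMatrix_apply, Matrix.map_apply, Matrix.of_apply, Matrix.mul_apply,
        AlgHom.mapMatrix_apply, Matrix.transpose_apply]
      rw [map_hasse, ← hQ, hsum, map_sum]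
      exact Finset.sum_congr rfl fun j _ => hasse_cons_aeval_mul_rename _ _ _ _
    rw [hW, RingHom.map_det, h1, Matrix.det_mul, Matrix.det_transpose, AlgHom.map_det,
      AlgHom.map_det]
  obtain ⟨V, U, c, h⟩ := exists_int_splitting (hasse_wronskian_det_ne_zero ψ hψ) hdet hmap
  exact ⟨V, U, c, W, rfl, h⟩

end WronskianSplitting

section Index

/-- The weight of an exponent relative to the degrees `d`. -/
noncomputable def weight {σ : Type*} [Fintype σ] (d : σ → ℕ) (J : σ →₀ ℕ) : ℝ :=
  ∑ i, (J i : ℝ) / d i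

variable {σ : Type*} [Fintype σ]

lemma weight_nonneg (d : σ → ℕ) (J : σ →₀ ℕ) : 0 ≤ weight d J :=
  Finset.sum_nonneg fun _ _ => by positivity

lemma weight_add (d : σ → ℕ) (J K : σ →₀ ℕ) : weight d (J + K) = weight d J + weight d K := by
  simp only [weight, Finsupp.add_apply, Nat.cast_add, add_div, Finset.sum_add_distrib]

lemma weight_cons {m : ℕ} (d : Fin (m + 1) → ℕ) (t : ℕ) (J : Fin m →₀ ℕ) :
    weight d (J.cons t) = (t : ℝ) / d 0 + weight (fun i => d i.succ) J := by
  simp [weight, Fin.sum_univ_succ]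

variable {R S : Type*} [CommRing R] [CommRing S] [Algebra R S]

/-- `P` has index at least `θ` at `ξ` with respect to the degrees `d`. -/
def IndexGE (d : σ → ℕ) (ξ : σ → S) (θ : ℝ) (P : MvPolynomial σ R) : Prop :=
  ∀ J, weight d J < θ → MvPolynomial.coeff J (shift ξ P) = 0

variable {d : σ → ℕ} {ξ : σ → S}

lemma IndexGE.of_nonpos {θ : ℝ} (h : θ ≤ 0) (P : MvPolynomial σ R) : IndexGE d ξ θ P :=
  fun J hJ => absurd (weight_nonneg d J) (by linarith)

lemma IndexGE.mul {a b : ℝ} {P Q : MvPolynomial σ R} (hP : IndexGE d ξ a P)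
    (hQ : IndexGE d ξ b Q) : IndexGE d ξ (a + b) (P * Q) := by
  classical
  intro J hJ
  rw [map_mul, MvPolynomial.coeff_mul]
  refine Finset.sum_eq_zero fun x hx => ?_
  rw [← Finset.HasAntidiagonal.mem_antidiagonal.1 hx, weight_add] at hJ
  by_cases h : weight d x.1 < a
  · rw [hP _ h, zero_mul]
  · rw [hQ _ (by linarith), mul_zero]

lemma IndexGE.prod {ι : Type*} (s : Finset ι) {f : ι → MvPolynomial σ R} {g : ι → ℝ}
    (h : ∀ i ∈ s, IndexGE d ξ (g i) (f i)) : IndexGE d ξ (∑ i ∈ s, g i) (∏ i ∈ s, f i) := by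
  classical
  induction s using Finset.induction_on with
  | empty => exact IndexGE.of_nonpos (by simp) _
  | insert a s ha ih =>
    rw [Finset.sum_insert ha, Finset.prod_insert ha]
    exact (h a (Finset.mem_insert_self a s)).mul
      (ih fun i hi => h i (Finset.mem_insert_of_mem hi))

lemma IndexGE.det {k : ℕ} {M : Matrix (Fin k) (Fin k) (MvPolynomial σ R)} {g : Fin k → ℝ}
    (h : ∀ i j, IndexGE d ξ (g i) (M i j)) : IndexGE d ξ (∑ i, g i) M.det := by
  intro J hJ
  rw [Matrix.det_apply, map_sum, MvPolynomial.coeff_sum]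
  refine Finset.sum_eq_zero fun τ _ => ?_
  have h1 : IndexGE d ξ (∑ i, g i) (∏ i, M (τ i) i) := by
    rw [← Equiv.sum_comp τ g]
    exact IndexGE.prod _ fun i _ => h _ _
  have h2 := h1 J hJ
  rw [map_prod] at h2
  rcases Int.units_eq_one_or (Equiv.Perm.sign τ) with hs | hs <;> simp [hs, h2]

lemma IndexGE.hasse {θ : ℝ} {P : MvPolynomial σ R} (h : IndexGE d ξ θ P) (K : σ →₀ ℕ) :
    IndexGE d ξ (θ - weight d K) (hasse K P) := by
  intro J hJ
  rw [coeff_shift_hasse, h _ (by rw [weight_add]; linarith), mul_zero]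

lemma IndexGE.mono {a b : ℝ} (hab : a ≤ b) {P : MvPolynomial σ R} (h : IndexGE d ξ b P) :
    IndexGE d ξ a P :=
  fun J hJ => h J (hJ.trans_le hab)

end Index

section RothLemma

lemma mul_sq_le_sum_max {k d : ℕ} (hk : k ≤ d + 1) (hd : 1 ≤ d) {τ : ℝ} (hτ : 0 < τ)
    (hτ1 : τ ≤ 1) : k * τ ^ 2 / 8 ≤ ∑ l : Fin k, max 0 (τ - (l : ℕ) / (d : ℝ)) := by
  have hd0 : (0 : ℝ) < d := by exact_mod_cast hd
  set n := min k (⌊τ * d / 2⌋₊ + 1) with hn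
  rw [Fin.sum_univ_eq_sum_range (fun l : ℕ => max 0 (τ - (l : ℕ) / (d : ℝ)))]
  have h1 : (n : ℝ) * (τ / 2) ≤ ∑ l ∈ Finset.range k, max 0 (τ - (l : ℕ) / (d : ℝ)) := by
    calc (n : ℝ) * (τ / 2) = ∑ l ∈ Finset.range n, τ / 2 := by simp
      _ ≤ ∑ l ∈ Finset.range n, max 0 (τ - (l : ℕ) / (d : ℝ)) := by
        refine Finset.sum_le_sum fun l hl => le_max_of_le_right ?_
        have h2 : l ≤ ⌊τ * d / 2⌋₊ := by
          have := Finset.mem_range.1 hl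
          omega
        have h3 : (l : ℝ) ≤ τ * d / 2 := (Nat.le_floor_iff (by positivity)).1 h2
        have h4 : (l : ℝ) / d ≤ τ / 2 := by
          rw [div_le_iff₀ hd0]
          linarith
        linarith
      _ ≤ _ := Finset.sum_le_sum_of_subset_of_nonneg
        (Finset.range_subset_range.2 (min_le_left _ _)) fun _ _ _ => le_max_left _ _
  have h5 : (k : ℝ) * τ / 4 ≤ n := by
    have h6 : τ * d / 2 ≤ (⌊τ * d / 2⌋₊ + 1 : ℕ) := by
      push_cast
      exact (Nat.lt_floor_add_one _).le
    have h7 : (k : ℝ) ≤ 2 * d := by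
      have : k ≤ 2 * d := by omega
      exact_mod_cast this
    rw [hn, Nat.cast_min]
    refine le_min ?_ (le_trans ?_ h6)
    · have : (0 : ℝ) ≤ k := Nat.cast_nonneg k
      nlinarith
    · nlinarith
  nlinarith

variable {L : Type*} [Field L] [CharZero L]

/-- A lower bound `η` for the height of `ξ`, in the form of a bound on the order of vanishing at
`ξ` of integer polynomials. -/
def HeightGE (ξ : L) (η : ℝ) : Prop :=
  ∀ V : ℤ[X], V ≠ 0 → ∀ t : ℕ,
    (∀ s < t, (taylor ξ (V.map (algebraMap ℤ L))).coeff s = 0) → t * η ≤ Real.log (plength V)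

/-- **Roth's lemma**. -/
lemma exists_coeff_shift_ne_zero (L : Type*) [Field L] [CharZero L] (m : ℕ) :
    ∀ ε : ℝ, 0 < ε → ∃ ω : ℝ, 0 < ω ∧
    ∀ (d : Fin m → ℕ) (ξ : Fin m → L) (η : Fin m → ℝ) (P : MvPolynomial (Fin m) ℤ) (D : ℝ),
      P ≠ 0 → (∀ i, P.degreeOf i ≤ d i) → (∀ i, 0 < d i) → (∀ i, (d i : ℝ) ≤ D) →
      (∀ i j, i < j → (d i : ℝ) ≤ ω * d j) → (∀ i, HeightGE (ξ i) (η i)) →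
      (∀ i, Real.log (length P) + D ≤ ω * d i * η i) →
      ∃ J, weight d J ≤ ε ∧ MvPolynomial.coeff J (shift ξ P) ≠ 0 := by
  induction m with
  | zero =>
    intro ε hε
    refine ⟨1, one_pos, fun d ξ η P D hP _ _ _ _ _ _ => ?_⟩
    obtain ⟨J, hJ⟩ := MvPolynomial.ne_zero_iff.1
      ((map_ne_zero_iff _ (shift_injective (algebraMap ℤ L).injective_int ξ)).2 hP)
    exact ⟨J, by simpa [weight] using hε.le, hJ⟩
  | succ m ih =>
    intro ε' hε'
    set ε := min ε' 1 with hε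
    have hε0 : 0 < ε := lt_min hε' one_pos
    have hε1 : ε ≤ 1 := min_le_right _ _
    obtain ⟨ω', hω', H⟩ := ih (ε ^ 2 / 100) (by positivity)
    set ω := min (ε / 2) (min (ω' / (m + 3)) (ε ^ 2 / 100 / (m + 2))) with hω
    have hω0 : 0 < ω := lt_min (by positivity) (lt_min (by positivity) (by positivity))
    have hω1 : ω ≤ ε / 2 := min_le_left _ _
    have hω2 : (m + 3) * ω ≤ ω' := by
      have : ω ≤ ω' / (m + 3) := (min_le_right _ _).trans (min_le_left _ _)
      rw [le_div_iff₀ (by positivity)] at this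
      linarith
    have hω3 : (m + 2) * ω ≤ ε ^ 2 / 100 := by
      have : ω ≤ ε ^ 2 / 100 / (m + 2) := (min_le_right _ _).trans (min_le_right _ _)
      rw [le_div_iff₀ (by positivity)] at this
      linarith
    refine ⟨ω, hω0, fun d ξ η P D hP hPd hd hdD hdd hη hlog => ?_⟩
    by_contra! hcon
    have hidx : IndexGE d ξ ε P := fun J hJ => hcon J (hJ.le.trans (min_le_left _ _))
    obtain ⟨k, hk1, hk2, J, hJ, V, U, c, W, hW, hV0, hU0, hc0, hcW, hVW, hUW, hUd⟩ :=
      exists_wronskian_splitting hP (hPd 0)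
    have hd0 : (0 : ℝ) < d 0 := by exact_mod_cast hd 0
    have hk0 : (0 : ℝ) < k := by exact_mod_cast hk1
    have hD0 : 0 < D := hd0.trans_le (hdD 0)
    have hlP : 1 ≤ length P := one_le_length hP
    have hlogP : 0 ≤ Real.log (length P) := Real.log_nonneg hlP
    have hη0 : ∀ i, 0 < (d i : ℝ) * η i := by
      intro i
      have := hlog i
      by_contra! h
      nlinarith
    -- the size of the Wronskian
    have hWlen : length W ≤ k.factorial * (2 ^ (∑ i, d i) * length P) ^ k := by
      rw [hW]
      exact length_det_le _ fun i j => length_hasse_le hPd _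
    have hlogW : ∀ X : ℝ, 0 < X → X ≤ length W →
        Real.log X ≤ k * ((m + 2) * (Real.log (length P) + D)) := by
      intro X hX hXW
      have h1 : X ≤ (k : ℝ) ^ k * (2 ^ (∑ i, d i) * length P) ^ k :=
        hXW.trans (hWlen.trans (by
          gcongr
          exact_mod_cast Nat.factorial_le_pow k))
      have h2 := Real.log_le_log hX h1
      rw [← mul_pow, Real.log_pow, Real.log_mul (by positivity) (by positivity),
        Real.log_mul (by positivity) (by positivity), Real.log_pow] at h2
      have h3 : Real.log k ≤ D := by
        have := Real.log_le_sub_one_of_pos hk0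
        have h4 : (k : ℝ) ≤ d 0 + 1 := by exact_mod_cast hk2
        linarith [hdD 0]
      have h5 : ((∑ i, d i : ℕ) : ℝ) ≤ (m + 1) * D := by
        push_cast
        calc ∑ i, (d i : ℝ) ≤ ∑ _i : Fin (m + 1), D := Finset.sum_le_sum fun i _ => hdD i
          _ = (m + 1) * D := by simp
      have h6 : ((∑ i, d i : ℕ) : ℝ) * Real.log 2 ≤ (m + 1) * D := by
        have := Real.log_two_lt_d9
        have h7 : (0 : ℝ) ≤ ((∑ i, d i : ℕ) : ℝ) := Nat.cast_nonneg _
        nlinarith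
      refine h2.trans (mul_le_mul_of_nonneg_left ?_ hk0.le)
      have hm : (0 : ℝ) ≤ m := Nat.cast_nonneg m
      nlinarith
    -- a small nonvanishing derivative of `U`
    obtain ⟨K, hK, hKU⟩ := H (fun i => k * d i.succ) (fun i => ξ i.succ) (fun i => η i.succ) U
      (k * D) hU0 (fun i => (hUd i).trans (by
        rw [hW]
        exact degreeOf_det_le _ _ fun a b => (degreeOf_hasse_le _ _ _).trans (hPd _)))
      (fun i => Nat.mul_pos hk1 (hd _))
      (fun i => by
        push_cast
        exact mul_le_mul_of_nonneg_left (hdD _) hk0.le)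
      (fun i j hij => by
        push_cast
        have := hdd i.succ j.succ (Fin.succ_lt_succ_iff.2 hij)
        have hle : ω ≤ ω' := by
          have hm : (0 : ℝ) ≤ m := Nat.cast_nonneg m
          nlinarith
        have h2 : (d i.succ : ℝ) ≤ ω' * d j.succ :=
          this.trans (mul_le_mul_of_nonneg_right hle (Nat.cast_nonneg _))
        nlinarith)
      (fun i => hη _)
      (fun i => by
        have h1 := hlogW (length U) (one_pos.trans_le (one_le_length hU0)) hUW
        have h2 := hlog i.succ
        have h3 := hη0 i.succ
        have hm : (0 : ℝ) ≤ m := Nat.cast_nonneg m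
        push_cast
        have h4 : Real.log (length U) + k * D ≤ k * ((m + 3) * (Real.log (length P) + D)) := by
          nlinarith
        refine h4.trans ?_
        have h5 : (m + 3) * (Real.log (length P) + D) ≤ ω' * (d i.succ * η i.succ) :=
          calc (m + 3) * (Real.log (length P) + D) ≤ (m + 3) * (ω * (d i.succ * η i.succ)) := by
                gcongr
                linarith
            _ = (m + 3) * ω * (d i.succ * η i.succ) := by ring
            _ ≤ _ := mul_le_mul_of_nonneg_right hω2 h3.le
        calc k * ((m + 3) * (Real.log (length P) + D)) ≤ k * (ω' * (d i.succ * η i.succ)) :=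
              mul_le_mul_of_nonneg_left h5 hk0.le
          _ = _ := by ring)
    -- the order of vanishing of `V`
    have hVt : ∃ t, (taylor (ξ 0) (V.map (algebraMap ℤ L))).coeff t ≠ 0 := by
      by_contra! h
      have h1 : taylor (ξ 0) (V.map (algebraMap ℤ L)) = 0 := Polynomial.ext h
      have h2 : V.map (algebraMap ℤ L) = 0 := taylor_injective _ (by rw [h1, map_zero])
      exact hV0 ((Polynomial.map_eq_zero_iff (algebraMap ℤ L).injective_int).1 h2)
    classical
    set t := Nat.find hVt with ht
    have htV : (t : ℝ) / d 0 ≤ k * (ε ^ 2 / 100) := by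
      have h1 : (t : ℝ) * η 0 ≤ Real.log (plength V) :=
        hη 0 V hV0 t fun s hs => not_not.1 (Nat.find_min hVt hs)
      have h0 : 0 < plength V := by
        obtain ⟨n, hn⟩ := Polynomial.nonempty_support_iff.2 hV0
        exact Finset.sum_pos' (fun _ _ => abs_nonneg _) ⟨n, hn, by
          have := Polynomial.mem_support_iff.1 hn
          positivity⟩
      have h2 := hlogW _ h0 hVW
      have h3 := hlog 0
      have h4 : (0 : ℝ) < η 0 := pos_of_mul_pos_right (hη0 0) hd0.le
      have h5 : (t : ℝ) * η 0 ≤ k * ((m + 2) * ω) * d 0 * η 0 :=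
        calc (t : ℝ) * η 0 ≤ k * ((m + 2) * (ω * d 0 * η 0)) := by
              refine (h1.trans h2).trans ?_
              gcongr
          _ = _ := by ring
      have h6 := le_of_mul_le_mul_right h5 h4
      rw [div_le_iff₀ hd0]
      refine h6.trans ?_
      gcongr
    -- comparison of indices
    have hWidx : IndexGE d ξ (∑ l : Fin k, max 0 ((ε - ω) - (l : ℕ) / (d 0 : ℝ))) W := by
      rw [hW]
      refine IndexGE.det fun l i => ?_
      rcases le_total 0 ((ε - ω) - ((l : ℕ) : ℝ) / (d 0 : ℝ)) with h | h
      · rw [max_eq_right h]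
        refine (hidx.hasse _).mono ?_
        rw [weight_cons]
        have h1 : weight (fun i => d i.succ) (J i) ≤ ω := by
          have h2 : ∀ a : Fin m, ((J i a : ℕ) : ℝ) / d a.succ ≤ J i a * (ω / d 0) := by
            intro a
            rw [div_eq_mul_inv]
            refine mul_le_mul_of_nonneg_left ?_ (Nat.cast_nonneg _)
            have := hdd 0 a.succ (Fin.succ_pos a)
            have h3 : (0 : ℝ) < d a.succ := by exact_mod_cast hd _
            rw [inv_eq_one_div, div_le_div_iff₀ h3 hd0]
            linarith
          calc weight (fun i => d i.succ) (J i) ≤ ∑ a, (J i a : ℝ) * (ω / d 0) :=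
                Finset.sum_le_sum fun a _ => h2 a
            _ = ((J i).degree : ℝ) * (ω / d 0) := by
                rw [← Finset.sum_mul, Finsupp.degree_eq_sum]
                push_cast
                rfl
            _ ≤ d 0 * (ω / d 0) := by
                gcongr
                have h3 := hJ i
                have h4 := i.2
                have : (J i).degree ≤ d 0 := by omega
                exact_mod_cast this
            _ = ω := by field_simp
        linarith
      · rw [max_eq_left h]
        exact IndexGE.of_nonpos le_rfl _
    have hne : MvPolynomial.coeff (K.cons t) (shift ξ W) ≠ 0 := by
      intro h
      have h1 := congrArg (fun Q => MvPolynomial.coeff (K.cons t) (shift ξ Q)) hcW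
      simp only [shift_aeval_mul_rename, coeff_cons_aeval_mul_rename] at h1
      rw [← MvPolynomial.smul_eq_C_mul, map_smul, MvPolynomial.coeff_smul, h, smul_zero] at h1
      exact mul_ne_zero (Nat.find_spec hVt) hKU h1.symm
    have hbound := mul_sq_le_sum_max hk2 (hd 0) (τ := ε - ω) (by linarith) (by linarith)
    have hw : weight d (K.cons t) < ∑ l : Fin k, max 0 ((ε - ω) - (l : ℕ) / (d 0 : ℝ)) := by
      rw [weight_cons]
      have h1 : weight (fun i => d i.succ) K ≤ k * (ε ^ 2 / 100) := by
        have h2 : weight (fun i => d i.succ) K = k * weight (fun i => k * d i.succ) K := by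
          rw [weight, weight, Finset.mul_sum]
          refine Finset.sum_congr rfl fun i _ => ?_
          have : (d i.succ : ℝ) ≠ 0 := by exact_mod_cast (hd _).ne'
          push_cast
          field_simp
        rw [h2]
        exact mul_le_mul_of_nonneg_left hK hk0.le
      have h3 : (ε / 2) ^ 2 ≤ (ε - ω) ^ 2 := by
        apply pow_le_pow_left₀ <;> linarith
      have h4 : 0 < k * ε ^ 2 := by positivity
      have h5 : k * (ε / 2) ^ 2 ≤ k * (ε - ω) ^ 2 := mul_le_mul_of_nonneg_left h3 hk0.le
      linarith
    exact hne (hWidx _ hw)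

end RothLemma

section Auxiliary

section Siegel

attribute [local instance] Matrix.seminormedAddCommGroup

lemma exists_int_solution {ι κ : Type*} [Fintype ι] [Fintype κ] [Nonempty κ] (A : ι → κ → ℤ)
    (hcard : 2 * Fintype.card ι ≤ Fintype.card κ) {B : ℝ} (hB : 1 ≤ B)
    (hA : ∀ i j, |(A i j : ℝ)| ≤ B) :
    ∃ t : κ → ℤ, t ≠ 0 ∧ (∀ i, ∑ j, A i j * t j = 0) ∧
      ∀ j, |(t j : ℝ)| ≤ Fintype.card κ * B := by
  have hκ : 0 < Fintype.card κ := Fintype.card_pos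
  have hκ1 : (1 : ℝ) ≤ Fintype.card κ := by exact_mod_cast hκ
  rcases Nat.eq_zero_or_pos (Fintype.card ι) with h0 | h0
  · have := Fintype.card_eq_zero_iff.1 h0
    refine ⟨fun _ => 1, fun h => ?_, fun i => isEmptyElim i, fun j => ?_⟩
    · simpa using congrFun h (Classical.arbitrary κ)
    · simpa using one_le_mul_of_one_le_of_one_le hκ1 hB
  · obtain ⟨t, ht0, ht, htn⟩ := Int.Matrix.exists_ne_zero_int_vec_norm_le (Matrix.of A)
      (by omega) h0
    refine ⟨t, ht0, fun i => congrFun ht i, fun j => ?_⟩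
    have h1 : |(t j : ℝ)| ≤ ‖t‖ := by
      have := norm_le_pi_norm t j
      rwa [Int.norm_eq_abs] at this
    have h2 : max 1 ‖Matrix.of A‖ ≤ B := max_le hB ((Matrix.norm_le_iff (by linarith)).2 fun i j => by
      rw [Int.norm_eq_abs]
      exact hA i j)
    have h3 : (1 : ℝ) ≤ Fintype.card κ * max 1 ‖Matrix.of A‖ :=
      one_le_mul_of_one_le_of_one_le hκ1 (le_max_left _ _)
    have h4 : (2 * Fintype.card ι : ℝ) ≤ Fintype.card κ := by exact_mod_cast hcard
    have h5 : (0 : ℝ) < Fintype.card ι := by exact_mod_cast h0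
    calc |(t j : ℝ)| ≤ _ := h1.trans htn
      _ ≤ (Fintype.card κ * max 1 ‖Matrix.of A‖) ^ (1 : ℝ) := by
        refine Real.rpow_le_rpow_of_exponent_le h3 ?_
        rw [div_le_one (by linarith)]
        linarith
      _ ≤ Fintype.card κ * B := by
        rw [Real.rpow_one]
        gcongr

end Siegel

lemma sum_exp_le (d : ℕ) (hd : 0 < d) (lam : ℝ) :
    ∑ j ∈ Finset.range (d + 1), Real.exp (lam * (1 / 2 - j / d)) ≤
      (d + 1) * Real.exp (lam ^ 2 / 8) := by
  have hd0 : (0 : ℝ) < d := by exact_mod_cast hd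
  have h1 : ∑ j ∈ Finset.range (d + 1), Real.exp (lam * (1 / 2 - j / d)) =
      ∑ j ∈ Finset.range (d + 1), Real.cosh (lam * (1 / 2 - j / d)) := by
    have h2 : ∑ j ∈ Finset.range (d + 1), Real.exp (lam * (1 / 2 - j / d)) =
        ∑ j ∈ Finset.range (d + 1), Real.exp (-(lam * (1 / 2 - j / d))) := by
      rw [← Finset.sum_range_reflect]
      refine Finset.sum_congr rfl fun j hj => ?_
      have h3 : j ≤ d := Nat.lt_succ_iff.1 (Finset.mem_range.1 hj)
      rw [Nat.add_sub_cancel, Nat.cast_sub h3]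
      congr 1
      field_simp
      ring
    simp only [Real.cosh_eq, add_div, Finset.sum_add_distrib, ← Finset.sum_div]
    rw [← h2]
    ring
  rw [h1]
  calc ∑ j ∈ Finset.range (d + 1), Real.cosh (lam * (1 / 2 - j / d))
      ≤ ∑ j ∈ Finset.range (d + 1), Real.exp (lam ^ 2 / 8) := by
        refine Finset.sum_le_sum fun j hj => (Real.cosh_le_exp_half_sq _).trans ?_
        have h3 : (j : ℝ) ≤ d := by exact_mod_cast Nat.lt_succ_iff.1 (Finset.mem_range.1 hj)
        have h4 : (j : ℝ) / d ≤ 1 := (div_le_one hd0).2 h3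
        have h5 : 0 ≤ (j : ℝ) / d := by positivity
        have h6 : (1 / 2 - (j : ℝ) / d) ^ 2 ≤ 1 / 4 := by nlinarith
        rw [Real.exp_le_exp, mul_pow]
        nlinarith [sq_nonneg lam]
    _ = (d + 1) * Real.exp (lam ^ 2 / 8) := by simp

/-- The exponents bounded by `d` coordinatewise. -/
def box {m : ℕ} (d : Fin m → ℕ) : Finset (Fin m → ℕ) :=
  Fintype.piFinset fun i => Finset.range (d i + 1)

lemma mem_box {m : ℕ} {d : Fin m → ℕ} {J : Fin m → ℕ} : J ∈ box d ↔ ∀ i, J i ≤ d i := by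
  simp [box]

lemma card_box {m : ℕ} (d : Fin m → ℕ) : (box d).card = ∏ i, (d i + 1) := by
  simp [box]

lemma card_filter_weight_le {m : ℕ} (d : Fin m → ℕ) (hd : ∀ i, 0 < d i) {ε : ℝ} (hε : 0 < ε) :
    (((box d).filter fun J => ∑ i, (J i : ℝ) / d i < m * (1 / 2 - ε)).card : ℝ) ≤
      (box d).card * Real.exp (-(2 * m * ε ^ 2)) := by
  set S := (box d).filter fun J => ∑ i, (J i : ℝ) / d i < m * (1 / 2 - ε)
  calc (S.card : ℝ) = ∑ J ∈ S, 1 := by simp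
    _ ≤ ∑ J ∈ S, Real.exp (4 * ε * (∑ i, (1 / 2 - (J i : ℝ) / d i) - m * ε)) := by
      refine Finset.sum_le_sum fun J hJ => Real.one_le_exp ?_
      have h1 := (Finset.mem_filter.1 hJ).2
      have h2 : ∑ i, (1 / 2 - (J i : ℝ) / d i) = m * (1 / 2) - ∑ i, (J i : ℝ) / d i := by
        rw [Finset.sum_sub_distrib]
        simp
      rw [h2]
      have : 0 ≤ m * (1 / 2) - ∑ i, (J i : ℝ) / d i - m * ε := by linarith
      positivity
    _ ≤ ∑ J ∈ box d, Real.exp (4 * ε * (∑ i, (1 / 2 - (J i : ℝ) / d i) - m * ε)) :=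
      Finset.sum_le_sum_of_subset_of_nonneg (Finset.filter_subset _ _)
        fun _ _ _ => (Real.exp_pos _).le
    _ = Real.exp (-(4 * m * ε ^ 2)) *
        ∑ J ∈ box d, ∏ i, Real.exp (4 * ε * (1 / 2 - (J i : ℝ) / d i)) := by
      rw [Finset.mul_sum]
      refine Finset.sum_congr rfl fun J _ => ?_
      rw [← Real.exp_sum, ← Real.exp_add, ← Finset.mul_sum]
      congr 1
      ring
    _ = Real.exp (-(4 * m * ε ^ 2)) *
        ∏ i, ∑ j ∈ Finset.range (d i + 1), Real.exp (4 * ε * (1 / 2 - (j : ℝ) / d i)) := by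
      rw [Finset.prod_univ_sum]
      rfl
    _ ≤ Real.exp (-(4 * m * ε ^ 2)) * ∏ i, ((d i + 1) * Real.exp ((4 * ε) ^ 2 / 8)) := by
      gcongr with i
      exact sum_exp_le _ (hd i) _
    _ = (box d).card * Real.exp (-(2 * m * ε ^ 2)) := by
      rw [Finset.prod_mul_distrib, card_box, Finset.prod_const, ← Real.exp_nat_mul]
      simp only [Finset.card_univ, Fintype.card_fin]
      push_cast
      rw [mul_left_comm, ← Real.exp_add]
      congr 2
      ring

lemma exists_pow_eq_sum {L : Type*} [Field L] {r : ℕ} {g : ℤ} (hg : g ≠ 0) (b : Fin (r + 1) → ℤ)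
    {α : L} (hα : (g : L) * α ^ (r + 1) = ∑ l : Fin (r + 1), (b l : L) * α ^ (l : ℕ)) :
    ∃ C : ℝ, 1 ≤ C ∧ |(g : ℝ)| ≤ C ∧ ∀ e : ℕ, ∃ a : Fin (r + 1) → ℤ,
      (g : L) ^ e * α ^ e = ∑ l : Fin (r + 1), (a l : L) * α ^ (l : ℕ) ∧
        ∀ l, |(a l : ℝ)| ≤ C ^ e := by
  have hg1 : (1 : ℝ) ≤ |(g : ℝ)| := by exact_mod_cast Int.one_le_abs hg
  have hb : 0 ≤ ∑ l, |(b l : ℝ)| := Finset.sum_nonneg fun _ _ => abs_nonneg _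
  set C := |(g : ℝ)| + ∑ l, |(b l : ℝ)| with hC
  refine ⟨C, by linarith, by linarith, fun e => ?_⟩
  induction e with
  | zero =>
    refine ⟨Pi.single 0 1, ?_, fun l => ?_⟩
    · rw [Finset.sum_eq_single 0]
      · simp
      · intro l _ hl
        simp [hl]
      · simp
    · by_cases h : l = 0
      · subst h
        simp
      · simp [h]
  | succ e ih =>
    obtain ⟨a, ha, haC⟩ := ih
    refine ⟨fun l => (Fin.cons 0 (fun i : Fin r => g * a i.castSucc) : Fin (r + 1) → ℤ) l +
      a (Fin.last r) * b l, ?_, fun l => ?_⟩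
    · calc (g : L) ^ (e + 1) * α ^ (e + 1) = ((g : L) ^ e * α ^ e) * (g * α) := by ring
        _ = ∑ i : Fin r, (g * a i.castSucc : L) * α ^ ((i : ℕ) + 1) +
            a (Fin.last r) * (g * α ^ (r + 1)) := by
          rw [ha, Fin.sum_univ_castSucc, add_mul, Finset.sum_mul]
          congr 1
          · exact Finset.sum_congr rfl fun i _ => by
              rw [Fin.val_castSucc]
              ring
          · rw [Fin.val_last]
            ring
        _ = _ := by
          simp only [Int.cast_add, add_mul, Finset.sum_add_distrib]
          rw [hα, Fin.sum_univ_succ (fun l => ((Fin.cons 0 (fun i : Fin r => g * a i.castSucc) :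
            Fin (r + 1) → ℤ) l : L) * α ^ (l : ℕ)), Finset.mul_sum]
          simp [mul_assoc]
    · have h1 : |((Fin.cons 0 (fun i : Fin r => g * a i.castSucc) : Fin (r + 1) → ℤ) l : ℝ)| ≤
          |(g : ℝ)| * C ^ e := by
        refine Fin.cases ?_ (fun i => ?_) l
        · simp only [Fin.cons_zero, Int.cast_zero, abs_zero]
          positivity
        · rw [Fin.cons_succ, Int.cast_mul, abs_mul]
          exact mul_le_mul_of_nonneg_left (haC _) (abs_nonneg _)
      have h2 : |(b l : ℝ)| ≤ ∑ l, |(b l : ℝ)| :=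
        Finset.single_le_sum (f := fun l => |(b l : ℝ)|) (fun _ _ => abs_nonneg _)
          (Finset.mem_univ l)
      push_cast
      calc _ ≤ |(g : ℝ)| * C ^ e + C ^ e * ∑ l, |(b l : ℝ)| := by
            refine (abs_add_le _ _).trans (add_le_add h1 ?_)
            rw [abs_mul]
            exact mul_le_mul (haC _) h2 (abs_nonneg _) (by positivity)
        _ = C ^ (e + 1) := by
            rw [hC]
            ring

end Auxiliary

section AuxiliaryPolynomial

variable {L : Type*} [Field L] [CharZero L]

lemma exists_int_relation {α : L} (hα : IsAlgebraic ℚ α) : ∃ (r : ℕ) (g : ℤ)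
    (b : Fin (r + 1) → ℤ), g ≠ 0 ∧
      (g : L) * α ^ (r + 1) = ∑ l : Fin (r + 1), (b l : L) * α ^ (l : ℕ) := by
  obtain ⟨f, hf, hfα⟩ := (IsFractionRing.isAlgebraic_iff ℤ ℚ L).2 hα
  obtain ⟨r, hr⟩ : ∃ r, f.natDegree = r + 1 := by
    refine Nat.exists_eq_succ_of_ne_zero fun h => hf ?_
    rw [eq_C_of_natDegree_eq_zero h, aeval_C] at hfα
    rw [eq_C_of_natDegree_eq_zero h,
      (map_eq_zero_iff _ (algebraMap ℤ L).injective_int).1 hfα, C_0]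
  refine ⟨r, f.leadingCoeff, fun l => -f.coeff l, leadingCoeff_ne_zero.2 hf, ?_⟩
  rw [aeval_eq_sum_range, hr, Finset.sum_range_succ, ← hr, coeff_natDegree, hr,
    ← Fin.sum_univ_eq_sum_range (fun i => f.coeff i • α ^ i)] at hfα
  simp only [zsmul_eq_mul] at hfα
  simp only [Int.cast_neg, neg_mul, Finset.sum_neg_distrib]
  linear_combination hfα

lemma card_box_le {m : ℕ} (d : Fin m → ℕ) : (box d).card ≤ 2 ^ ∑ i, d i := by
  rw [card_box, ← Finset.prod_pow_eq_pow_sum]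
  exact Finset.prod_le_prod' fun i _ => Nat.succ_le_of_lt (Nat.lt_two_pow_self)

/-- The auxiliary polynomial: a nonzero polynomial with integer coefficients of controlled size and
large index at `(α, …, α)`. -/
lemma exists_auxiliary_polynomial {α : L} (hα : IsAlgebraic ℚ α) :
    ∃ C : ℝ, 1 ≤ C ∧ ∀ ε : ℝ, 0 < ε → ∃ m₀ : ℕ, ∀ m ≥ m₀, ∀ d : Fin m → ℕ, (∀ i, 0 < d i) →
      ∃ P : MvPolynomial (Fin m) ℤ, P ≠ 0 ∧ (∀ i, P.degreeOf i ≤ d i) ∧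
        length P ≤ C ^ ∑ i, d i ∧ IndexGE d (fun _ => α) (m * (1 / 2 - ε)) P := by
  classical
  obtain ⟨r, g, b, hg, hrel⟩ := exists_int_relation hα
  obtain ⟨C, hC1, hgC, hpow⟩ := exists_pow_eq_sum hg b hrel
  choose a ha haC using hpow
  refine ⟨8 * C, by linarith, fun ε hε => ?_⟩
  obtain ⟨m₀, hm₀⟩ : ∃ m₀ : ℕ, Real.log (2 * (r + 1)) / (2 * ε ^ 2) ≤ m₀ := exists_nat_ge _
  refine ⟨m₀, fun m hm d hd => ?_⟩
  set S := (box d).filter fun J => ∑ i, (J i : ℝ) / d i < m * (1 / 2 - ε)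
  let M : ({K // K ∈ S} × Fin (r + 1)) → {J // J ∈ box d} → ℤ := fun x J =>
    ((∏ i, (J.1 i).choose (x.1.1 i) : ℕ) : ℤ) *
      (g ^ (∑ i, d i - ∑ i, (J.1 i - x.1.1 i)) * a (∑ i, (J.1 i - x.1.1 i)) x.2)
  have hne : Nonempty {J // J ∈ box d} := ⟨⟨0, mem_box.2 fun i => Nat.zero_le _⟩⟩
  have hle : ∀ (J : {J // J ∈ box d}) (K : Fin m → ℕ), ∑ i, (J.1 i - K i) ≤ ∑ i, d i :=
    fun J K => Finset.sum_le_sum fun i _ => (Nat.sub_le _ _).trans (mem_box.1 J.2 i)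
  have hM : ∀ x J, |(M x J : ℝ)| ≤ (2 * C) ^ ∑ i, d i := by
    intro x J
    simp only [M]
    push_cast
    rw [abs_mul, abs_mul, abs_pow, mul_pow]
    refine mul_le_mul ?_ ?_ (by positivity) (by positivity)
    · rw [abs_of_nonneg (by positivity), ← Finset.prod_pow_eq_pow_sum]
      refine Finset.prod_le_prod (fun _ _ => by positivity) fun i _ => ?_
      have h1 : (J.1 i).choose (x.1.1 i) ≤ 2 ^ d i :=
        (Nat.choose_le_two_pow _ _).trans (Nat.pow_le_pow_right (by norm_num) (mem_box.1 J.2 i))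
      exact_mod_cast h1
    · calc |(g : ℝ)| ^ (∑ i, d i - ∑ i, (J.1 i - x.1.1 i)) * |(a (∑ i, (J.1 i - x.1.1 i)) x.2 : ℝ)|
          ≤ C ^ (∑ i, d i - ∑ i, (J.1 i - x.1.1 i)) * C ^ (∑ i, (J.1 i - x.1.1 i)) :=
            mul_le_mul (pow_le_pow_left₀ (abs_nonneg _) hgC _) (haC _ _) (abs_nonneg _)
              (by positivity)
        _ = C ^ ∑ i, d i := by rw [← pow_add, Nat.sub_add_cancel (hle _ _)]
  have hcard : 2 * Fintype.card ({K // K ∈ S} × Fin (r + 1)) ≤ Fintype.card {J // J ∈ box d} := by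
    simp only [Fintype.card_prod, Fintype.card_coe, Fintype.card_fin]
    have h1 := card_filter_weight_le d hd hε
    have h2 : Real.log (2 * (r + 1)) ≤ 2 * m * ε ^ 2 := by
      have h3 : Real.log (2 * (r + 1)) / (2 * ε ^ 2) ≤ m := hm₀.trans (by exact_mod_cast hm)
      rw [div_le_iff₀ (by positivity)] at h3
      linarith
    have h4 : Real.exp (-(2 * m * ε ^ 2)) ≤ (2 * (r + 1) : ℝ)⁻¹ := by
      rw [Real.exp_neg]
      refine inv_anti₀ (by positivity) ?_
      rwa [← Real.log_le_iff_le_exp (by positivity)]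
    have h5 : (S.card : ℝ) ≤ (box d).card * (2 * (r + 1) : ℝ)⁻¹ :=
      h1.trans (mul_le_mul_of_nonneg_left h4 (Nat.cast_nonneg _))
    rw [← div_eq_mul_inv, le_div_iff₀ (by positivity)] at h5
    have h6 : ((2 * (S.card * (r + 1)) : ℕ) : ℝ) ≤ ((box d).card : ℕ) := by
      push_cast
      linarith
    exact_mod_cast h6
  obtain ⟨t, ht0, ht, htn⟩ := exists_int_solution M hcard
    (one_le_pow₀ (by linarith : (1 : ℝ) ≤ 2 * C)) hM
  let e : {J // J ∈ box d} → (Fin m →₀ ℕ) := fun J => Finsupp.equivFunOnFinite.symm J.1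
  have he : Function.Injective e := fun J J' h =>
    Subtype.ext (Finsupp.equivFunOnFinite.symm.injective h)
  set P : MvPolynomial (Fin m) ℤ := ∑ J, MvPolynomial.monomial (e J) (t J) with hP
  have hPc : ∀ J, MvPolynomial.coeff (e J) P = t J := by
    intro J
    rw [hP, MvPolynomial.coeff_sum, Finset.sum_eq_single J]
    · simp
    · intro J' _ hJ'
      rw [MvPolynomial.coeff_monomial, if_neg fun h => hJ' (he h)]
    · simp
  refine ⟨P, fun h => ht0 (funext fun J => ?_), fun i => ?_, ?_, fun K hK => ?_⟩
  · rw [← hPc, h]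
    simp
  · refine (MvPolynomial.degreeOf_sum_le _ _ _).trans (Finset.sup_le fun J _ => ?_)
    refine MvPolynomial.degreeOf_le_iff.2 fun I hI => ?_
    rw [Finset.mem_singleton.1 (MvPolynomial.support_monomial_subset hI)]
    exact mem_box.1 J.2 i
  · have hn : (Fintype.card {J // J ∈ box d} : ℝ) ≤ 2 ^ ∑ i, d i := by
      rw [Fintype.card_coe]
      exact_mod_cast card_box_le d
    calc length P ≤ ∑ J, length (MvPolynomial.monomial (e J) (t J)) := length_sum_le _ _
      _ ≤ ∑ _J : {J // J ∈ box d}, Fintype.card {J // J ∈ box d} * (2 * C) ^ ∑ i, d i :=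
        Finset.sum_le_sum fun J _ => by
          rw [length_monomial]
          exact htn J
      _ = Fintype.card {J // J ∈ box d} *
          (Fintype.card {J // J ∈ box d} * (2 * C) ^ ∑ i, d i) := by simp
      _ ≤ 2 ^ (∑ i, d i) * (2 ^ (∑ i, d i) * (2 * C) ^ ∑ i, d i) := by gcongr
      _ = (8 * C) ^ ∑ i, d i := by
        rw [← mul_pow, ← mul_pow]
        congr 1
        ring
  · have hterm : ∀ J, MvPolynomial.coeff K (shift (fun _ => α) (MvPolynomial.monomial (e J) (t J))) =
        (t J : L) * ((∏ i, (J.1 i).choose (K i) : ℕ) : L) * α ^ ∑ i, (J.1 i - K i) := by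
      intro J
      rw [coeff_shift_monomial, Finset.prod_mul_distrib, Finset.prod_pow_eq_pow_sum, ← mul_assoc]
      push_cast
      rfl
    rw [hP, map_sum, MvPolynomial.coeff_sum]
    simp only [hterm]
    by_cases hKd : (K : Fin m → ℕ) ∈ box d
    · have hKS : (K : Fin m → ℕ) ∈ S := Finset.mem_filter.2 ⟨hKd, hK⟩
      have hg0 : (g : L) ^ ∑ i, d i ≠ 0 := pow_ne_zero _ (Int.cast_ne_zero.2 hg)
      refine (mul_eq_zero.1 ?_).resolve_left hg0
      rw [Finset.mul_sum]
      calc ∑ J : {J // J ∈ box d}, (g : L) ^ (∑ i, d i) *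
            ((t J : L) * ((∏ i, (J.1 i).choose (K i) : ℕ) : L) * α ^ ∑ i, (J.1 i - K i))
          = ∑ J, ∑ l, (M (⟨K, hKS⟩, l) J * t J : L) * α ^ (l : ℕ) := by
            refine Finset.sum_congr rfl fun J _ => ?_
            have h1 : (g : L) ^ (∑ i, d i) = g ^ (∑ i, d i - ∑ i, (J.1 i - K i)) *
                g ^ (∑ i, (J.1 i - K i)) := by rw [← pow_add, Nat.sub_add_cancel (hle _ _)]
            calc _ = (t J : L) * ((∏ i, (J.1 i).choose (K i) : ℕ) : L) *
                  g ^ (∑ i, d i - ∑ i, (J.1 i - K i)) *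
                  (g ^ (∑ i, (J.1 i - K i)) * α ^ ∑ i, (J.1 i - K i)) := by
                  rw [h1]
                  ring
              _ = _ := by
                rw [ha, Finset.mul_sum]
                refine Finset.sum_congr rfl fun l _ => ?_
                simp only [M]
                push_cast
                ring
        _ = ∑ l, ((∑ J, M (⟨K, hKS⟩, l) J * t J : ℤ) : L) * α ^ (l : ℕ) := by
            rw [Finset.sum_comm]
            refine Finset.sum_congr rfl fun l _ => ?_
            rw [← Finset.sum_mul]
            push_cast
            rfl
        _ = 0 := Finset.sum_eq_zero fun l _ => by rw [ht, Int.cast_zero, zero_mul]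
    · obtain ⟨i, hi⟩ : ∃ i, d i < K i := by
        by_contra! h
        exact hKd (mem_box.2 h)
      refine Finset.sum_eq_zero fun J _ => ?_
      rw [Finset.prod_eq_zero (Finset.mem_univ i)
        (Nat.choose_eq_zero_of_lt ((mem_box.1 J.2 i).trans_lt hi))]
      simp

end AuxiliaryPolynomial

section Heights

variable {L : Type*} [Field L]

lemma HeightGE.mono {ξ : L} {η η' : ℝ} (h : HeightGE ξ η) (hη : η' ≤ η) : HeightGE ξ η' :=
  fun V hV t ht => (mul_le_mul_of_nonneg_left hη t.cast_nonneg).trans (h V hV t ht)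

lemma le_rootMultiplicity_of_taylor {ξ : L} {V : L[X]} (hV : V ≠ 0) {t : ℕ}
    (h : ∀ s < t, (taylor ξ V).coeff s = 0) : t ≤ V.rootMultiplicity ξ := by
  rw [le_rootMultiplicity_iff hV]
  obtain ⟨W, hW⟩ := X_pow_dvd_iff.2 h
  have := congrArg (taylor (-ξ)) hW
  rw [taylor_taylor, neg_add_cancel, taylor_zero, taylor_mul] at this
  refine ⟨taylor (-ξ) W, this.trans ?_⟩
  simp [taylor_apply, sub_eq_add_neg]

variable [CharZero L]

lemma exists_isPrimitive_map_eq {ξ : L} (hξ : IsAlgebraic ℚ ξ) : ∃ f : ℤ[X], f.IsPrimitive ∧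
    ∃ c : ℚ, c ≠ 0 ∧ f.map (algebraMap ℤ ℚ) = C c * minpoly ℚ ξ := by
  have h0 := minpoly.ne_zero hξ.isIntegral
  obtain ⟨b, hbM, hb⟩ := IsLocalization.integerNormalization_spec (nonZeroDivisors ℤ)
    (minpoly ℚ ξ)
  set g := IsLocalization.integerNormalization (nonZeroDivisors ℤ) (minpoly ℚ ξ) with hg
  have hb0 : (b : ℚ) ≠ 0 := by exact_mod_cast nonZeroDivisors.ne_zero hbM
  rw [zsmul_eq_mul, ← C_eq_intCast] at hb
  have hg0 : g ≠ 0 := by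
    intro h
    rw [h, Polynomial.map_zero, eq_comm, mul_eq_zero, C_eq_zero] at hb
    tauto
  have hc0 : ((g.content : ℤ) : ℚ) ≠ 0 := by exact_mod_cast mt content_eq_zero_iff.1 hg0
  refine ⟨g.primPart, g.isPrimitive_primPart, (g.content : ℚ)⁻¹ * b, by simp [hc0, hb0], ?_⟩
  have := congrArg (Polynomial.map (algebraMap ℤ ℚ)) g.eq_C_content_mul_primPart
  rw [hb, Polynomial.map_mul, map_C] at this
  rw [C_mul, mul_assoc, this, ← mul_assoc, ← C_mul]
  simp [hc0]

lemma dvd_of_aeval_eq_zero {ξ : L} {f g : ℤ[X]} (hf : f.IsPrimitive) {c : ℚ} (hc : c ≠ 0)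
    (hfc : f.map (algebraMap ℤ ℚ) = C c * minpoly ℚ ξ) (hg : aeval ξ g = 0) : f ∣ g := by
  refine hf.dvd_of_fraction_map_dvd_fraction_map (K := ℚ) ?_
  rw [hfc, (isUnit_C.2 (isUnit_iff_ne_zero.2 hc)).mul_left_dvd]
  exact minpoly.dvd ℚ ξ (by rwa [aeval_map_algebraMap])

lemma pow_dvd_of_le_rootMultiplicity {ξ : L} (hξ : IsAlgebraic ℚ ξ) {f : ℤ[X]}
    (hf : f.IsPrimitive) {c : ℚ} (hc : c ≠ 0)
    (hfc : f.map (algebraMap ℤ ℚ) = C c * minpoly ℚ ξ) (t : ℕ) {V : ℤ[X]} (hV : V ≠ 0)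
    (h : t ≤ (V.map (algebraMap ℤ L)).rootMultiplicity ξ) : f ^ t ∣ V := by
  induction t generalizing V with
  | zero => simp
  | succ t ih =>
    have hinj : Function.Injective (algebraMap ℤ L) := (algebraMap ℤ L).injective_int
    have hroot : aeval ξ V = 0 := by
      rw [aeval_def, ← eval_map]
      exact (rootMultiplicity_pos ((Polynomial.map_ne_zero_iff hinj).2 hV)).1
        (t.succ_pos.trans_le h)
    obtain ⟨W, rfl⟩ := dvd_of_aeval_eq_zero hf hc hfc hroot
    have hW : W ≠ 0 := right_ne_zero_of_mul hV
    rw [pow_succ']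
    refine mul_dvd_mul_left _ (ih hW ?_)
    rw [Polynomial.map_mul, rootMultiplicity_mul (by
      rw [← Polynomial.map_mul]; exact (Polynomial.map_ne_zero_iff hinj).2 hV)] at h
    have hsep : (f.map (algebraMap ℤ L)).Separable := by
      rw [IsScalarTower.algebraMap_eq ℤ ℚ L, ← Polynomial.map_map, separable_map, hfc]
      exact (minpoly.irreducible hξ.isIntegral).separable.unit_mul
        (isUnit_C.2 (isUnit_iff_ne_zero.2 hc))
    have := rootMultiplicity_le_one_of_separable hsep ξ
    omega

lemma plength_eq_sum (f : ℤ[X]) : plength f = f.sum fun _ a => |(a : ℝ)| := rfl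

lemma abs_coeff_le_plength (f : ℤ[X]) (i : ℕ) : |(f.coeff i : ℝ)| ≤ plength f := by
  by_cases h : i ∈ f.support
  · exact Finset.single_le_sum (f := fun i => |(f.coeff i : ℝ)|) (fun _ _ => abs_nonneg _) h
  · rw [notMem_support_iff.1 h]
    rw [Int.cast_zero, abs_zero]
    exact Finset.sum_nonneg fun _ _ => abs_nonneg _

lemma one_le_plength {f : ℤ[X]} (hf : f ≠ 0) : 1 ≤ plength f := by
  refine le_trans ?_ (abs_coeff_le_plength f f.natDegree)
  exact_mod_cast Int.one_le_abs (leadingCoeff_ne_zero.2 hf)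

lemma isometry_intCast_complex : Isometry (Int.castRingHom ℂ) :=
  AddMonoidHomClass.isometry_of_norm _ fun n => by simp [Int.norm_eq_abs]

lemma mapMahlerMeasure_le_plength (f : ℤ[X]) :
    f.mapMahlerMeasure (Int.castRingHom ℂ) ≤ plength f := by
  refine (mapMahlerMeasure_le_sum_norm_coeff f _ isometry_intCast_complex).trans_eq ?_
  simp [plength, sum_def, Int.norm_eq_abs]

lemma one_le_mapMahlerMeasure {f : ℤ[X]} (hf : f ≠ 0) :
    1 ≤ f.mapMahlerMeasure (Int.castRingHom ℂ) := by
  refine le_trans ?_ (leadingCoeff_le_mapMahlerMeasure f _ isometry_intCast_complex)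
  rw [Int.norm_eq_abs]
  exact_mod_cast Int.one_le_abs (leadingCoeff_ne_zero.2 hf)

lemma plength_le_mapMahlerMeasure (f : ℤ[X]) :
    plength f ≤ 2 ^ f.natDegree * f.mapMahlerMeasure (Int.castRingHom ℂ) := by
  rw [plength_eq_sum, sum_over_range _ (by simp)]
  calc _ ≤ ∑ n ∈ Finset.range (f.natDegree + 1),
        (f.natDegree.choose n : ℝ) * f.mapMahlerMeasure (Int.castRingHom ℂ) :=
        Finset.sum_le_sum fun n _ => by
          simpa [Int.norm_eq_abs] using
            norm_coeff_le_choose_mul_mapMahlerMeasure _ isometry_intCast_complex n f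
    _ = _ := by
      rw [← Finset.sum_mul]
      congr 1
      exact_mod_cast Nat.sum_range_choose _

lemma heightGE_of_map_eq {ξ : L} (hξ : IsAlgebraic ℚ ξ) {f : ℤ[X]}
    (hf : f.IsPrimitive) {c : ℚ} (hc : c ≠ 0)
    (hfc : f.map (algebraMap ℤ ℚ) = C c * minpoly ℚ ξ) :
    HeightGE ξ (Real.log (plength f / 2 ^ f.natDegree)) := by
  intro V hV t ht
  have hf0 := hf.ne_zero
  obtain ⟨W, rfl⟩ := pow_dvd_of_le_rootMultiplicity hξ hf hc hfc t hV
    (le_rootMultiplicity_of_taylor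
      ((Polynomial.map_ne_zero_iff (algebraMap ℤ L).injective_int).2 hV) ht)
  have hpos : 0 < plength f / 2 ^ f.natDegree :=
    div_pos (one_pos.trans_le (one_le_plength hf0)) (by positivity)
  rw [← Real.log_pow]
  refine Real.log_le_log (pow_pos hpos _) ?_
  refine le_trans ?_ (mapMahlerMeasure_le_plength _)
  have hM : ∀ n : ℕ, (f ^ n).mapMahlerMeasure (Int.castRingHom ℂ) =
      f.mapMahlerMeasure (Int.castRingHom ℂ) ^ n := by
    intro n
    induction n with
    | zero => simp
    | succ n ih => rw [pow_succ, mapMahlerMeasure_mul, ih, pow_succ]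
  rw [mapMahlerMeasure_mul, hM]
  refine le_trans ?_ (le_mul_of_one_le_right (pow_nonneg (mapMahlerMeasure_nonneg _ _) _)
    (one_le_mapMahlerMeasure (right_ne_zero_of_mul hV)))
  refine pow_le_pow_left₀ hpos.le ?_ _
  rw [div_le_iff₀ (by positivity), mul_comm]
  exact plength_le_mapMahlerMeasure f

end Heights

section Liouville

variable {p : ℕ} [Fact p.Prime]

lemma abs_resultant_le (f h : ℤ[X]) (m n : ℕ) (hf : f ≠ 0) (hh : h ≠ 0) :
    |((f.resultant h m n : ℤ) : ℝ)| ≤ (m + n).factorial * (plength f * plength h) ^ (m + n) := by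
  have h1 := one_le_plength hf
  have h2 := one_le_plength hh
  have := Matrix.det_le (A := (f.sylvester h m n).map (Int.cast : ℤ → ℝ))
    (abv := IsAbsoluteValue.toAbsoluteValue (abs : ℝ → ℝ)) (x := plength f * plength h) ?_
  · rw [Fintype.card_fin, nsmul_eq_mul] at this
    refine le_trans (le_of_eq ?_) this
    have h3 := (Int.castRingHom ℝ).map_det (f.sylvester h m n)
    simp only [eq_intCast] at h3
    rw [resultant, h3]
    rfl
  · intro i j
    have key : |((f.sylvester h m n i j : ℤ) : ℝ)| ≤ plength f * plength h := by
      rw [sylvester, Matrix.of_apply]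
      induction j using Fin.addCases with
      | left j =>
        rw [Fin.addCases_left]
        split_ifs
        · exact (abs_coeff_le_plength _ _).trans (le_mul_of_one_le_left (by linarith) h1)
        · rw [Int.cast_zero, abs_zero]; positivity
      | right j =>
        rw [Fin.addCases_right]
        split_ifs
        · exact (abs_coeff_le_plength _ _).trans (le_mul_of_one_le_right (by linarith) h2)
        · rw [Int.cast_zero, abs_zero]; positivity
    exact key

lemma one_le_abs_mul_norm_intCast {z : ℤ} (hz : z ≠ 0) : 1 ≤ |(z : ℝ)| * ‖(z : ℚ_[p])‖ := by
  have h1 : (p : ℤ) ^ padicValInt p z ∣ z := padicValInt_dvd z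
  have h2 : ‖(z : ℚ_[p])‖ = ((p : ℝ) ^ padicValInt p z)⁻¹ := by
    have : ((z : ℚ) : ℚ_[p]) = z := by norm_cast
    rw [← this, Padic.eq_padicNorm, padicNorm.eq_zpow_of_nonzero (by exact_mod_cast hz),
      padicValRat.of_int]
    simp
  have hp : (0 : ℝ) < p := by exact_mod_cast (Fact.out : p.Prime).pos
  rw [h2, ← div_eq_mul_inv, one_le_div (by positivity)]
  exact_mod_cast Int.le_of_dvd (abs_pos.2 hz) ((dvd_abs _ _).2 h1)

lemma norm_aeval_le_max_pow (α : ℚ_[p]) (f : ℤ[X]) {n : ℕ} (hf : f.natDegree ≤ n) :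
    ‖aeval α f‖ ≤ max 1 ‖α‖ ^ n := by
  rw [aeval_eq_sum_range]
  refine IsUltrametricDist.norm_sum_le_of_forall_le_of_nonneg (by positivity) fun i hi => ?_
  rw [zsmul_eq_mul, norm_mul, norm_pow]
  have : i ≤ n := (Nat.lt_succ_iff.1 (Finset.mem_range.1 hi)).trans hf
  calc _ ≤ 1 * max 1 ‖α‖ ^ i :=
        mul_le_mul (Padic.norm_int_le_one _) (pow_le_pow_left₀ (norm_nonneg _) (le_max_right _ _) _)
          (by positivity) zero_le_one
    _ ≤ _ := by
        rw [one_mul]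
        exact pow_le_pow_right₀ (le_max_left _ _) this

/-- Liouville's inequality for the values of integer polynomials of bounded degree. -/
lemma exists_one_le_mul_norm_aeval {α : ℚ_[p]} (hα : IsAlgebraic ℚ α) (D : ℕ) :
    ∃ (C : ℝ) (e : ℕ), 0 < C ∧ ∀ f : ℤ[X], f.natDegree ≤ D → aeval α f ≠ 0 →
      1 ≤ C * plength f ^ e * ‖aeval α f‖ := by
  obtain ⟨h, hh, c, hc, hhc⟩ := exists_isPrimitive_map_eq hα
  have hirr : Irreducible (h.map (algebraMap ℤ ℚ)) := by
    rw [hhc, irreducible_isUnit_mul (isUnit_C.2 (isUnit_iff_ne_zero.2 hc))]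
    exact minpoly.irreducible hα.isIntegral
  have hhα : aeval α h = 0 := by
    rw [← aeval_map_algebraMap ℚ, hhc, map_mul, minpoly.aeval, mul_zero]
  set n := h.natDegree
  have hn : n ≠ 0 := by
    have := hirr.natDegree_pos
    rw [natDegree_map_eq_of_injective (algebraMap ℤ ℚ).injective_int] at this
    exact this.ne'
  have hP := one_le_plength hh.ne_zero
  refine ⟨(D + n).factorial * plength h ^ (D + n) * max 1 ‖α‖ ^ n, D + n, by positivity,
    fun f hf hfα => ?_⟩
  have hf0 : f ≠ 0 := by rintro rfl; simp at hfα
  have hF := one_le_plength hf0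
  obtain ⟨u, v, hu, -, huv⟩ := exists_mul_add_mul_eq_C_resultant f h le_rfl le_rfl (Or.inr hn)
  have hres : f.resultant h f.natDegree n ≠ 0 := by
    intro h0
    have h1 := resultant_map_map f h f.natDegree n (algebraMap ℤ ℚ)
    rw [h0, map_zero] at h1
    have h2 : resultant (f.map (algebraMap ℤ ℚ)) (h.map (algebraMap ℤ ℚ)) = 0 := by
      rw [natDegree_map_eq_of_injective (algebraMap ℤ ℚ).injective_int,
        natDegree_map_eq_of_injective (algebraMap ℤ ℚ).injective_int]
      exact h1
    refine (resultant_eq_zero_iff.1 h2).2 (IsCoprime.symm ?_)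
    rw [hirr.coprime_iff_not_dvd]
    rintro ⟨w, hw⟩
    apply hfα
    rw [← aeval_map_algebraMap ℚ, hw, map_mul, aeval_map_algebraMap, hhα, zero_mul]
  have hval : aeval α f * aeval α u = ((f.resultant h f.natDegree n : ℤ) : ℚ_[p]) := by
    have := congrArg (aeval α) huv
    rwa [map_add, map_mul, map_mul, hhα, zero_mul, add_zero, aeval_C, eq_intCast] at this
  have hu' : u.natDegree ≤ n := natDegree_le_of_degree_le hu.le
  have hle : f.natDegree + n ≤ D + n := by omega
  calc 1 ≤ |((f.resultant h f.natDegree n : ℤ) : ℝ)| *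
        ‖((f.resultant h f.natDegree n : ℤ) : ℚ_[p])‖ := one_le_abs_mul_norm_intCast hres
    _ ≤ ((D + n).factorial * (plength f * plength h) ^ (D + n)) *
        (‖aeval α f‖ * max 1 ‖α‖ ^ n) := by
      refine mul_le_mul ((abs_resultant_le f h _ n hf0 hh.ne_zero).trans ?_) ?_ (norm_nonneg _)
        (by positivity)
      · refine mul_le_mul (by exact_mod_cast Nat.factorial_le hle)
          (pow_le_pow_right₀ (one_le_mul_of_one_le_of_one_le hF hP) hle) (by positivity)
          (by positivity)
      · rw [← hval, norm_mul]
        exact mul_le_mul_of_nonneg_left (norm_aeval_le_max_pow α u hu') (norm_nonneg _)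
    _ = _ := by
      rw [mul_pow]
      ring

/-- Good quadratic approximations to a number that is not quadratic have large height. -/
lemma exists_heightGE {α : ℚ_[p]} (hα : IsAlgebraic ℚ α) (h2 : (minpoly ℚ α).natDegree ≠ 2) :
    ∃ c C : ℝ, 0 < c ∧ ∀ ξ : ℚ_[p], IsAlgebraic ℚ ξ → (minpoly ℚ ξ).natDegree ≤ 2 → ξ ≠ α →
      ‖ξ - α‖ ≤ 1 → HeightGE ξ (-c * Real.log ‖ξ - α‖ - C) := by
  obtain ⟨C, e, hC, hL⟩ := exists_one_le_mul_norm_aeval hα 2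
  set M : ℝ := max 1 ‖α‖ with hM
  have hM1 : 1 ≤ M := le_max_left _ _
  refine ⟨1 / (e + 1), 1 / (e + 1) * |Real.log (C * M)| + Real.log 4, by positivity,
    fun ξ hξ hdeg hne hdist => ?_⟩
  obtain ⟨f, hf, c, hc, hfc⟩ := exists_isPrimitive_map_eq hξ
  have hfdeg : f.natDegree ≤ 2 := by
    have := natDegree_map_eq_of_injective (algebraMap ℤ ℚ).injective_int f
    rw [hfc, natDegree_C_mul hc] at this
    omega
  have hfξ : aeval ξ f = 0 := by
    rw [← aeval_map_algebraMap ℚ, hfc, map_mul, minpoly.aeval, mul_zero]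
  have hexp : ∀ x : ℚ_[p], aeval x f = f.coeff 0 + f.coeff 1 * x + f.coeff 2 * x ^ 2 := by
    intro x
    rw [aeval_eq_sum_range' (Nat.lt_succ_of_le hfdeg)]
    simp [Finset.sum_range_succ]
  have hfα : aeval α f ≠ 0 := by
    intro h0
    have hdvd : minpoly ℚ α ∣ minpoly ℚ ξ := by
      refine minpoly.dvd ℚ α ?_
      have := aeval_map_algebraMap ℚ α f
      rw [h0, hfc, map_mul, aeval_C, mul_eq_zero] at this
      exact this.resolve_left (by simpa using hc)
    have heq : minpoly ℚ α = minpoly ℚ ξ := 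
      eq_of_monic_of_associated (minpoly.monic hα.isIntegral) (minpoly.monic hξ.isIntegral)
        ((minpoly.irreducible hα.isIntegral).associated_of_dvd
          (minpoly.irreducible hξ.isIntegral) hdvd)
    have hd1 : (minpoly ℚ α).natDegree = 1 := by
      have := minpoly.natDegree_pos hα.isIntegral
      rw [← heq] at hdeg
      omega
    have hroot : ∀ x : ℚ_[p], aeval x (minpoly ℚ α) = 0 →
        x = -(((minpoly ℚ α).coeff 0 : ℚ) : ℚ_[p]) := by
      intro x hx
      rw [(minpoly.monic hα.isIntegral).eq_X_add_C hd1] at hx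
      simp only [map_add, aeval_X, aeval_C, eq_ratCast] at hx
      exact eq_neg_of_add_eq_zero_left hx
    exact hne ((hroot ξ (by rw [heq, minpoly.aeval])).trans (hroot α (minpoly.aeval _ _)).symm)
  have hnorm : ‖aeval α f‖ ≤ M * ‖ξ - α‖ := by
    have : aeval α f = (f.coeff 1 + f.coeff 2 * ((ξ - α) + 2 * α)) * (-(ξ - α)) := by
      rw [← sub_zero (aeval α f), ← hfξ, hexp, hexp]
      ring
    rw [this, norm_mul, norm_neg]
    refine mul_le_mul_of_nonneg_right ?_ (norm_nonneg _)
    refine (Padic.nonarchimedean _ _).trans (max_le ((Padic.norm_int_le_one _).trans hM1) ?_)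
    rw [norm_mul]
    have : ‖ξ - α + 2 * α‖ ≤ M := by
      refine (Padic.nonarchimedean _ _).trans (max_le (hdist.trans hM1) ?_)
      rw [norm_mul]
      have h2' : ‖(2 : ℚ_[p])‖ ≤ 1 := by exact_mod_cast Padic.norm_int_le_one (p := p) 2
      exact (mul_le_of_le_one_left (norm_nonneg _) h2').trans (le_max_right _ _)
    exact (mul_le_of_le_one_left (norm_nonneg _) (Padic.norm_int_le_one _)).trans this
  have hP := one_le_plength hf.ne_zero
  have hd0 : 0 < ‖ξ - α‖ := norm_pos_iff.2 (sub_ne_zero.2 hne)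
  refine (heightGE_of_map_eq hξ hf hc hfc).mono ?_
  rw [Real.log_div (by positivity) (by positivity)]
  have h4 : Real.log (2 ^ f.natDegree) ≤ Real.log 4 := by
    refine Real.log_le_log (by positivity) ?_
    calc (2 : ℝ) ^ f.natDegree ≤ 2 ^ 2 := pow_le_pow_right₀ one_le_two hfdeg
      _ = 4 := by norm_num
  have hmain : 1 ≤ (C * M) * plength f ^ (e + 1) * ‖ξ - α‖ := by
    refine (hL f hfdeg hfα).trans ?_
    calc C * plength f ^ e * ‖aeval α f‖ ≤ C * plength f ^ (e + 1) * (M * ‖ξ - α‖) := by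
          gcongr
          exact e.le_succ
      _ = _ := by ring
  have hlog := Real.log_le_log one_pos hmain
  rw [Real.log_one, Real.log_mul (by positivity) hd0.ne', Real.log_mul (by positivity)
    (by positivity), Real.log_pow] at hlog
  push_cast at hlog
  have habs := le_abs_self (Real.log (C * M))
  have he : (0 : ℝ) < e + 1 := by positivity
  have : 1 / ((e : ℝ) + 1) * (-Real.log ‖ξ - α‖ - |Real.log (C * M)|) ≤ Real.log (plength f) := by
    rw [one_div, inv_mul_le_iff₀ he]
    linarith
  linarith

end Liouville

section QuadraticIntegers

variable {p : ℕ} [Fact p.Prime]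

/-- `SizeLE s t ω z h` says that `z = u + v * ω` with integers `u`, `v` whose weighted absolute
values are at most `h`; it is meant for `ω` with `ω ^ 2 = s * ω + t`. -/
def SizeLE (s t : ℤ) (ω z : ℚ_[p]) (h : ℝ) : Prop :=
  ∃ u v : ℤ, z = u + v * ω ∧ (1 + |(s : ℝ)| + |(t : ℝ)|) * (|(u : ℝ)| + |(v : ℝ)|) ≤ h

variable {s t : ℤ} {ω : ℚ_[p]}

lemma SizeLE.mono {z : ℚ_[p]} {h h' : ℝ} (hz : SizeLE s t ω z h) (hh : h ≤ h') :
    SizeLE s t ω z h' := by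
  obtain ⟨u, v, h1, h2⟩ := hz
  exact ⟨u, v, h1, h2.trans hh⟩

lemma SizeLE.nonneg {z : ℚ_[p]} {h : ℝ} (hz : SizeLE s t ω z h) : 0 ≤ h := by
  obtain ⟨u, v, h1, h2⟩ := hz
  exact le_trans (by positivity) h2

lemma sizeLE_zero : SizeLE s t ω 0 0 := ⟨0, 0, by simp, by simp⟩

lemma sizeLE_one : SizeLE s t ω 1 (1 + |(s : ℝ)| + |(t : ℝ)|) := ⟨1, 0, by simp, by simp⟩

lemma SizeLE.add {z z' : ℚ_[p]} {h h' : ℝ} (hz : SizeLE s t ω z h) (hz' : SizeLE s t ω z' h') :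
    SizeLE s t ω (z + z') (h + h') := by
  obtain ⟨u, v, rfl, h2⟩ := hz
  obtain ⟨u', v', rfl, h2'⟩ := hz'
  refine ⟨u + u', v + v', by push_cast; ring, le_trans ?_ (add_le_add h2 h2')⟩
  rw [← mul_add]
  push_cast
  refine mul_le_mul_of_nonneg_left ?_ (by positivity)
  linarith [abs_add_le (u : ℝ) u', abs_add_le (v : ℝ) v']

lemma SizeLE.mul (hω : ω ^ 2 = s * ω + t) {z z' : ℚ_[p]} {h h' : ℝ} (hz : SizeLE s t ω z h)
    (hz' : SizeLE s t ω z' h') : SizeLE s t ω (z * z') (h * h') := by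
  have hh := hz.nonneg
  obtain ⟨u, v, rfl, h2⟩ := hz
  obtain ⟨u', v', rfl, h2'⟩ := hz'
  refine ⟨u * u' + v * v' * t, u * v' + v * u' + v * v' * s, ?_,
    le_trans ?_ (mul_le_mul h2 h2' (by positivity) hh)⟩
  · push_cast
    linear_combination (v * v' : ℚ_[p]) * hω
  · push_cast
    have h3 : |(u * u' + v * v' * t : ℝ)| ≤ |(u : ℝ)| * |(u' : ℝ)| +
        |(v : ℝ)| * |(v' : ℝ)| * |(t : ℝ)| := by
      simpa [abs_mul] using abs_add_le (u * u' : ℝ) (v * v' * t)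
    have h4 : |(u * v' + v * u' + v * v' * s : ℝ)| ≤ |(u : ℝ)| * |(v' : ℝ)| +
        |(v : ℝ)| * |(u' : ℝ)| + |(v : ℝ)| * |(v' : ℝ)| * |(s : ℝ)| := by
      simpa [abs_mul] using abs_add_three (u * v' : ℝ) (v * u') (v * v' * s)
    set K := 1 + |(s : ℝ)| + |(t : ℝ)|
    have hK : 0 ≤ K := by positivity
    have h5 : |(u * u' + v * v' * t : ℝ)| + |(u * v' + v * u' + v * v' * s : ℝ)| ≤
        K * ((|(u : ℝ)| + |(v : ℝ)|) * (|(u' : ℝ)| + |(v' : ℝ)|)) := by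
      have e1 := mul_nonneg (abs_nonneg (u : ℝ)) (abs_nonneg (u' : ℝ))
      have e2 := mul_nonneg (abs_nonneg (u : ℝ)) (abs_nonneg (v' : ℝ))
      have e3 := mul_nonneg (abs_nonneg (v : ℝ)) (abs_nonneg (u' : ℝ))
      have hst : 0 ≤ |(s : ℝ)| + |(t : ℝ)| := by positivity
      refine (add_le_add h3 h4).trans ?_
      simp only [K]
      have e4 := mul_nonneg (abs_nonneg (v : ℝ)) (abs_nonneg (v' : ℝ))
      linarith [mul_nonneg hst e1, mul_nonneg hst e2, mul_nonneg hst e3]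
    calc _ ≤ K * (K * ((|(u : ℝ)| + |(v : ℝ)|) * (|(u' : ℝ)| + |(v' : ℝ)|))) :=
          mul_le_mul_of_nonneg_left h5 hK
      _ = _ := by ring

lemma SizeLE.intCast_mul {z : ℚ_[p]} {h : ℝ} (hz : SizeLE s t ω z h) (n : ℤ) :
    SizeLE s t ω (n * z) (|(n : ℝ)| * h) := by
  obtain ⟨u, v, rfl, h2⟩ := hz
  refine ⟨n * u, n * v, by push_cast; ring, ?_⟩
  push_cast
  rw [abs_mul, abs_mul, ← mul_add, mul_left_comm]
  exact mul_le_mul_of_nonneg_left h2 (abs_nonneg _)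

lemma SizeLE.pow (hω : ω ^ 2 = s * ω + t) {z : ℚ_[p]} {h : ℝ} (hz : SizeLE s t ω z h) (n : ℕ) :
    SizeLE s t ω (z ^ n) ((1 + |(s : ℝ)| + |(t : ℝ)|) * h ^ n) := by
  induction n with
  | zero => simpa using sizeLE_one
  | succ n ih =>
    rw [pow_succ, pow_succ, ← mul_assoc]
    exact ih.mul hω hz

lemma SizeLE.prod (hω : ω ^ 2 = s * ω + t) {ι : Type*} (S : Finset ι) {z : ι → ℚ_[p]} {h : ι → ℝ}
    (hz : ∀ i ∈ S, SizeLE s t ω (z i) (h i)) :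
    SizeLE s t ω (∏ i ∈ S, z i) ((1 + |(s : ℝ)| + |(t : ℝ)|) * ∏ i ∈ S, h i) := by
  classical
  induction S using Finset.induction_on with
  | empty => simpa using sizeLE_one
  | insert a S ha ih =>
    rw [Finset.prod_insert ha, Finset.prod_insert ha, mul_left_comm]
    exact (hz a (Finset.mem_insert_self a S)).mul hω
      (ih fun i hi => hz i (Finset.mem_insert_of_mem hi))

lemma SizeLE.sum {ι : Type*} (S : Finset ι) {z : ι → ℚ_[p]} {h : ι → ℝ}
    (hz : ∀ i ∈ S, SizeLE s t ω (z i) (h i)) :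
    SizeLE s t ω (∑ i ∈ S, z i) (∑ i ∈ S, h i) := by
  classical
  induction S using Finset.induction_on with
  | empty => simpa using sizeLE_zero
  | insert a S ha ih =>
    rw [Finset.sum_insert ha, Finset.sum_insert ha]
    exact (hz a (Finset.mem_insert_self a S)).add
      (ih fun i hi => hz i (Finset.mem_insert_of_mem hi))

lemma norm_le_one_of_sq_eq (hω : ω ^ 2 = s * ω + t) : ‖ω‖ ≤ 1 := by
  by_contra! h
  have h1 : ‖ω‖ ^ 2 ≤ max (‖ω‖) 1 := by
    rw [← norm_pow, hω]
    refine (Padic.nonarchimedean _ _).trans (max_le_max ?_ (Padic.norm_int_le_one _))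
    rw [norm_mul]
    exact mul_le_of_le_one_left (norm_nonneg _) (Padic.norm_int_le_one _)
  rw [max_eq_left h.le] at h1
  nlinarith

lemma norm_intCast_add_intCast_mul_le_one (hω : ω ^ 2 = s * ω + t) (u v : ℤ) :
    ‖(u : ℚ_[p]) + v * ω‖ ≤ 1 := by
  refine (Padic.nonarchimedean _ _).trans (max_le (Padic.norm_int_le_one _) ?_)
  rw [norm_mul]
  exact mul_le_one₀ (Padic.norm_int_le_one _) (norm_nonneg _) (norm_le_one_of_sq_eq hω)

lemma SizeLE.norm_le_one (hω : ω ^ 2 = s * ω + t) {z : ℚ_[p]} {h : ℝ}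
    (hz : SizeLE s t ω z h) : ‖z‖ ≤ 1 := by
  obtain ⟨u, v, rfl, -⟩ := hz
  exact norm_intCast_add_intCast_mul_le_one hω u v

lemma SizeLE.one_le_mul_norm (hω : ω ^ 2 = s * ω + t) {z : ℚ_[p]} {h : ℝ}
    (hz : SizeLE s t ω z h) (hz0 : z ≠ 0) : 1 ≤ 2 * h ^ 2 * ‖z‖ := by
  obtain ⟨u, v, rfl, h2⟩ := hz
  set K := 1 + |(s : ℝ)| + |(t : ℝ)| with hK
  have hs := abs_nonneg (s : ℝ)
  have ht := abs_nonneg (t : ℝ)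
  have hu := abs_nonneg (u : ℝ)
  have hv := abs_nonneg (v : ℝ)
  have hK1 : 1 ≤ K := by linarith
  have huv1 : 1 ≤ |(u : ℝ)| + |(v : ℝ)| := by
    by_cases hu0 : u = 0
    · have hv0 : v ≠ 0 := by
        rintro rfl
        simp [hu0] at hz0
      have : (1 : ℝ) ≤ |(v : ℝ)| := by exact_mod_cast Int.one_le_abs hv0
      linarith
    · have : (1 : ℝ) ≤ |(u : ℝ)| := by exact_mod_cast Int.one_le_abs hu0
      linarith
  have hh1 : 1 ≤ h := (one_le_mul_of_one_le_of_one_le hK1 huv1).trans h2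
  have hsq : K * (|(u : ℝ)| + |(v : ℝ)|) ^ 2 ≤ h ^ 2 := by
    calc _ ≤ (K * (|(u : ℝ)| + |(v : ℝ)|)) ^ 2 := by
          rw [mul_pow]
          exact mul_le_mul_of_nonneg_right (le_self_pow₀ hK1 two_ne_zero) (by positivity)
      _ ≤ h ^ 2 := by gcongr
  by_cases hN : u ^ 2 + s * u * v - t * v ^ 2 = 0
  · have hN' : ((u : ℚ_[p]) + v * ω) * (u + v * s - v * ω) = 0 := by
      have : ((u ^ 2 + s * u * v - t * v ^ 2 : ℤ) : ℚ_[p]) = 0 := by rw [hN, Int.cast_zero]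
      push_cast at this
      linear_combination this - (v : ℚ_[p]) ^ 2 * hω
    have hconj := (mul_eq_zero.1 hN').resolve_left hz0
    have hz : (u : ℚ_[p]) + v * ω = ((2 * u + v * s : ℤ) : ℚ_[p]) := by
      push_cast
      linear_combination -hconj
    rw [hz] at hz0 ⊢
    refine (one_le_abs_mul_norm_intCast (p := p) (by exact_mod_cast hz0)).trans
      (mul_le_mul_of_nonneg_right ?_ (norm_nonneg _))
    push_cast
    calc |(2 * u + v * s : ℝ)| ≤ 2 * |(u : ℝ)| + |(v : ℝ)| * |(s : ℝ)| := by
          simpa [abs_mul] using abs_add_le (2 * u : ℝ) (v * s)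
      _ ≤ 2 * (K * (|(u : ℝ)| + |(v : ℝ)|)) := by
          rw [hK]
          nlinarith [mul_nonneg hu hs, mul_nonneg hu ht, mul_nonneg hv hs, mul_nonneg hv ht]
      _ ≤ 2 * h ^ 2 := by nlinarith
  · refine (one_le_abs_mul_norm_intCast (p := p) hN).trans ?_
    have hnorm : ‖((u ^ 2 + s * u * v - t * v ^ 2 : ℤ) : ℚ_[p])‖ ≤ ‖(u : ℚ_[p]) + v * ω‖ := by
      have : ((u ^ 2 + s * u * v - t * v ^ 2 : ℤ) : ℚ_[p]) =
          ((u : ℚ_[p]) + v * ω) * (((u + v * s : ℤ) : ℚ_[p]) + ((-v : ℤ) : ℚ_[p]) * ω) := by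
        push_cast
        linear_combination (v : ℚ_[p]) ^ 2 * hω
      rw [this, norm_mul]
      exact mul_le_of_le_one_right (norm_nonneg _) (norm_intCast_add_intCast_mul_le_one hω _ _)
    refine mul_le_mul ?_ hnorm (norm_nonneg _) (by positivity)
    push_cast
    calc |(u ^ 2 + s * u * v - t * v ^ 2 : ℝ)| ≤
          |(u : ℝ)| ^ 2 + |(s : ℝ)| * |(u : ℝ)| * |(v : ℝ)| + |(t : ℝ)| * |(v : ℝ)| ^ 2 := by
          rw [← abs_pow, ← abs_pow, ← abs_mul, ← abs_mul, ← abs_mul, ← abs_neg ((t : ℝ) * _),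
            sub_eq_add_neg]
          exact abs_add_three _ _ _
      _ ≤ K * (|(u : ℝ)| + |(v : ℝ)|) ^ 2 := by
          rw [hK]
          have := mul_nonneg hu hv
          nlinarith [mul_nonneg hs this, mul_nonneg ht this, mul_nonneg hs (sq_nonneg |(u : ℝ)|),
            mul_nonneg hs (sq_nonneg |(v : ℝ)|), mul_nonneg ht (sq_nonneg |(u : ℝ)|)]
      _ ≤ h ^ 2 := hsq
      _ ≤ 2 * h ^ 2 := by nlinarith [sq_nonneg h]

end QuadraticIntegers

section RothCore

variable {p : ℕ} [Fact p.Prime] {m : ℕ}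

lemma norm_mvPolynomial_aeval_le (α : ℚ_[p]) {d : Fin m → ℕ} {P : MvPolynomial (Fin m) ℤ}
    (hP : ∀ i, P.degreeOf i ≤ d i) :
    ‖MvPolynomial.aeval (fun _ => α) P‖ ≤ max 1 ‖α‖ ^ ∑ i, d i := by
  rw [MvPolynomial.aeval_def, MvPolynomial.eval₂_eq']
  refine IsUltrametricDist.norm_sum_le_of_forall_le_of_nonneg (by positivity) fun I hI => ?_
  rw [norm_mul, Finset.prod_pow_eq_pow_sum, norm_pow, eq_intCast]
  calc _ ≤ 1 * max 1 ‖α‖ ^ ∑ i, I i :=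
        mul_le_mul (Padic.norm_int_le_one _) (pow_le_pow_left₀ (norm_nonneg _) (le_max_right _ _) _)
          (by positivity) zero_le_one
    _ ≤ _ := by
        rw [one_mul]
        exact pow_le_pow_right₀ (le_max_left _ _)
          (Finset.sum_le_sum fun i _ => (MvPolynomial.degreeOf_le_iff.1 (hP i) I hI))

lemma IndexGE.norm_aeval_le {α : ℚ_[p]} {d : Fin m → ℕ} {θ : ℝ} {P : MvPolynomial (Fin m) ℤ}
    (h : IndexGE d (fun _ => α) θ P) (hP : ∀ i, P.degreeOf i ≤ d i) (hd : ∀ i, 0 < d i)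
    {ξ : Fin m → ℚ_[p]} {δ : Fin m → ℝ} {D : ℝ} (hD : 0 ≤ D) (hδ : ∀ i, D ≤ d i * δ i)
    (hξ : ∀ i, ‖ξ i - α‖ ≤ Real.exp (-δ i)) :
    ‖MvPolynomial.aeval ξ P‖ ≤ max 1 ‖α‖ ^ (∑ i, d i) * Real.exp (-(D * θ)) := by
  rw [← aeval_sub_shift (fun _ => α) ξ P, MvPolynomial.aeval_def, MvPolynomial.eval₂_eq']
  refine IsUltrametricDist.norm_sum_le_of_forall_le_of_nonneg (by positivity) fun J hJ => ?_
  have hJθ : θ ≤ weight d J := by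
    by_contra! hlt
    exact MvPolynomial.mem_support_iff.1 hJ (h J hlt)
  rw [norm_mul]
  refine mul_le_mul ?_ ?_ (norm_nonneg _) (by positivity)
  · rw [Algebra.algebraMap_self, RingHom.id_apply, ← aeval_hasse]
    exact norm_mvPolynomial_aeval_le α fun i => (degreeOf_hasse_le J P i).trans (hP i)
  · rw [norm_prod]
    calc ∏ i, ‖(ξ i - α) ^ J i‖ ≤ ∏ i, Real.exp (-(D * (J i / d i))) := by
          refine Finset.prod_le_prod (fun _ _ => norm_nonneg _) fun i _ => ?_
          rw [norm_pow]
          refine (pow_le_pow_left₀ (norm_nonneg _) (hξ i) _).trans ?_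
          rw [← Real.exp_nat_mul, Real.exp_le_exp, mul_neg, neg_le_neg_iff]
          have hdi : (0 : ℝ) < d i := by exact_mod_cast hd i
          calc D * (J i / d i) ≤ d i * δ i * (J i / d i) :=
                mul_le_mul_of_nonneg_right (hδ i) (by positivity)
            _ = J i * δ i := by field_simp
      _ = Real.exp (-(D * weight d J)) := by
          rw [← Real.exp_sum, weight, Finset.mul_sum, Finset.sum_neg_distrib]
      _ ≤ _ := by
          rw [Real.exp_le_exp, neg_le_neg_iff]
          exact mul_le_mul_of_nonneg_left hJθ hD

lemma SizeLE.mvPolynomial_aeval {s t : ℤ} {ω : ℚ_[p]} (hω : ω ^ 2 = s * ω + t)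
    {d : Fin m → ℕ} {P : MvPolynomial (Fin m) ℤ} (hP : ∀ i, P.degreeOf i ≤ d i)
    {x y ξ : Fin m → ℚ_[p]} {h : Fin m → ℝ} (hxy : ∀ i, x i = ξ i * y i)
    (hx : ∀ i, SizeLE s t ω (x i) (h i)) (hy : ∀ i, SizeLE s t ω (y i) (h i)) :
    SizeLE s t ω ((∏ i, y i ^ d i) * MvPolynomial.aeval ξ P)
      (length P * ((1 + |(s : ℝ)| + |(t : ℝ)|) *
        ∏ i, (1 + |(s : ℝ)| + |(t : ℝ)|) ^ 2 * h i ^ d i)) := by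
  rw [MvPolynomial.aeval_def, MvPolynomial.eval₂_eq', Finset.mul_sum, length, Finset.sum_mul]
  refine SizeLE.sum _ fun I hI => ?_
  have hId : ∀ i, I i ≤ d i := fun i => MvPolynomial.degreeOf_le_iff.1 (hP i) I hI
  have hterm : (∏ i, y i ^ d i) * ((algebraMap ℤ ℚ_[p]) (MvPolynomial.coeff I P) * ∏ i, ξ i ^ I i) =
      (MvPolynomial.coeff I P : ℤ) * ∏ i, (x i ^ I i * y i ^ (d i - I i)) := by
    rw [mul_left_comm, ← Finset.prod_mul_distrib, eq_intCast]
    congr 1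
    refine Finset.prod_congr rfl fun i _ => ?_
    rw [hxy, mul_pow, mul_assoc, ← pow_add, Nat.add_sub_cancel' (hId i), mul_comm]
  rw [hterm]
  refine (SizeLE.prod hω _ fun i _ => ?_).intCast_mul _
  refine (((hx i).pow hω (I i)).mul hω ((hy i).pow hω (d i - I i))).mono (le_of_eq ?_)
  rw [mul_mul_mul_comm, ← pow_add, Nat.add_sub_cancel' (hId i), sq]

end RothCore

section RothTheorem

variable {p : ℕ} [Fact p.Prime]

lemma exists_lacunary_seq {S : ℝ → ℝ} (hS : ∀ N, N ≤ S N) {R N₀ : ℝ} (hR : 1 ≤ R) (hN₀ : 0 < N₀) :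
    ∃ N : ℕ → ℝ, (∀ k, N₀ ≤ S (N k)) ∧ (∀ i j, i ≤ j → S (N i) ≤ S (N j)) ∧
      ∀ i j, i < j → R * S (N i) ≤ S (N j) := by
  set N : ℕ → ℝ := fun k => k.rec N₀ fun _ x => R * S x with hN
  have hstep : ∀ k, R * S (N k) ≤ S (N (k + 1)) := fun k => hS _
  have hpos : ∀ k, N₀ ≤ S (N k) := by
    intro k
    induction k with
    | zero => exact hS _
    | succ k ih =>
      refine ih.trans (le_trans ?_ (hstep k))
      exact le_mul_of_one_le_left (hN₀.le.trans ih) hR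
  have hmono : Monotone fun k => S (N k) := monotone_nat_of_le_succ fun k =>
    (le_mul_of_one_le_left (hN₀.le.trans (hpos k)) hR).trans (hstep k)
  exact ⟨N, hpos, fun i j hij => hmono hij, fun i j hij => (hstep i).trans (hmono hij)⟩

/-- A `p`-adic Roth theorem for approximations by quotients of elements of `ℤ[ω]`, where `ω` is a
quadratic integer. -/
theorem not_exists_good_approximations {α : ℚ_[p]} (hα : IsAlgebraic ℚ α) {s t : ℤ} {ω : ℚ_[p]}
    (hω : ω ^ 2 = s * ω + t) {κ c : ℝ} (hκ : 0 < κ) (hc : 0 < c)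
    (H : ∀ N : ℝ, ∃ h, N ≤ h ∧ ∃ x y ξ : ℚ_[p], y ≠ 0 ∧ x = ξ * y ∧
      SizeLE s t ω x (Real.exp h) ∧ SizeLE s t ω y (Real.exp h) ∧
      ‖ξ - α‖ ≤ Real.exp (-((4 + κ) * h)) ∧ HeightGE ξ (c * h)) : False := by
  choose h hN x y ξ hy hxy hxs hys hξ hht using H
  obtain ⟨C, hC, haux⟩ := exists_auxiliary_polynomial hα
  set K : ℝ := 1 + |(s : ℝ)| + |(t : ℝ)| with hK
  have hK1 : 1 ≤ K := by
    rw [hK, add_assoc]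
    exact le_add_of_nonneg_right (by positivity)
  set M : ℝ := max 1 ‖α‖ with hM
  have hM1 : 1 ≤ M := le_max_left _ _
  set G : ℝ := 2 * (2 * C * K ^ 3) ^ 2 * M with hG
  have hCK : 1 ≤ C * K ^ 3 := one_le_mul_of_one_le_of_one_le hC (one_le_pow₀ hK1)
  have hG1 : 1 ≤ G := by
    have : 1 ≤ (2 * C * K ^ 3) ^ 2 := one_le_pow₀ (by linarith)
    exact one_le_mul_of_one_le_of_one_le (by linarith) hM1
  have hlogG : 0 ≤ Real.log G := Real.log_nonneg hG1
  have hlogC : 0 ≤ Real.log C := Real.log_nonneg hC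
  set ε : ℝ := κ / (16 * (4 + κ)) with hε
  have hε0 : 0 < ε := by positivity
  have hεκ : (4 + κ) * ε = κ / 16 := by rw [hε]; field_simp
  obtain ⟨m₀, hm₀⟩ := haux ε hε0
  set m := m₀ + 1 with hm
  obtain ⟨ω₀, hω₀, hroth⟩ := exists_coeff_shift_ne_zero ℚ_[p] m ε hε0
  set N₀ : ℝ := 1 + 16 * Real.log G / κ + 2 * (m * Real.log C + 1) / (ω₀ * c) with hN₀
  have hN₀1 : 0 < N₀ := by positivity
  have hN₀G : 16 * Real.log G ≤ κ * N₀ := by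
    have : 16 * Real.log G / κ ≤ N₀ := by
      rw [hN₀]
      linarith [show 0 ≤ 2 * (m * Real.log C + 1) / (ω₀ * c) by positivity]
    rwa [div_le_iff₀ hκ, mul_comm N₀] at this
  have hN₀C : 2 * (m * Real.log C + 1) ≤ ω₀ * c * N₀ := by
    have : 2 * (m * Real.log C + 1) / (ω₀ * c) ≤ N₀ := by
      rw [hN₀]
      linarith [show 0 ≤ 16 * Real.log G / κ by positivity]
    rwa [div_le_iff₀ (by positivity), mul_comm N₀] at this
  obtain ⟨N, hNpos, hNmono, hNlac⟩ :=
    exists_lacunary_seq hN (R := max 1 (2 / ω₀)) (le_max_left _ _) hN₀1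
  set g : Fin m → ℝ := fun i => h (N (i.rev : ℕ)) with hg
  have hgN : ∀ i, N₀ ≤ g i := fun i => hNpos _
  have hg0 : ∀ i, 0 < g i := fun i => hN₀1.trans_le (hgN i)
  set D : ℝ := (1 + 16 / κ) * h (N m) with hD
  have hhm : 0 < h (N m) := hN₀1.trans_le (hNpos _)
  have hD0 : 0 < D := by positivity
  have hgm : ∀ i, g i ≤ h (N m) := fun i => hNmono _ _ i.rev.is_lt.le
  have hgD : ∀ i, g i ≤ D := fun i => (hgm i).trans (by
    rw [hD]
    exact le_mul_of_one_le_left hhm.le (le_add_of_nonneg_right (by positivity)))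
  have hgκ : ∀ i, g i ≤ κ / 16 * D := fun i => (hgm i).trans (by
    rw [hD, ← mul_assoc]
    refine le_mul_of_one_le_left hhm.le ?_
    rw [mul_add, div_mul_div_cancel₀ (by norm_num), div_self hκ.ne']
    exact le_add_of_nonneg_left (by positivity))
  set d : Fin m → ℕ := fun i => ⌈D / g i⌉₊ with hd
  have hd0 : ∀ i, 0 < d i := fun i => Nat.ceil_pos.2 (div_pos hD0 (hg0 i))
  have hDd : ∀ i, D ≤ d i * g i := fun i => (div_le_iff₀ (hg0 i)).1 (Nat.le_ceil _)
  have hdg : ∀ i, (d i : ℝ) * g i ≤ D + g i := by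
    intro i
    have h1 : (d i : ℝ) ≤ D / g i + 1 := (Nat.ceil_lt_add_one (div_pos hD0 (hg0 i)).le).le
    calc (d i : ℝ) * g i ≤ (D / g i + 1) * g i := mul_le_mul_of_nonneg_right h1 (hg0 i).le
      _ = D + g i := by
        have := (hg0 i).ne'
        field_simp
  have hdN : ∀ i, (d i : ℝ) ≤ 2 * D / N₀ := by
    intro i
    rw [le_div_iff₀ hN₀1]
    calc (d i : ℝ) * N₀ ≤ d i * g i := mul_le_mul_of_nonneg_left (hgN i) (Nat.cast_nonneg _)
      _ ≤ 2 * D := by linarith [hdg i, hgD i]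
  have hlac : ∀ i j, i < j → (d i : ℝ) ≤ ω₀ * d j := by
    intro i j hij
    have h1 : 2 / ω₀ * g j ≤ g i :=
      (mul_le_mul_of_nonneg_right (le_max_right _ _) (hg0 j).le).trans
        (hNlac _ _ (Fin.rev_lt_rev.2 hij))
    have h2 : 2 * g j ≤ ω₀ * g i := by
      rw [div_mul_eq_mul_div, div_le_iff₀ hω₀] at h1
      linarith
    refine le_of_mul_le_mul_right ?_ (mul_pos (hg0 i) (hg0 j))
    calc (d i : ℝ) * (g i * g j) = d i * g i * g j := by ring
      _ ≤ 2 * D * g j := mul_le_mul_of_nonneg_right (by linarith [hdg i, hgD i]) (hg0 j).le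
      _ = 2 * g j * D := by ring
      _ ≤ ω₀ * g i * (d j * g j) := mul_le_mul h2 (hDd j) hD0.le
          (mul_pos hω₀ (hg0 i)).le
      _ = _ := by ring
  obtain ⟨P, hP0, hPd, hPl, hPi⟩ := hm₀ m (by omega) d hd0
  set S := ∑ i, d i with hS
  have hSle : (S : ℝ) ≤ m * (2 * D / N₀) := by
    rw [hS]
    push_cast
    refine (Finset.sum_le_sum fun i _ => hdN i).trans ?_
    simp
  obtain ⟨J, hJ, hJ0⟩ := hroth d (fun i => ξ (N (i.rev : ℕ))) (fun i => c * g i) P (2 * D / N₀) hP0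
    hPd hd0 hdN hlac (fun i => hht _) (by
      intro i
      have hlP : Real.log (length P) ≤ S * Real.log C := by
        rw [← Real.log_pow]
        exact Real.log_le_log (one_pos.trans_le (one_le_length hP0)) hPl
      calc _ ≤ m * (2 * D / N₀) * Real.log C + 2 * D / N₀ :=
            add_le_add (hlP.trans (mul_le_mul_of_nonneg_right hSle hlogC)) le_rfl
        _ = 2 * (m * Real.log C + 1) / N₀ * D := by ring
        _ ≤ ω₀ * c * D := by
            refine mul_le_mul_of_nonneg_right ?_ hD0.le
            rwa [div_le_iff₀ hN₀1]
        _ ≤ ω₀ * c * (d i * g i) := mul_le_mul_of_nonneg_left (hDd i) (by positivity)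
        _ = _ := by ring)
  set Q := hasse J P with hQ
  have hQd : ∀ i, Q.degreeOf i ≤ d i := fun i => (degreeOf_hasse_le J P i).trans (hPd i)
  have hQi : IndexGE d (fun _ => α) (m * (1 / 2 - ε) - ε) Q :=
    (hPi.hasse J).mono (by linarith)
  have hQl : length Q ≤ (2 * C) ^ S := by
    rw [mul_pow]
    exact (length_hasse_le hPd J).trans (mul_le_mul_of_nonneg_left hPl (by positivity))
  set z := (∏ i, y (N (i.rev : ℕ)) ^ d i) *
    MvPolynomial.aeval (fun i : Fin m => ξ (N (i.rev : ℕ))) Q with hz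
  have hz0 : z ≠ 0 := by
    refine mul_ne_zero (Finset.prod_ne_zero_iff.2 fun i _ => pow_ne_zero _ (hy _)) ?_
    rwa [aeval_hasse]
  have hzs := SizeLE.mvPolynomial_aeval hω hQd
    (fun i : Fin m => hxy (N (i.rev : ℕ))) (fun i => hxs _) (fun i => hys _)
  have hSm : m ≤ S := by
    calc m = ∑ i : Fin m, 1 := by simp
      _ ≤ S := Finset.sum_le_sum fun i _ => hd0 i
  have hzs' : SizeLE s t ω z ((2 * C * K ^ 3) ^ S * Real.exp (∑ i, d i * g i)) := by
    refine hzs.mono ?_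
    rw [Finset.prod_mul_distrib, Finset.prod_const, Finset.card_univ, Fintype.card_fin, ← pow_mul,
      mul_pow, mul_assoc ((2 * C) ^ S)]
    refine mul_le_mul hQl ?_ (by positivity) (by positivity)
    rw [← mul_assoc, ← pow_succ', Real.exp_sum]
    refine mul_le_mul ?_ (le_of_eq ?_) (by positivity) (by positivity)
    · rw [← pow_mul]
      exact pow_le_pow_right₀ hK1 (by omega)
    · exact Finset.prod_congr rfl fun i _ => (Real.exp_nat_mul _ _).symm
  have hzn : ‖z‖ ≤ M ^ S * Real.exp (-((4 + κ) * D * (m * (1 / 2 - ε) - ε))) := by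
    rw [hz, norm_mul]
    refine (mul_le_of_le_one_left (norm_nonneg _) ?_).trans
      (hQi.norm_aeval_le hQd hd0 (δ := fun i => (4 + κ) * g i) (by positivity) (fun i => ?_)
        fun i => hξ _)
    · rw [norm_prod]
      refine Finset.prod_le_one (fun _ _ => norm_nonneg _) fun i _ => ?_
      rw [norm_pow]
      exact pow_le_one₀ (norm_nonneg _) ((hys _).norm_le_one hω)
    · calc (4 + κ) * D ≤ (4 + κ) * (d i * g i) := mul_le_mul_of_nonneg_left (hDd i) (by positivity)
        _ = _ := by ring
  have hfin : 1 ≤ G ^ S * Real.exp (2 * ∑ i, d i * g i - (4 + κ) * D * (m * (1 / 2 - ε) - ε)) := by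
    refine (hzs'.one_le_mul_norm hω hz0).trans ?_
    have h2 : (2 : ℝ) ≤ 2 ^ S := le_self_pow₀ one_le_two (by omega)
    calc _ ≤ 2 ^ S * ((2 * C * K ^ 3) ^ S * Real.exp (∑ i, d i * g i)) ^ 2 *
          (M ^ S * Real.exp (-((4 + κ) * D * (m * (1 / 2 - ε) - ε)))) :=
          mul_le_mul (mul_le_mul_of_nonneg_right h2 (sq_nonneg _)) hzn (norm_nonneg _)
            (by positivity)
      _ = _ := by
          have e (u v : ℝ) : Real.exp (2 * u - v) = Real.exp u ^ 2 * Real.exp (-v) := by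
            rw [← Real.exp_nat_mul, ← Real.exp_add]
            congr 1
          rw [e, hG]
          generalize 2 * C * K ^ 3 = Y
          ring
  have hlog := Real.log_le_log one_pos hfin
  rw [Real.log_one, Real.log_mul (by positivity) (Real.exp_pos _).ne', Real.log_exp,
    Real.log_pow] at hlog
  have h1 : (S : ℝ) * Real.log G ≤ m * D * (κ / 8) := by
    calc (S : ℝ) * Real.log G ≤ m * (2 * D / N₀) * Real.log G :=
          mul_le_mul_of_nonneg_right hSle hlogG
      _ = m * D * (16 * Real.log G / N₀ / 8) := by ring
      _ ≤ m * D * (κ / 8) := by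
          refine mul_le_mul_of_nonneg_left ?_ (by positivity)
          have : 16 * Real.log G / N₀ ≤ κ := by rwa [div_le_iff₀ hN₀1]
          linarith
  have h2 : ∑ i, (d i : ℝ) * g i ≤ m * (D + κ / 16 * D) := by
    refine (Finset.sum_le_sum fun i _ => (hdg i).trans (add_le_add le_rfl (hgκ i))).trans ?_
    simp [mul_add]
  have hm1 : (1 : ℝ) ≤ m := by exact_mod_cast (by omega : 1 ≤ m)
  have h3 : (4 + κ) * D * (m * (1 / 2 - ε) - ε) =
      D * (m * ((4 + κ) / 2) - m * ((4 + κ) * ε) - (4 + κ) * ε) := by ring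
  rw [h3, hεκ] at hlog
  have h4 : D * κ ≤ m * D * κ :=
    (le_mul_of_one_le_left (by positivity) hm1).trans_eq (mul_assoc _ _ _).symm
  have h5 : 0 < (m : ℝ) * D * κ := by positivity
  linarith

end RothTheorem

section Ruban

variable {p : ℕ} [Fact p.Prime]

lemma rubanR_succ_add (a : ℕ → ℚ) (n m : ℕ) :
    rubanR a (n + 1 + m) = rubanR a (n + 1) * rubanR (fun i => a (n + 1 + i)) m +
      rubanR a n * rubanQ (fun i => a (n + 1 + i)) m := by
  induction m using Nat.twoStepInduction with
  | zero => simp [rubanR, rubanQ]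
  | one => simp only [rubanR, rubanQ, add_zero]; ring
  | more m ih1 ih2 =>
    rw [show n + 1 + (m + 2) = (n + 1 + m) + 2 by ring, rubanR, rubanR, rubanQ, ih1,
      show n + 1 + m + 1 = n + 1 + (m + 1) by ring, ih2]
    ring

lemma rubanQ_succ_add (a : ℕ → ℚ) (n m : ℕ) :
    rubanQ a (n + 1 + m) = rubanQ a (n + 1) * rubanR (fun i => a (n + 1 + i)) m +
      rubanQ a n * rubanQ (fun i => a (n + 1 + i)) m := by
  induction m using Nat.twoStepInduction with
  | zero => simp [rubanR, rubanQ]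
  | one => simp only [rubanR, rubanQ, add_zero]; ring
  | more m ih1 ih2 =>
    rw [show n + 1 + (m + 2) = (n + 1 + m) + 2 by ring, rubanQ, rubanR, rubanQ, ih1,
      show n + 1 + m + 1 = n + 1 + (m + 1) by ring, ih2]
    ring

lemma rubanR_mul_rubanQ_sub (a : ℕ → ℚ) (n : ℕ) :
    rubanR a (n + 1) * rubanQ a n - rubanR a n * rubanQ a (n + 1) = (-1) ^ (n + 1) := by
  induction n with
  | zero => simp [rubanR, rubanQ]
  | succ n ih =>
    rw [rubanR, rubanQ, pow_succ, ← ih]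
    ring

lemma rubanR_congr {a b : ℕ → ℚ} {n : ℕ} (h : ∀ i < n, a i = b i) :
    rubanR a n = rubanR b n := by
  induction n using Nat.twoStepInduction with
  | zero => rfl
  | one => exact h 0 one_pos
  | more n ih1 ih2 =>
    rw [rubanR, rubanR, ih1 fun i hi => h i (by omega), ih2 fun i hi => h i (by omega),
      h (n + 1) (by omega)]

lemma rubanQ_congr {a b : ℕ → ℚ} {n : ℕ} (h : ∀ i < n, a i = b i) :
    rubanQ a n = rubanQ b n := by
  induction n using Nat.twoStepInduction with
  | zero => rfl
  | one => rfl
  | more n ih1 ih2 =>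
    rw [rubanQ, rubanQ, ih1 fun i hi => h i (by omega), ih2 fun i hi => h i (by omega),
      h (n + 1) (by omega)]

lemma norm_of_mem_Sp' {b : ℚ} (hb : b ∈ Sp' p) : (p : ℝ) ≤ ‖(b : ℚ_[p])‖ := by
  rw [Padic.eq_padicNorm]
  exact_mod_cast hb.2

lemma one_lt_cast : (1 : ℝ) < p := by exact_mod_cast (Fact.out : p.Prime).one_lt

/-- Norms of consecutive denominators grow by a factor of at least `p`. -/
lemma mul_norm_rubanQ_le {a : ℕ → ℚ} (ha : ∀ i, a (i + 1) ∈ Sp' p) (n : ℕ) :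
    p * ‖(rubanQ a n : ℚ_[p])‖ ≤ ‖(rubanQ a (n + 1) : ℚ_[p])‖ ∧
      0 < ‖(rubanQ a (n + 1) : ℚ_[p])‖ := by
  induction n with
  | zero => simp [rubanQ]
  | succ n ih =>
    have hp := one_lt_cast (p := p)
    have h1 := norm_of_mem_Sp' (ha n)
    have h2 : p * ‖(rubanQ a (n + 1) : ℚ_[p])‖ ≤ ‖((a (n + 1) * rubanQ a (n + 1) : ℚ) : ℚ_[p])‖ := by
      rw [Rat.cast_mul, norm_mul]
      exact mul_le_mul_of_nonneg_right h1 (norm_nonneg _)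
    have h3 : ‖(rubanQ a n : ℚ_[p])‖ < ‖((a (n + 1) * rubanQ a (n + 1) : ℚ) : ℚ_[p])‖ := by
      refine lt_of_lt_of_le ?_ h2
      nlinarith [ih.1, ih.2, norm_nonneg (rubanQ a n : ℚ_[p])]
    have h4 : ‖(rubanQ a (n + 2) : ℚ_[p])‖ = ‖((a (n + 1) * rubanQ a (n + 1) : ℚ) : ℚ_[p])‖ := by
      rw [rubanQ, Rat.cast_add, Padic.add_eq_max_of_ne h3.ne', max_eq_left h3.le]
    rw [h4]
    exact ⟨h2, (norm_nonneg _).trans_lt h3⟩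

lemma pow_le_norm_rubanQ {a : ℕ → ℚ} (ha : ∀ i, a (i + 1) ∈ Sp' p) (n : ℕ) :
    (p : ℝ) ^ n ≤ ‖(rubanQ a (n + 1) : ℚ_[p])‖ := by
  induction n with
  | zero => simp [rubanQ]
  | succ n ih =>
    rw [pow_succ']
    exact (mul_le_mul_of_nonneg_left ih (Nat.cast_nonneg _)).trans (mul_norm_rubanQ_le ha _).1

lemma rubanQ_ne_zero {a : ℕ → ℚ} (ha : ∀ i, a (i + 1) ∈ Sp' p) (n : ℕ) :
    rubanQ a (n + 1) ≠ 0 := fun h => by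
  have := (mul_norm_rubanQ_le ha n).2
  simp [h] at this

lemma norm_convergent_sub_le {a : ℕ → ℚ} (ha : ∀ i, a (i + 1) ∈ Sp' p) (n : ℕ) :
    ‖((rubanR a (n + 2) / rubanQ a (n + 2) : ℚ) : ℚ_[p]) -
      ((rubanR a (n + 1) / rubanQ a (n + 1) : ℚ) : ℚ_[p])‖ ≤ (p : ℝ)⁻¹ * ((p : ℝ)⁻¹ ^ 2) ^ n := by
  have h : rubanR a (n + 2) / rubanQ a (n + 2) - rubanR a (n + 1) / rubanQ a (n + 1) =
      (-1) ^ (n + 2) * (rubanQ a (n + 2) * rubanQ a (n + 1))⁻¹ := by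
    have := rubanQ_ne_zero ha n
    have := rubanQ_ne_zero ha (n + 1)
    rw [← rubanR_mul_rubanQ_sub a (n + 1)]
    field_simp
  rw [← Rat.cast_sub, h]
  have hp := zero_lt_one.trans (one_lt_cast (p := p))
  calc _ = (‖(rubanQ a (n + 2) : ℚ_[p])‖ * ‖(rubanQ a (n + 1) : ℚ_[p])‖)⁻¹ := by simp
    _ ≤ ((p : ℝ) ^ (n + 1) * (p : ℝ) ^ n)⁻¹ := inv_anti₀ (by positivity)
      (mul_le_mul (pow_le_norm_rubanQ ha _) (pow_le_norm_rubanQ ha _) (by positivity)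
        (norm_nonneg _))
    _ = _ := by
      rw [← pow_mul, inv_pow, ← mul_inv]
      ring_nf

lemma geometric_ratio_lt_one : (p : ℝ)⁻¹ ^ 2 < 1 :=
  pow_lt_one₀ (by positivity) (inv_lt_one_of_one_lt₀ one_lt_cast) two_ne_zero

lemma exists_isRubanValue {a : ℕ → ℚ} (ha : ∀ i, a (i + 1) ∈ Sp' p) :
    ∃ x : ℚ_[p], IsRubanValue p a x :=
  cauchySeq_tendsto_of_complete <| cauchySeq_of_le_geometric _ _ geometric_ratio_lt_one fun n => by
    rw [dist_comm, dist_eq_norm]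
    exact norm_convergent_sub_le ha n

lemma exists_norm_sub_le_of_agree : ∃ C : ℝ, 0 < C ∧ ∀ (a b : ℕ → ℚ) (x z : ℚ_[p]) (M : ℕ),
    (∀ i, a (i + 1) ∈ Sp' p) → (∀ i, b (i + 1) ∈ Sp' p) → IsRubanValue p a x →
      IsRubanValue p b z → (∀ i ≤ M, a i = b i) → ‖x - z‖ ≤ C * ((p : ℝ)⁻¹ ^ 2) ^ M := by
  have hp := zero_lt_one.trans (one_lt_cast (p := p))
  set r : ℝ := (p : ℝ)⁻¹ ^ 2 with hr
  have hr1 : 0 < 1 - r := sub_pos.2 geometric_ratio_lt_one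
  have hr0 : 0 < r := by positivity
  have key : ∀ (a : ℕ → ℚ) (x : ℚ_[p]) (n : ℕ), (∀ i, a (i + 1) ∈ Sp' p) → IsRubanValue p a x →
      ‖((rubanR a (n + 1) / rubanQ a (n + 1) : ℚ) : ℚ_[p]) - x‖ ≤ (p : ℝ)⁻¹ * r ^ n / (1 - r) := by
    intro a x n ha hx
    rw [← dist_eq_norm]
    refine dist_le_of_le_geometric_of_tendsto _ _ geometric_ratio_lt_one (fun n => ?_) hx n
    rw [dist_comm, dist_eq_norm]
    exact norm_convergent_sub_le ha n
  refine ⟨2 * (p : ℝ)⁻¹ / (1 - r), by positivity, fun a b x z M ha hb hx hz hab => ?_⟩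
  have h1 := key a x M ha hx
  have h2 := key b z M hb hz
  rw [← rubanR_congr fun i hi => hab i (Nat.lt_succ_iff.1 hi),
    ← rubanQ_congr fun i hi => hab i (Nat.lt_succ_iff.1 hi)] at h2
  rw [norm_sub_rev] at h1
  calc ‖x - z‖ ≤ _ := norm_sub_le_norm_sub_add_norm_sub _ _ _
    _ ≤ _ := add_le_add h1 h2
    _ = _ := by ring

/-- The complete quotient relation: the value of a continued fraction is the Möbius transform,
given by its convergents, of the value of its tail. -/
lemma _root_.IsRubanValue.mul_tail_eq {a : ℕ → ℚ} (ha : ∀ i, a (i + 1) ∈ Sp' p) {n : ℕ} {x y : ℚ_[p]}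
    (hx : IsRubanValue p a x) (hy : IsRubanValue p (fun i => a (n + 1 + i)) y) :
    x * (rubanQ a (n + 1) * y + rubanQ a n) = rubanR a (n + 1) * y + rubanR a n := by
  have hx' := hx.comp (tendsto_add_atTop_nat (n + 1))
  have h1 := hx'.mul ((hy.const_mul (rubanQ a (n + 1) : ℚ_[p])).add_const (rubanQ a n : ℚ_[p]))
  have h2 := (hy.const_mul (rubanR a (n + 1) : ℚ_[p])).add_const (rubanR a n : ℚ_[p])
  refine tendsto_nhds_unique (h1.congr fun m => ?_) h2
  have hb : ∀ i, a (n + 1 + (i + 1)) ∈ Sp' p := fun i => ha (n + 1 + i)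
  have hq1 := rubanQ_ne_zero ha (n + 1 + m)
  have hq2 := rubanQ_ne_zero (a := fun i => a (n + 1 + i)) hb m
  have e1 := rubanR_succ_add a n (m + 1)
  have e2 := rubanQ_succ_add a n (m + 1)
  simp only [Function.comp_apply]
  norm_cast
  rw [show m + (n + 1) + 1 = n + 1 + (m + 1) by ring]
  rw [show n + 1 + m + 1 = n + 1 + (m + 1) by ring] at hq1
  rw [e2] at hq1
  rw [e1, e2, div_mul_eq_mul_div, div_eq_iff hq1]
  field_simp

lemma _root_.IsRubanValue.norm_sub_lt_one {a : ℕ → ℚ} (ha : ∀ i, a (i + 1) ∈ Sp' p) {x : ℚ_[p]}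
    (hx : IsRubanValue p a x) : ‖x - a 0‖ < 1 := by
  have hp := one_lt_cast (p := p)
  have hr : (p : ℝ)⁻¹ ^ 2 ≤ 1 := geometric_ratio_lt_one.le
  refine lt_of_le_of_lt ?_ (inv_lt_one_of_one_lt₀ hp)
  refine le_of_tendsto (hx.sub_const (a 0 : ℚ_[p])).norm (Eventually.of_forall fun n => ?_)
  induction n with
  | zero => simp [rubanR, rubanQ]
  | succ n ih =>
    rw [← sub_add_sub_cancel _ ((rubanR a (n + 1) / rubanQ a (n + 1) : ℚ) : ℚ_[p])]
    exact (Padic.nonarchimedean _ _).trans (max_le ((norm_convergent_sub_le ha n).trans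
      (mul_le_of_le_one_right (by positivity) (pow_le_one₀ (by positivity) hr))) ih)

lemma eq_of_mem_Sp_of_norm_sub_lt_one {a b : ℚ} (ha : a ∈ Sp p) (hb : b ∈ Sp p)
    (h : ‖(a - b : ℚ_[p])‖ < 1) : a = b := by
  obtain ⟨⟨k, u, hu⟩, ha0, hap⟩ := ha
  obtain ⟨⟨l, v, hv⟩, hb0, hbp⟩ := hb
  have hp := (Fact.out : p.Prime).pos
  have hpQ : (0 : ℚ) < p := by exact_mod_cast hp
  set z : ℤ := u * p ^ l - v * p ^ k with hz
  have e : (z : ℚ) = (a - b) * p ^ (k + l) := by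
    rw [hz]
    push_cast
    rw [hu, hv]
    ring
  have hdvd : (p : ℤ) ^ (k + l + 1) ∣ z := by
    have e' : (z : ℚ_[p]) = (a - b) * p ^ (k + l) := by exact_mod_cast congrArg (Rat.cast) e
    rw [← Padic.norm_int_le_pow_iff_dvd, Padic.norm_le_pow_iff_norm_lt_pow_add_one, e', norm_mul,
      norm_pow, Padic.norm_p]
    push_cast
    rw [neg_add, neg_add_cancel_right, zpow_neg, inv_pow, ← Nat.cast_add, zpow_natCast]
    exact mul_lt_of_lt_one_left (by positivity) h
  have hz0 : z = 0 := by
    refine Int.eq_zero_of_abs_lt_dvd hdvd ?_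
    have : |(z : ℚ)| < p ^ (k + l + 1) := by
      rw [e, abs_mul, abs_of_pos (by positivity : (0 : ℚ) < p ^ (k + l)), pow_succ']
      exact mul_lt_mul_of_pos_right (abs_sub_lt_of_nonneg_of_lt ha0 hap hb0 hbp) (by positivity)
    exact_mod_cast this
  rw [hz0, Int.cast_zero] at e
  exact sub_eq_zero.1 ((mul_eq_zero.1 e.symm).resolve_right (by positivity))

lemma _root_.IsRubanValue.head_eq {a b : ℕ → ℚ} (ha0 : a 0 ∈ Sp p) (ha : ∀ i, a (i + 1) ∈ Sp' p)
    (hb0 : b 0 ∈ Sp p) (hb : ∀ i, b (i + 1) ∈ Sp' p) {x : ℚ_[p]} (hx : IsRubanValue p a x)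
    (hx' : IsRubanValue p b x) : a 0 = b 0 := by
  refine eq_of_mem_Sp_of_norm_sub_lt_one ha0 hb0 ?_
  rw [← sub_add_sub_cancel _ x]
  refine (Padic.nonarchimedean _ _).trans_lt (max_lt ?_ (hx'.norm_sub_lt_one hb))
  rw [norm_sub_rev]
  exact hx.norm_sub_lt_one ha

/-- A Ruban continued fraction is determined by its value. -/
lemma _root_.IsRubanValue.eq {a b : ℕ → ℚ} (ha0 : a 0 ∈ Sp p) (ha : ∀ i, a (i + 1) ∈ Sp' p)
    (hb0 : b 0 ∈ Sp p) (hb : ∀ i, b (i + 1) ∈ Sp' p) {x : ℚ_[p]} (hx : IsRubanValue p a x)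
    (hx' : IsRubanValue p b x) : a = b := by
  funext i
  induction i generalizing a b x with
  | zero => exact hx.head_eq ha0 ha hb0 hb hx'
  | succ i ih =>
    obtain ⟨y, hy⟩ := exists_isRubanValue (a := fun i => a (0 + 1 + i)) fun i => ha (0 + 1 + i)
    obtain ⟨y', hy'⟩ := exists_isRubanValue (a := fun i => b (0 + 1 + i)) fun i => hb (0 + 1 + i)
    have e := hx.mul_tail_eq ha hy
    have e' := hx'.mul_tail_eq hb hy'
    simp only [rubanR, rubanQ, Rat.cast_one, Rat.cast_zero, one_mul, add_zero] at e e'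
    have hyy : y = y' := by
      have h1 : (x - a 0) * y = 1 := by rw [sub_mul, e]; ring
      have h2 : (x - a 0) * y' = 1 := by rw [sub_mul, e', hx.head_eq ha0 ha hb0 hb hx']; ring
      have : x - a 0 ≠ 0 := fun h => by simp [h] at h1
      exact mul_left_cancel₀ this (h1.trans h2.symm)
    subst hyy
    have := ih (ha 0).1 (fun i => ha (0 + 1 + i)) (hb 0).1 (fun i => hb (0 + 1 + i)) hy hy'
    simpa [add_comm 1] using this

end Ruban

section RubanBounds

variable {p : ℕ} [Fact p.Prime]

lemma exists_nat_eq_mul_pow {b : ℚ} (hb : b ∈ Sp p) {s : ℕ}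
    (h : ‖(b : ℚ_[p])‖ < (p : ℝ) ^ (s + 1)) : ∃ u < p * p ^ s, b * (p ^ s : ℕ) = (u : ℕ) := by
  obtain ⟨⟨k, z, hz⟩, hb0, hbp⟩ := hb
  have hp := (Fact.out : p.Prime).pos
  have hpQ : (0 : ℚ) < p := by exact_mod_cast hp
  have hpR : (0 : ℝ) < p := by exact_mod_cast hp
  have h' : ‖(b : ℚ_[p])‖ ≤ (p : ℝ) ^ s := by
    have := (Padic.norm_le_pow_iff_norm_lt_pow_add_one (b : ℚ_[p]) s).2 (by exact_mod_cast h)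
    exact_mod_cast this
  have hdvd : (p : ℤ) ^ k ∣ p ^ s * z := by
    have e : ((p ^ s * z : ℤ) : ℚ_[p]) = p ^ s * (b * p ^ k) := by
      exact_mod_cast congrArg (fun x : ℚ => (p ^ s : ℚ) * x) hz
    rw [← Padic.norm_int_le_pow_iff_dvd, e, norm_mul, norm_mul, norm_pow, norm_pow, Padic.norm_p,
      ← mul_assoc, zpow_neg, zpow_natCast, inv_pow, inv_pow]
    refine mul_le_of_le_one_left (by positivity) ?_
    rw [inv_mul_le_iff₀ (by positivity), mul_one]
    exact h'
  obtain ⟨w, hw⟩ := hdvd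
  have hbw : b * (p ^ s : ℕ) = w := by
    have hw' : (p ^ s * (b * p ^ k) : ℚ) = p ^ k * w := by
      rw [← hz]
      exact_mod_cast hw
    have : (p : ℚ) ^ k ≠ 0 := by positivity
    push_cast
    refine mul_left_cancel₀ this ?_
    rw [← hw']
    ring
  have hw0 : 0 ≤ w := by
    have : (0 : ℚ) ≤ w := hbw ▸ by positivity
    exact_mod_cast this
  lift w to ℕ using hw0
  refine ⟨w, ?_, by exact_mod_cast hbw⟩
  have : ((w : ℕ) : ℚ) < (p * p ^ s : ℕ) := by
    rw [← Int.cast_natCast w, ← hbw, Nat.cast_mul]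
    exact mul_lt_mul_of_pos_right hbp (by positivity)
  exact_mod_cast this

/-- Linear recurrences driven by `b / B` with `0 ≤ b < p * B` have denominators dividing `B ^ n`
and grow at most like `B ^ n`. -/
lemma exists_nat_eq_mul_pow_of_rec {q B : ℕ} (hB : q ≤ B) {a u : ℕ → ℚ} {b : ℕ → ℕ}
    (hb : ∀ i, b i < q * B) (hab : ∀ i, a i * B = b i)
    (hu : ∀ n, u (n + 2) = a (n + 1) * u (n + 1) + u n) (h0 : ∃ z ≤ 1, u 0 = (z : ℕ))
    (h1 : ∃ z ≤ B ^ 2, u 1 * B = (z : ℕ)) (n : ℕ) :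
    ∃ z ≤ B ^ (2 * n), u n * B ^ n = (z : ℕ) := by
  induction n using Nat.twoStepInduction with
  | zero => simpa using h0
  | one => simpa using h1
  | more n ih1 ih2 =>
    obtain ⟨z₁, hz₁, e₁⟩ := ih1
    obtain ⟨z₂, hz₂, e₂⟩ := ih2
    refine ⟨b (n + 1) * z₂ + B ^ 2 * z₁, ?_, ?_⟩
    · calc b (n + 1) * z₂ + B ^ 2 * z₁ ≤ b (n + 1) * B ^ (2 * (n + 1)) + B ^ 2 * B ^ (2 * n) := by
            gcongr
        _ = (b (n + 1) + 1) * B ^ (2 * (n + 1)) := by ring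
        _ ≤ B * B * B ^ (2 * (n + 1)) :=
            Nat.mul_le_mul_right _ ((hb (n + 1)).trans_le (Nat.mul_le_mul_right _ hB))
        _ = _ := by ring
    · push_cast
      rw [hu, ← e₁, ← e₂, ← hab]
      ring

lemma exists_nat_eq_rubanQ_mul_pow {q B : ℕ} (hB : q ≤ B) {a : ℕ → ℚ} {b : ℕ → ℕ}
    (hb : ∀ i, b i < q * B) (hab : ∀ i, a i * B = b i) (n : ℕ) :
    ∃ z ≤ B ^ (2 * n), rubanQ a n * B ^ n = (z : ℕ) :=
  exists_nat_eq_mul_pow_of_rec hB hb hab (fun _ => rfl) ⟨0, by simp, by simp [rubanQ]⟩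
    ⟨B, Nat.le_self_pow two_ne_zero _, by simp [rubanQ]⟩ n

lemma exists_nat_eq_rubanR_mul_pow {q B : ℕ} (hB : q ≤ B) {a : ℕ → ℚ} {b : ℕ → ℕ}
    (hb : ∀ i, b i < q * B) (hab : ∀ i, a i * B = b i) (n : ℕ) :
    ∃ z ≤ B ^ (2 * n), rubanR a n * B ^ n = (z : ℕ) :=
  exists_nat_eq_mul_pow_of_rec hB hb hab (fun _ => rfl) ⟨1, le_rfl, by simp [rubanR]⟩
    ⟨b 0, (hb 0).le.trans (by rw [sq]; exact Nat.mul_le_mul_right _ hB), hab 0⟩ n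

lemma sizeLE_of_rec {B : ℕ} (hB0 : 0 < B) {u : ℕ → ℚ}
    (hu : ∀ n, ∃ z ≤ B ^ (2 * n), u n * B ^ n = (z : ℕ)) {s t e : ℤ} {β : ℚ_[p]} (he : 0 < e)
    (n : ℕ) : SizeLE s t ((e : ℚ_[p]) * β)
      ((e : ℚ_[p]) * (B : ℚ_[p]) ^ (n + 1) * ((u (n + 1) : ℚ_[p]) * β + (u n : ℚ_[p])))
      ((1 + |(s : ℝ)| + |(t : ℝ)|) * (2 * e) * (B : ℝ) ^ (2 * (n + 1))) := by
  obtain ⟨z, hz, ez⟩ := hu (n + 1)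
  obtain ⟨z', hz', ez'⟩ := hu n
  have c : (u (n + 1) : ℚ_[p]) * B ^ (n + 1) = z := by exact_mod_cast congrArg Rat.cast ez
  have c' : (u n : ℚ_[p]) * B ^ n = z' := by exact_mod_cast congrArg Rat.cast ez'
  refine ⟨e * B * z', z, ?_, ?_⟩
  · push_cast
    rw [← c, ← c']
    ring
  · rw [mul_assoc (1 + _ + _)]
    refine mul_le_mul_of_nonneg_left ?_ (by positivity)
    have he1 : (1 : ℝ) ≤ e := by exact_mod_cast he
    have hB1 : (1 : ℝ) ≤ B := by exact_mod_cast hB0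
    have hz1 : (z : ℝ) ≤ B ^ (2 * (n + 1)) := by exact_mod_cast hz
    have hz1' : (z' : ℝ) ≤ B ^ (2 * n) := by exact_mod_cast hz'
    push_cast
    rw [abs_of_nonneg (by positivity), abs_of_nonneg (by positivity), mul_assoc (2 : ℝ), two_mul]
    refine add_le_add ?_ (hz1.trans (le_mul_of_one_le_left (by positivity) he1))
    rw [mul_assoc]
    refine mul_le_mul_of_nonneg_left ?_ (by positivity)
    calc (B : ℝ) * z' ≤ B * B * B ^ (2 * n) :=
          mul_le_mul (le_mul_of_one_le_left (by positivity) hB1) hz1' (by positivity)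
            (by positivity)
      _ = _ := by ring

/-- The value of a purely periodic Ruban continued fraction is a root of a quadratic polynomial. -/
lemma _root_.IsRubanValue.exists_quadratic {q B : ℕ} (hB0 : 0 < B) (hB : q ≤ B) {w : ℕ → ℚ}
    {b : ℕ → ℕ} (hb : ∀ i, b i < q * B) (hab : ∀ i, w i * B = b i) (hw : ∀ i, w i ∈ Sp' p) {k : ℕ}
    (hk : 1 ≤ k) (hper : ∀ i, w (k + i) = w i) {β : ℚ_[p]} (hβ : IsRubanValue p w β) :
    ∃ e f g : ℤ, 0 < e ∧ (e : ℚ_[p]) * β ^ 2 = f * β + g := by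
  obtain ⟨l, rfl⟩ := Nat.exists_eq_add_of_le' hk
  have hβ' : IsRubanValue p (fun i => w (l + 1 + i)) β := by simpa only [hper] using hβ
  have h := hβ.mul_tail_eq (fun i => hw (i + 1)) hβ'
  obtain ⟨z₁, -, e₁⟩ := exists_nat_eq_rubanQ_mul_pow hB hb hab (l + 1)
  obtain ⟨z₂, -, e₂⟩ := exists_nat_eq_rubanQ_mul_pow hB hb hab l
  obtain ⟨z₃, -, e₃⟩ := exists_nat_eq_rubanR_mul_pow hB hb hab (l + 1)
  obtain ⟨z₄, -, e₄⟩ := exists_nat_eq_rubanR_mul_pow hB hb hab l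
  have hz₁ : z₁ ≠ 0 := by
    rintro rfl
    have := rubanQ_ne_zero (fun i => hw (i + 1)) l
    rw [Nat.cast_zero, mul_eq_zero] at e₁
    exact e₁.elim this (by positivity)
  refine ⟨z₁, z₃ - B * z₂, B * z₄, by omega, ?_⟩
  have c₁ : (rubanQ w (l + 1) : ℚ_[p]) * B ^ (l + 1) = z₁ := by exact_mod_cast congrArg Rat.cast e₁
  have c₂ : (rubanQ w l : ℚ_[p]) * B ^ l = z₂ := by exact_mod_cast congrArg Rat.cast e₂
  have c₃ : (rubanR w (l + 1) : ℚ_[p]) * B ^ (l + 1) = z₃ := by exact_mod_cast congrArg Rat.cast e₃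
  have c₄ : (rubanR w l : ℚ_[p]) * B ^ l = z₄ := by exact_mod_cast congrArg Rat.cast e₄
  push_cast
  rw [← c₁, ← c₂, ← c₃, ← c₄]
  linear_combination (B : ℚ_[p]) ^ (l + 1) * h

lemma natDegree_minpoly_le_of_mem_adjoin {K L : Type*} [Field K] [Field L] [Algebra K L] {x y : L}
    (hx : IsIntegral K x) (hy : y ∈ IntermediateField.adjoin K {x}) :
    IsIntegral K y ∧ (minpoly K y).natDegree ≤ (minpoly K x).natDegree := by
  have := IntermediateField.adjoin.finiteDimensional hx
  rw [← IntermediateField.adjoin.finrank hx]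
  lift y to IntermediateField.adjoin K {x} using hy
  refine ⟨(Algebra.IsIntegral.isIntegral y).map (IntermediateField.val _), ?_⟩
  rw [← IntermediateField.minpoly_eq]
  exact minpoly.natDegree_le y

lemma natDegree_minpoly_le_two_of_mobius {K L : Type*} [Field K] [Field L] [Algebra K L]
    {e f g u v u' v' : K} {β ξ : L} (he : e ≠ 0)
    (hβ : algebraMap K L e * β ^ 2 = algebraMap K L f * β + algebraMap K L g)
    (h0 : algebraMap K L u * β + algebraMap K L v ≠ 0)
    (hξ : ξ * (algebraMap K L u * β + algebraMap K L v) =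
      algebraMap K L u' * β + algebraMap K L v') :
    IsIntegral K ξ ∧ (minpoly K ξ).natDegree ≤ 2 := by
  set P : K[X] := C e * X ^ 2 + C (-f) * X + C (-g) with hP
  have hP0 : P ≠ 0 := fun h => by
    have := leadingCoeff_quadratic (b := -f) (c := -g) he
    rw [← hP, h, leadingCoeff_zero] at this
    exact he this.symm
  have hPβ : aeval β P = 0 := by
    simp [hP, hβ]
  have hβi : IsIntegral K β := (show IsAlgebraic K β from ⟨P, hP0, hPβ⟩).isIntegral
  have hdeg : (minpoly K β).natDegree ≤ 2 :=
    (natDegree_le_of_dvd (minpoly.dvd K β hPβ) hP0).trans natDegree_quadratic_le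
  have hmem : ξ ∈ IntermediateField.adjoin K {β} := by
    rw [eq_div_of_mul_eq h0 hξ]
    have hβm := IntermediateField.mem_adjoin_simple_self K β
    exact div_mem (add_mem (mul_mem (algebraMap_mem _ _) hβm) (algebraMap_mem _ _))
      (add_mem (mul_mem (algebraMap_mem _ _) hβm) (algebraMap_mem _ _))
  obtain ⟨h1, h2⟩ := natDegree_minpoly_le_of_mem_adjoin hβi hmem
  exact ⟨h1, h2.trans hdeg⟩

end RubanBounds

section RubanApproximation

variable {p : ℕ} [Fact p.Prime]

lemma eq_add_mod_of_block {a : ℕ → ℚ} {n l k : ℕ} (hk : 1 ≤ k)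
    (h : ∀ m, n ≤ m → m + 1 ≤ n + (l - 1) * k → a (m + k) = a m) (j : ℕ) (hj : j < l * k) :
    a (n + j) = a (n + j % k) := by
  induction j using Nat.strong_induction_on with
  | _ j ih =>
    rcases lt_or_ge j k with hjk | hjk
    · rw [Nat.mod_eq_of_lt hjk]
    · obtain ⟨i, rfl⟩ := Nat.exists_eq_add_of_le' hjk
      have hi : i + 1 ≤ (l - 1) * k := by
        rw [Nat.sub_one_mul]
        omega
      rw [Nat.add_mod_right, ← ih i (by omega) (by omega), ← add_assoc]
      exact h _ (by omega) (by omega)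

/-- Replacing the tail of a Ruban continued fraction of value `α` by a purely periodic one of value
`β` gives an element of `ℚ(β)` close to `α`, of controlled height. -/
lemma exists_approximant {a w : ℕ → ℚ} (ha0 : a 0 ∈ Sp p) (ha : ∀ i, a (i + 1) ∈ Sp' p)
    (hw : ∀ i, w i ∈ Sp' p) {α β : ℚ_[p]} (hα : IsRubanValue p a α) (hβ : IsRubanValue p w β)
    {B : ℕ} (hB0 : 0 < B) (hB : p ≤ B) {b : ℕ → ℕ} (hb : ∀ i, b i < p * B)
    (hab : ∀ i, a i * B = b i) {e f g : ℤ} (he : 0 < e) (hefg : (e : ℚ_[p]) * β ^ 2 = f * β + g)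
    {C : ℝ} (hC : ∀ (a b : ℕ → ℚ) (x z : ℚ_[p]) (M : ℕ),
      (∀ i, a (i + 1) ∈ Sp' p) → (∀ i, b (i + 1) ∈ Sp' p) → IsRubanValue p a x →
      IsRubanValue p b z → (∀ i ≤ M, a i = b i) → ‖x - z‖ ≤ C * ((p : ℝ)⁻¹ ^ 2) ^ M)
    {n M : ℕ} (hM : ∀ j < M, a (n + 1 + j) = w j) (hne : ∃ j, a (n + 1 + j) ≠ w j) :
    ∃ ξ x y : ℚ_[p], y ≠ 0 ∧ x = ξ * y ∧
      SizeLE f (e * g) ((e : ℚ_[p]) * β) x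
        ((1 + |(f : ℝ)| + |((e * g : ℤ) : ℝ)|) * (2 * e) * (B : ℝ) ^ (2 * (n + 1))) ∧
      SizeLE f (e * g) ((e : ℚ_[p]) * β) y
        ((1 + |(f : ℝ)| + |((e * g : ℤ) : ℝ)|) * (2 * e) * (B : ℝ) ^ (2 * (n + 1))) ∧
      ‖ξ - α‖ ≤ C * ((p : ℝ)⁻¹ ^ 2) ^ (n + M) ∧ IsAlgebraic ℚ ξ ∧
      (minpoly ℚ ξ).natDegree ≤ 2 ∧ ξ ≠ α := by
  set c : ℕ → ℚ := fun m => if m ≤ n then a m else w (m - (n + 1)) with hc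
  have hca : ∀ i < n + 1, c i = a i := fun i hi => if_pos (Nat.lt_succ_iff.1 hi)
  have hcw : (fun i => c (n + 1 + i)) = w := by
    funext i
    simp only [hc]
    rw [if_neg (by omega), Nat.add_sub_cancel_left]
  have hc0 : c 0 ∈ Sp p := by rwa [hca 0 n.succ_pos]
  have hc' : ∀ i, c (i + 1) ∈ Sp' p := by
    intro i
    simp only [hc]
    split_ifs
    exacts [ha i, hw _]
  obtain ⟨ξ, hξ⟩ := exists_isRubanValue hc'
  have h := hξ.mul_tail_eq hc' (n := n) (hcw.symm ▸ hβ)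
  have hdet := rubanR_mul_rubanQ_sub a n
  rw [rubanR_congr hca, rubanQ_congr hca, rubanR_congr fun i hi => hca i (Nat.lt_succ_of_lt hi),
    rubanQ_congr fun i hi => hca i (Nat.lt_succ_of_lt hi)] at h
  have hne0 : (rubanQ a (n + 1) : ℚ_[p]) * β + rubanQ a n ≠ 0 := by
    intro h0
    rw [h0, mul_zero] at h
    have hdet' : (rubanR a (n + 1) * rubanQ a n - rubanR a n * rubanQ a (n + 1) : ℚ_[p]) =
        (-1) ^ (n + 1) := by exact_mod_cast congrArg Rat.cast hdet
    have : (-1 : ℚ_[p]) ^ (n + 1) = 0 := by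
      rw [← hdet']
      linear_combination (rubanR a (n + 1) : ℚ_[p]) * h0 + (rubanQ a (n + 1) : ℚ_[p]) * h
    exact pow_ne_zero _ (by norm_num) this
  have hB' : (B : ℚ_[p]) ≠ 0 := by exact_mod_cast hB0.ne'
  have he' : (e : ℚ_[p]) ≠ 0 := by exact_mod_cast he.ne'
  have hdeg := natDegree_minpoly_le_two_of_mobius (K := ℚ) (L := ℚ_[p]) (e := e) (f := f) (g := g)
    (u := rubanQ a (n + 1)) (v := rubanQ a n) (u' := rubanR a (n + 1)) (v' := rubanR a n)
    (β := β) (ξ := ξ) (by exact_mod_cast he.ne') (by simpa using hefg) (by simpa using hne0)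
    (by simpa using h)
  refine ⟨ξ, _, e * (B : ℚ_[p]) ^ (n + 1) * (rubanQ a (n + 1) * β + rubanQ a n),
    mul_ne_zero (mul_ne_zero he' (pow_ne_zero _ hB')) hne0, ?_,
    sizeLE_of_rec hB0 (exists_nat_eq_rubanR_mul_pow hB hb hab) he n,
    sizeLE_of_rec hB0 (exists_nat_eq_rubanQ_mul_pow hB hb hab) he n, ?_, hdeg.1.isAlgebraic,
    hdeg.2, ?_⟩
  · rw [← h]
    ring
  · refine hC c a ξ α (n + M) hc' ha hξ hα fun i hi => ?_
    rcases lt_or_ge i (n + 1) with hin | hin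
    · exact hca i hin
    · obtain ⟨j, rfl⟩ := Nat.exists_eq_add_of_le hin
      rw [hM j (by omega)]
      exact congrFun hcw j
  · rintro rfl
    obtain ⟨j, hj⟩ := hne
    apply hj
    rw [← congrFun hcw j, hξ.eq hc0 hc' ha0 ha hα]

end RubanApproximation

section Final

lemma exists_frequently_same_block {a : ℕ → ℚ} {B K : ℕ} {b : ℕ → ℕ} (hb : ∀ i, b i < B)
    (hab : ∀ i j, b i = b j → a i = a j) {n k : ℕ → ℕ} (hk : ∀ i, k i ≤ K) {P : ℕ → Prop}
    (hP : ∃ᶠ i in atTop, P i) :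
    ∃ i₀, ∃ᶠ i in atTop, P i ∧ k i = k i₀ ∧ ∀ j < k i₀, a (n i + j) = a (n i₀ + j) := by
  let G : ℕ → Fin (K + 1) × (Fin (K + 1) → Fin B) := fun i =>
    (⟨k i, Nat.lt_succ_iff.2 (hk i)⟩, fun j => ⟨b (n i + j), hb _⟩)
  obtain ⟨v, hv⟩ := frequently_exists.1 (hP.mono fun i hi => (⟨G i, hi, rfl⟩ : ∃ v, P i ∧ G i = v))
  obtain ⟨i₀, -, hi₀⟩ := hv.exists
  refine ⟨i₀, hv.mono fun i ⟨hi, hiv⟩ => ⟨hi, ?_⟩⟩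
  have h : G i = G i₀ := hiv.trans hi₀.symm
  refine ⟨congrArg (fun x => (x.1 : ℕ)) h, fun j hj => hab _ _ ?_⟩
  exact congrArg (fun x => (x.2 ⟨j, Nat.lt_succ_of_lt (hj.trans_le (hk i₀))⟩ : ℕ)) h

lemma exists_pos_forall_le_exp {q A θ K C : ℝ} (hq : 1 < q) (hA : 1 < A)
    (hθ : 4 * Real.log A / Real.log q - 1 < θ) (hC : 0 < C) :
    ∃ κ : ℝ, 0 < κ ∧ ∀ᶠ n : ℕ in atTop, ∀ M : ℕ, θ * (n + 1 : ℕ) ≤ M →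
      C * (q⁻¹ ^ 2) ^ (n + M) ≤ Real.exp (-((4 + κ) * (K + 2 * (n + 1 : ℕ) * Real.log A))) := by
  have hℓ := Real.log_pos hq
  have hL := Real.log_pos hA
  set ℓ := Real.log q with hℓq
  set L := Real.log A
  set μ := (1 + θ) * ℓ - 4 * L with hμ
  have hμ0 : 0 < μ := by
    have : 4 * L / ℓ < 1 + θ := by linarith
    rw [div_lt_iff₀ hℓ] at this
    linarith
  refine ⟨μ / (2 * L), by positivity, ?_⟩
  have hlim : Tendsto (fun n : ℕ => (n : ℝ) * μ) atTop atTop :=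
    tendsto_natCast_atTop_atTop.atTop_mul_const hμ0
  filter_upwards [hlim.eventually_ge_atTop ((4 + μ / (2 * L)) * K + Real.log C + 2 * ℓ)] with
    n hn M hM
  have e : C * (q⁻¹ ^ 2) ^ (n + M) = Real.exp (Real.log C - 2 * (n + M) * ℓ) := by
    rw [sub_eq_add_neg, Real.exp_add, Real.exp_log hC, ← pow_mul, inv_pow, Real.exp_neg]
    congr 2
    rw [show 2 * (n + M : ℝ) * ℓ = ((2 * (n + M) : ℕ) : ℝ) * ℓ by push_cast; ring,
      Real.exp_nat_mul, hℓq, Real.exp_log (zero_lt_one.trans hq)]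
  rw [e, Real.exp_le_exp]
  have h1 : θ * (n + 1 : ℕ) * ℓ ≤ M * ℓ := mul_le_mul_of_nonneg_right hM hℓ.le
  have h2 : (4 + μ / (2 * L)) * (K + 2 * (n + 1 : ℕ) * L) =
      (4 + μ / (2 * L)) * K + 8 * (n + 1 : ℕ) * L + (n + 1 : ℕ) * μ := by
    field_simp
    ring
  rw [h2]
  push_cast at h1 ⊢
  nlinarith

end Final

end Roth

open Roth in
/-- **Theorem 2.** A quasi-periodic, non-ultimately-periodic Ruban continued fraction with
partial quotients bounded by `A` in `p`-adic absolute value, bounded block lengths `k_i`,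
and `limsup λ_i / n_i > 4 log A / log p - 1`, has value that is quadratic irrational
or transcendental. -/
theorem ruban_quasiPeriodic_quadratic_or_transcendental
    (p : ℕ) [Fact p.Prime] (A : ℝ) (hA : (p : ℝ) ≤ A)
    (a : ℕ → ℚ) (ha0 : a 0 ∈ Sp p) (ha : ∀ i, 1 ≤ i → a i ∈ Sp' p)
    (n lam k : ℕ → ℕ)
    (hmono : StrictMono n) (hpos : 1 ≤ n 0)
    (hlam : ∀ i, 1 ≤ lam i) (hk : ∀ i, 1 ≤ k i)
    (hqp1 : ∀ i, n i + lam i * k i ≤ n (i + 1))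
    (hqp2 : ∀ i m, n i ≤ m → m + 1 ≤ n i + (lam i - 1) * k i → a (m + k i) = a m)
    (hbound : ∀ i, (padicNorm p (a i) : ℝ) ≤ A)
    (hkbound : ∃ K : ℕ, ∀ i, k i ≤ K)
    (hnper : ¬ UltimatelyPeriodic a)
    (hlimsup : 4 * Real.log A / Real.log p - 1 <
      Filter.limsup (fun i => (lam i : ℝ) / (n i : ℝ)) Filter.atTop)
    (α : ℚ_[p]) (hα : IsRubanValue p a α) :
    (minpoly ℚ α).natDegree = 2 ∨ Transcendental ℚ α := by
  have hp := one_lt_cast (p := p)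
  have hA1 : 1 < A := hp.trans_le hA
  have ha' : ∀ i, a (i + 1) ∈ Sp' p := fun i => ha _ (Nat.succ_pos i)
  by_contra! hcon
  obtain ⟨hdeg, halg⟩ := hcon
  have halg : IsAlgebraic ℚ α := not_not.1 halg
  obtain ⟨K, hK⟩ := hkbound
  obtain ⟨s, hsA, hAs⟩ := exists_nat_pow_near hA1.le hp
  have hs : p ≤ p ^ s := by
    refine Nat.le_self_pow ?_ _
    rintro rfl
    rw [zero_add, pow_one] at hAs
    linarith
  have hB0 : 0 < p ^ s := pow_pos (Fact.out : p.Prime).pos s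
  have hSp : ∀ i, a i ∈ Sp p := fun i => i.casesOn ha0 fun i => (ha' i).1
  have hbd : ∀ i, ∃ u < p * p ^ s, a i * (p ^ s : ℕ) = (u : ℕ) := fun i =>
    exists_nat_eq_mul_pow (hSp i) (by rw [Padic.eq_padicNorm]; exact (hbound i).trans_lt hAs)
  choose b hb hab using hbd
  have hB0' : ((p ^ s : ℕ) : ℚ) ≠ 0 := by exact_mod_cast hB0.ne'
  obtain ⟨θ, hθ, hθlim⟩ := exists_between hlimsup
  have hfreq : ∃ᶠ i in atTop, θ < (lam i : ℝ) / (n i : ℝ) :=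
    frequently_lt_of_lt_limsup (isCoboundedUnder_le_of_le atTop (x := 0) fun i => by positivity) hθlim
  obtain ⟨i₀, hi₀⟩ := exists_frequently_same_block (n := n) hb
    (fun i j hij => mul_right_cancel₀ hB0' (by rw [hab i, hab j, hij])) hK hfreq
  have hn1 : ∀ i, 1 ≤ n i := fun i => hpos.trans (hmono.monotone (Nat.zero_le i))
  set w : ℕ → ℚ := fun j => a (n i₀ + j % k i₀) with hw
  have hwS : ∀ j, w j ∈ Sp' p := fun j => ha _ ((hn1 i₀).trans (Nat.le_add_right _ _))
  obtain ⟨β, hβ⟩ := exists_isRubanValue (a := w) fun j => hwS (j + 1)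
  obtain ⟨e, f, g, he, hefg⟩ := hβ.exists_quadratic hB0 hs
    (fun j => hb (n i₀ + j % k i₀)) (fun j => hab _) hwS (hk i₀) (by simp)
  obtain ⟨C, hC0, hC⟩ := exists_norm_sub_le_of_agree (p := p)
  set T : ℝ := (1 + |(f : ℝ)| + |((e * g : ℤ) : ℝ)|) * (2 * e) with hT
  have he' : (0 : ℝ) < e := by exact_mod_cast he
  have hT0 : 0 < T := by positivity
  obtain ⟨κ, hκ, hκn⟩ := exists_pos_forall_le_exp (K := Real.log T) hp hA1 hθ hC0
  obtain ⟨c, C', hc, hheight⟩ := exists_heightGE halg hdeg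
  refine not_exists_good_approximations halg (s := f) (t := e * g) (ω := (e : ℚ_[p]) * β) ?_ hκ hc
    fun N => ?_
  · push_cast
    linear_combination (e : ℚ_[p]) * hefg
  have hn : Tendsto (fun i => n i - 1) atTop atTop :=
    (tendsto_sub_atTop_nat 1).comp hmono.tendsto_atTop
  have hlim : Tendsto (fun m : ℕ => Real.log T + 2 * ((m + 1 : ℕ) : ℝ) * Real.log A) atTop atTop :=
    tendsto_atTop_add_const_left _ _ (((tendsto_natCast_atTop_atTop.comp
      (tendsto_add_atTop_nat 1)).const_mul_atTop two_pos).atTop_mul_const (Real.log_pos hA1))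
  obtain ⟨i, ⟨hiθ, hik, hiw⟩, hiκ, hiN⟩ := (hi₀.and_eventually
    ((hn.eventually hκn).and ((hlim.comp hn).eventually_ge_atTop (max (max N 0) (C' / (3 * c)))))).exists
  obtain ⟨m, hm⟩ := Nat.exists_eq_add_of_le' (hn1 i)
  simp only [Function.comp_apply, hm, Nat.add_sub_cancel] at hiκ hiN
  set h := Real.log T + 2 * ((m + 1 : ℕ) : ℝ) * Real.log A with hh
  have hper : ∀ j < lam i * k i, a (m + 1 + j) = w j := by
    intro j hj
    rw [← hm, eq_add_mod_of_block (hk i) (hqp2 i) j hj, hik]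
    exact hiw _ (Nat.mod_lt _ (hk i₀))
  have hne : ∃ j, a (m + 1 + j) ≠ w j := by
    by_contra! hall
    refine hnper ⟨m + 1, k i₀, hk i₀, fun l hl => ?_⟩
    obtain ⟨j, rfl⟩ := Nat.exists_eq_add_of_le hl
    rw [add_assoc, hall, hall]
    simp [hw]
  obtain ⟨ξ, x, y, hy, hxy, hxs, hys, hξ, hξalg, hξdeg, hξα⟩ := exists_approximant ha0 ha' hwS hα hβ
    hB0 hs hb hab he hefg hC hper hne
  have hsize : T * ((p ^ s : ℕ) : ℝ) ^ (2 * (m + 1)) ≤ Real.exp h := by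
    rw [hh, Real.exp_add, Real.exp_log hT0,
      show 2 * ((m + 1 : ℕ) : ℝ) * Real.log A = ((2 * (m + 1) : ℕ) : ℝ) * Real.log A by push_cast; ring,
      Real.exp_nat_mul, Real.exp_log (zero_lt_one.trans hA1)]
    push_cast
    gcongr
  have hξ' : ‖ξ - α‖ ≤ Real.exp (-((4 + κ) * h)) := by
    refine hξ.trans (hiκ _ ?_)
    rw [lt_div_iff₀ (by exact_mod_cast hn1 i), hm] at hiθ
    refine hiθ.le.trans ?_
    exact_mod_cast Nat.le_mul_of_pos_right _ (hk i)
  have hh0 : 0 ≤ h := ((le_max_right _ _).trans (le_max_left _ _)).trans hiN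
  have hκh : 0 ≤ κ * h := mul_nonneg hκ.le hh0
  refine ⟨h, ((le_max_left _ _).trans (le_max_left _ _)).trans hiN, x, y, ξ, hy, hxy, hxs.mono hsize,
    hys.mono hsize, hξ', (hheight ξ hξalg hξdeg hξα ?_).mono ?_⟩
  · exact hξ'.trans (Real.exp_le_one_iff.2 (by linarith))
  · have h1 : C' ≤ h * (3 * c) := (div_le_iff₀ (by positivity)).1 ((le_max_right _ _).trans hiN)
    have h2 : Real.log ‖ξ - α‖ ≤ -((4 + κ) * h) :=
      (Real.log_le_iff_le_exp (norm_pos_iff.2 (sub_ne_zero.2 hξα))).2 hξ'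
    have h3 : c * Real.log ‖ξ - α‖ ≤ c * (-(4 * h)) :=
      mul_le_mul_of_nonneg_left (by linarith) hc.le
    linarith
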